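/- In the renormalization setting: for positive integers n, the crossing times s_n := t_{n+1} − t_n form a nondecreasing sequence, and s_n converges as n → ∞ to some T ∈ (0, 1/c₀); equivalently, the average speeds 1/s_n of the free boundary over the intervals [n, n+1] decrease to the limit 1/T > c₀. -/

import Mathlib

open MeasureTheory Set Filter

noncomputable section

/-- Condition (F1): `f` and `κ` are `C²`, 1-periodic in `x`, `f(x,0)=0`, and there is `θ > 0`
with `f(x,u) > 0` for `u > θ` and `κ(x) > θ`. -/
def CondF1 (f : ℝ → ℝ → ℝ) (κ : ℝ → ℝ) (θ : ℝ) : Prop :=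
  ContDiff ℝ 2 (Function.uncurry f) ∧ ContDiff ℝ 2 κ ∧
  (∀ x u, f (x + 1) u = f x u) ∧ (∀ x, κ (x + 1) = κ x) ∧
  (∀ x, f x 0 = 0) ∧ 0 < θ ∧ (∀ x u, θ < u → 0 < f x u) ∧ (∀ x, θ < κ x)

/-- `κ₀ := min κ` (over a period). -/
def kappaMin (κ : ℝ → ℝ) : ℝ := sInf (κ '' Icc 0 1)

/-- `κ⁰ := max κ` (over a period). -/
def kappaMax (κ : ℝ → ℝ) : ℝ := sSup (κ '' Icc 0 1)

/-- Condition (F2): existence of a compactly supported traveling subsolution profile `φ₀`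
with speed `c₀`. -/
def CondF2 (m : ℝ) (f : ℝ → ℝ → ℝ) (κ : ℝ → ℝ) (c₀ l₀ : ℝ) (φ₀ : ℝ → ℝ) : Prop :=
  0 < c₀ ∧ 0 < l₀ ∧ ContDiffOn ℝ 2 φ₀ (Icc (-l₀) l₀) ∧
  φ₀ (-l₀) = 0 ∧ φ₀ l₀ = 0 ∧ (∀ z ∈ Ioo (-l₀) l₀, 0 < φ₀ z) ∧
  c₀ < -(derivWithin φ₀ (Icc (-l₀) l₀) l₀) ∧
  ∀ (x : ℝ), ∀ z ∈ Icc (-l₀) l₀,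
    0 ≤ derivWithin (derivWithin (fun w => φ₀ w ^ m) (Icc (-l₀) l₀)) (Icc (-l₀) l₀) z
        + c₀ * derivWithin φ₀ (Icc (-l₀) l₀) z
        + f x (φ₀ z) * (κ x - φ₀ z)

/-- A (bounded, continuous) very weak solution of `u_t = (u^m)_{xx} + f(x,u)(κ(x)-u)`
on `ℝ × (0,τ)` with initial data `u₀`. -/
def VeryWeakSol (m : ℝ) (f : ℝ → ℝ → ℝ) (κ : ℝ → ℝ) (τ : ℝ)
    (u₀ : ℝ → ℝ) (u : ℝ → ℝ → ℝ) : Prop :=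
  ContinuousOn (fun q : ℝ × ℝ => u q.1 q.2) (univ ×ˢ Ioc (0:ℝ) τ) ∧
  (∃ M : ℝ, ∀ x : ℝ, ∀ t ∈ Ioc (0:ℝ) τ, |u x t| ≤ M) ∧
  ∀ φ : ℝ → ℝ → ℝ, ContDiff ℝ (⊤ : ℕ∞) (Function.uncurry φ) →
    HasCompactSupport (Function.uncurry φ) →
    ∫ x : ℝ, u x τ * φ x τ =
      (∫ x : ℝ, u₀ x * φ x 0)
      + (∫ t in Ioo (0:ℝ) τ, ∫ x : ℝ, f x (u x t) * (κ x - u x t) * φ x t)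
      + (∫ t in Ioo (0:ℝ) τ, ∫ x : ℝ,
          (u x t * deriv (fun s => φ x s) t + u x t ^ m * deriv (deriv (fun y => φ y t)) x))

/-- A global very weak solution: a very weak solution on `ℝ × (0,τ)` for every `τ > 0`. -/
def GlobalVeryWeakSol (m : ℝ) (f : ℝ → ℝ → ℝ) (κ : ℝ → ℝ)
    (u₀ : ℝ → ℝ) (u : ℝ → ℝ → ℝ) : Prop :=
  ∀ τ > (0:ℝ), VeryWeakSol m f κ τ u₀ u

/-- Left spatial derivative of the pressure `v = (m/(m-1)) u^{m-1}` at the point `z`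
(at time `t`). -/
def pressureDx (m : ℝ) (u : ℝ → ℝ → ℝ) (z t : ℝ) : ℝ :=
  derivWithin (fun y => (m / (m - 1)) * u y t ^ (m - 1)) (Iic z) z

/-- The renormalization setting: (F1), (F2), a positive 1-periodic stationary solution `p`
with `p ≥ κ₀` lying strictly above all translates of `φ₀`, a global very weak solution `u`
with Heaviside-type initial data `p·H(-x)` possessing a `C¹`, strictly increasing free
boundary `b → ∞` along which Darcy's law holds with nonnegative speed, and the crossing
times `ty y` defined by `b (ty y) = y` for `y > 0`. -/
def RenormSetting (m : ℝ) (f : ℝ → ℝ → ℝ) (κ : ℝ → ℝ) (θ c₀ l₀ : ℝ) (φ₀ p : ℝ → ℝ)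
    (u : ℝ → ℝ → ℝ) (b : ℝ → ℝ) (ty : ℝ → ℝ) : Prop :=
  CondF1 f κ θ ∧ CondF2 m f κ c₀ l₀ φ₀ ∧
  ContDiff ℝ 2 p ∧ (∀ x, 0 < p x) ∧ (∀ x, p (x + 1) = p x) ∧
  (∀ x, deriv (deriv (fun y => p y ^ m)) x + f x (p x) * (κ x - p x) = 0) ∧
  (∀ x, kappaMin κ ≤ p x) ∧
  (∀ x₀ : ℝ, ∀ x ∈ Icc (x₀ - l₀) (x₀ + l₀), φ₀ (x - x₀) < p x) ∧
  GlobalVeryWeakSol m f κ (fun x => if x ≤ 0 then p x else 0) u ∧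
  (∀ t > (0:ℝ), DifferentiableAt ℝ b t) ∧
  ContinuousOn (deriv b) (Ioi 0) ∧
  (∀ t > (0:ℝ), ∀ x : ℝ, (x < b t → 0 < u x t) ∧ (b t ≤ x → u x t = 0)) ∧
  StrictMonoOn b (Ioi 0) ∧
  Tendsto b atTop atTop ∧
  (∀ x t : ℝ, 0 < t → 0 < u x t →
      DifferentiableAt ℝ (fun s => u x s) t ∧
      DifferentiableAt ℝ (fun y => u y t) x ∧
      DifferentiableAt ℝ (deriv (fun y => u y t)) x) ∧
  (∀ t > (0:ℝ), deriv b t = -(pressureDx m u (b t) t) ∧ 0 ≤ deriv b t) ∧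
  (∀ y > (0:ℝ), 0 < ty y ∧ b (ty y) = y)

/-! ### Discrete calculus on `ℤ` -/

/-- The second difference of a sequence indexed by `ℤ`. -/
def lap (v : ℤ → ℝ) (i : ℤ) : ℝ := v (i + 1) - 2 * v i + v (i - 1)

/-- One step of the explicit scheme `φ + b Δφ + c φ`. -/
def dualStep (b c φ : ℤ → ℝ) (i : ℤ) : ℝ := φ i + b i * lap φ i + c i * φ i

theorem summable_of_box {f : ℤ → ℝ} (J : ℤ) (h : ∀ i, J < |i| → f i = 0) : Summable f := by
  apply summable_of_hasFiniteSupport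
  refine Set.Finite.subset (Set.finite_Icc (-J) J) ?_
  intro i hi
  by_contra hc
  apply hi
  apply h
  by_contra hle
  exact hc (Set.mem_Icc.2 (abs_le.1 (not_lt.1 hle)))

theorem tsum_shift_add (T : ℤ → ℝ) : ∑' i, T (i + 1) = ∑' i, T i :=
  (Equiv.addRight (1 : ℤ)).tsum_eq T

theorem tsum_shift_sub (T : ℤ → ℝ) : ∑' i, T (i - 1) = ∑' i, T i :=
  (Equiv.subRight (1 : ℤ)).tsum_eq T

theorem summable_shift_add {T : ℤ → ℝ} (h : Summable T) : Summable fun i => T (i + 1) :=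
  (Equiv.addRight (1 : ℤ)).summable_iff.2 h

theorem summable_shift_sub {T : ℤ → ℝ} (h : Summable T) : Summable fun i => T (i - 1) :=
  (Equiv.subRight (1 : ℤ)).summable_iff.2 h

theorem tsum_le_of_telescope {f g T : ℤ → ℝ} (hf : Summable f) (hg : Summable g)
    (hT : Summable T) (h : ∀ i, f i ≤ g i + (T (i + 1) - T i)) : ∑' i, f i ≤ ∑' i, g i := by
  have h1 : Summable fun i => T (i + 1) - T i := (summable_shift_add hT).sub hT
  have h2 := hf.tsum_le_tsum h (hg.add h1)
  rw [hg.tsum_add h1, (summable_shift_add hT).tsum_sub hT, tsum_shift_add] at h2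
  linarith

/-- Finitely supported sequences vanish together with their neighbours far away. -/
theorem box_neighbours {φ : ℤ → ℝ} {J : ℤ} (hφ : ∀ i, J < |i| → φ i = 0) {i : ℤ}
    (hi : J + 2 < |i|) : φ i = 0 ∧ φ (i + 1) = 0 ∧ φ (i - 1) = 0 ∧ φ (i + 1 + 1) = 0 := by
  refine ⟨hφ _ ?_, hφ _ ?_, hφ _ ?_, hφ _ ?_⟩ <;>
  · rcases abs_cases i with h | h <;>
    rw [lt_abs] <;> omega

theorem energy_pointwise {b l x : ℝ} (hb : 0 < b) (hb8 : b ≤ 1 / 8) :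
    -2 * (b * l + x) * l + 4 * (b * l + x) ^ 2 + 1 / 2 * (b * l ^ 2) ≤ 3 * (x ^ 2 / b) := by
  have hx : x ^ 2 / b * b = x ^ 2 := by field_simp
  set y := x ^ 2 / b with hy
  have hy0 : 0 ≤ y := by positivity
  have h1 : 8 * x ^ 2 ≤ y := by
    rw [← hx]; nlinarith
  have h2 : 8 * (b * l) ^ 2 ≤ b * l ^ 2 := by
    have : 0 ≤ b * l ^ 2 := by positivity
    nlinarith
  have h3 : 4 * (b * l + x) ^ 2 ≤ 8 * (b * l) ^ 2 + 8 * x ^ 2 := by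
      nlinarith [sq_nonneg (b * l - x)]
  have h4 : -2 * x * l ≤ 1 / 2 * (b * l ^ 2) + 2 * y := by
    have : 0 ≤ (b * l + 2 * x) ^ 2 / (2 * b) := by positivity
    have h5 : (b * l + 2 * x) ^ 2 / (2 * b) = 1 / 2 * (b * l ^ 2) + 2 * y + 2 * x * l := by
      rw [hy]; field_simp; ring
    linarith
  nlinarith

theorem energy_step {φ b c : ℤ → ℝ} (J : ℤ) (hφ : ∀ i, J < |i| → φ i = 0)
    (hb : ∀ i, 0 < b i) (hb8 : ∀ i, b i ≤ 1 / 8) :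
    ∑' i, (dualStep b c φ (i + 1) - dualStep b c φ i) ^ 2 + 1 / 2 * ∑' i, b i * lap φ i ^ 2
      ≤ ∑' i, (φ (i + 1) - φ i) ^ 2 + 3 * ∑' i, (c i * φ i) ^ 2 / b i := by
  have s1 : Summable fun i => (dualStep b c φ (i + 1) - dualStep b c φ i) ^ 2 := by
    apply summable_of_box (J + 2)
    intro i hi
    obtain ⟨h0, h1, h2, h3⟩ := box_neighbours hφ hi
    simp [dualStep, lap, h0, h1, h2, h3]
  have s2 : Summable fun i => b i * lap φ i ^ 2 := by
    apply summable_of_box (J + 2)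
    intro i hi
    obtain ⟨h0, h1, h2, h3⟩ := box_neighbours hφ hi
    simp [lap, h0, h1, h2]
  have s3 : Summable fun i => (φ (i + 1) - φ i) ^ 2 := by
    apply summable_of_box (J + 2)
    intro i hi
    obtain ⟨h0, h1, h2, h3⟩ := box_neighbours hφ hi
    simp [h0, h1]
  have s4 : Summable fun i => (c i * φ i) ^ 2 / b i := by
    apply summable_of_box (J + 2)
    intro i hi
    obtain ⟨h0, h1, h2, h3⟩ := box_neighbours hφ hi
    simp [h0]
  rw [← tsum_mul_left, ← tsum_mul_left, ← s1.tsum_add (s2.mul_left _),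
    ← s3.tsum_add (s4.mul_left _)]
  let v : ℤ → ℝ := fun i => b i * lap φ i + c i * φ i
  let T : ℤ → ℝ := fun i => 2 * v i * (φ i - φ (i - 1)) + 2 * v i ^ 2
  refine tsum_le_of_telescope (T := T) (s1.add (s2.mul_left _)) (s3.add (s4.mul_left _)) ?_ ?_
  · apply summable_of_box (J + 2)
    intro i hi
    obtain ⟨h0, h1, h2, h3⟩ := box_neighbours hφ hi
    simp [T, v, lap, h0, h1, h2]
  · intro i
    have key := energy_pointwise (l := lap φ i) (x := c i * φ i) (hb i) (hb8 i)
    have e1 : dualStep b c φ (i + 1) - dualStep b c φ i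
        = (φ (i + 1) - φ i) + (v (i + 1) - v i) := by
      simp only [dualStep, v]; ring
    rw [e1]
    have e2 : (v (i + 1) - v i) ^ 2 ≤ 4 * v i ^ 2 + 2 * (v (i + 1) ^ 2 - v i ^ 2) := by
      nlinarith [sq_nonneg (v (i + 1) + v i)]
    have e3 : lap φ i = (φ (i + 1) - φ i) - (φ i - φ (i - 1)) := by simp only [lap]; ring
    have e4 : b i * lap φ i + c i * φ i = v i := rfl
    rw [e4] at key
    simp only [T, add_sub_cancel_right]
    have e5 : 2 * (φ (i + 1) - φ i) * (v (i + 1) - v i)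
        = -2 * v i * lap φ i + 2 * v (i + 1) * (φ (i + 1) - φ i) - 2 * v i * (φ i - φ (i - 1)) := by
      rw [e3]; ring
    nlinarith

theorem dualStep_eq (b c φ : ℤ → ℝ) (i : ℤ) :
    dualStep b c φ i = (1 - 2 * b i + c i) * φ i + b i * φ (i + 1) + b i * φ (i - 1) := by
  simp only [dualStep, lap]; ring

theorem dualStep_nonneg {b c φ : ℤ → ℝ} (hb : ∀ i, 0 ≤ b i) (hb8 : ∀ i, b i ≤ 1 / 8)
    (hc : ∀ i, |c i| ≤ 1 / 4) (hφ : ∀ i, 0 ≤ φ i) (i : ℤ) : 0 ≤ dualStep b c φ i := by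
  rw [dualStep_eq]
  have h1 : 0 ≤ 1 - 2 * b i + c i := by
    have := hb8 i; have := (abs_le.1 (hc i)).1; linarith
  have := mul_nonneg h1 (hφ i)
  have := mul_nonneg (hb i) (hφ (i + 1))
  have := mul_nonneg (hb i) (hφ (i - 1))
  linarith

/-- A sequence changing sign at most once, from nonnegative to nonpositive. -/
def PosNeg (φ : ℤ → ℝ) : Prop := ∃ j : ℤ, (∀ i < j, 0 ≤ φ i) ∧ ∀ i ≥ j, φ i ≤ 0

theorem PosNeg.dualStep {b c φ : ℤ → ℝ} (hb : ∀ i, 0 ≤ b i) (hb8 : ∀ i, b i ≤ 1 / 8)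
    (hc : ∀ i, |c i| ≤ 1 / 4) (hφ : PosNeg φ) : PosNeg (dualStep b c φ) := by
  obtain ⟨j, hp, hn⟩ := hφ
  have hd : ∀ i, 1 / 2 ≤ 1 - 2 * b i + c i := fun i => by
    have := hb8 i; have := (abs_le.1 (hc i)).1; linarith
  have A : ∀ i < j - 1, 0 ≤ _root_.dualStep b c φ i := fun i hi => by
    rw [dualStep_eq]
    have := mul_nonneg (by linarith [hd i] : 0 ≤ 1 - 2 * b i + c i) (hp i (by omega))
    have := mul_nonneg (hb i) (hp (i + 1) (by omega))
    have := mul_nonneg (hb i) (hp (i - 1) (by omega))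
    linarith
  have B : ∀ i ≥ j + 1, _root_.dualStep b c φ i ≤ 0 := fun i hi => by
    rw [dualStep_eq]
    have := mul_nonneg (by linarith [hd i] : 0 ≤ 1 - 2 * b i + c i)
      (neg_nonneg.2 (hn i (by omega)))
    have := mul_nonneg (hb i) (neg_nonneg.2 (hn (i + 1) (by omega)))
    have := mul_nonneg (hb i) (neg_nonneg.2 (hn (i - 1) (by omega)))
    linarith
  by_cases h1 : 0 ≤ _root_.dualStep b c φ (j - 1)
  · by_cases h2 : 0 ≤ _root_.dualStep b c φ j
    · refine ⟨j + 1, fun i hi => ?_, B⟩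
      rcases (by omega : i < j - 1 ∨ i = j - 1 ∨ i = j) with h | h | h
      · exact A i h
      · exact h ▸ h1
      · exact h ▸ h2
    · refine ⟨j, fun i hi => ?_, fun i hi => ?_⟩
      · rcases (by omega : i < j - 1 ∨ i = j - 1) with h | h
        · exact A i h
        · exact h ▸ h1
      · rcases (by omega : i = j ∨ i ≥ j + 1) with h | h
        · exact h ▸ (not_le.1 h2).le
        · exact B i h
  · refine ⟨j - 1, A, fun i hi => ?_⟩
    rcases (by omega : i = j - 1 ∨ i = j ∨ i ≥ j + 1) with h | h | h
    · exact h ▸ (not_le.1 h1).le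
    · rw [h]
      by_contra h2
      rw [not_le] at h1 h2
      rw [dualStep_eq] at h1 h2
      have e : j - 1 + 1 = j := by ring
      rw [e] at h1
      have p1 := hp (j - 1) (by omega)
      have p2 := hp (j - 1 - 1) (by omega)
      have n1 := hn j le_rfl
      have n2 := hn (j + 1) (by omega)
      have q1 := mul_nonneg (hb (j - 1)) p2
      have q2 := mul_nonneg (hb j) (neg_nonneg.2 n2)
      have r1 := mul_le_mul_of_nonneg_right (hd (j - 1)) p1
      have r2 := mul_le_mul_of_nonneg_right (hd j) (neg_nonneg.2 n1)
      have r3 := mul_le_mul_of_nonneg_right (hb8 (j - 1)) (neg_nonneg.2 n1)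
      have r4 := mul_le_mul_of_nonneg_right (hb8 j) p1
      nlinarith
    · exact B i h

theorem exp_add_exp_neg_le {s : ℝ} (hs : |s| ≤ 1) : Real.exp s + Real.exp (-s) - 2 ≤ 2 * s ^ 2 := by
  have h1 := (abs_le.1 (Real.abs_exp_sub_one_sub_id_le hs)).2
  have h2 := (abs_le.1 (Real.abs_exp_sub_one_sub_id_le (x := -s) (by rwa [abs_neg]))).2
  nlinarith

theorem dualStep_exp_le {b c φ : ℤ → ℝ} {Q s C : ℝ} (hb : ∀ i, 0 ≤ b i) (hb8 : ∀ i, b i ≤ 1 / 8)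
    (hc : ∀ i, |c i| ≤ C) (hC : C ≤ 1 / 4) (hs : |s| ≤ 1) (hQ : 0 ≤ Q)
    (hφ : ∀ i : ℤ, φ i ≤ Q * Real.exp (s * i)) (i : ℤ) :
    dualStep b c φ i ≤ (1 + s ^ 2 / 4 + C) * Q * Real.exp (s * i) := by
  rw [dualStep_eq]
  have hc' := abs_le.1 (hc i)
  have h1 : 0 ≤ 1 - 2 * b i + c i := by
    have := hb8 i; linarith
  have e1 : Real.exp (s * ((i + 1 : ℤ) : ℝ)) = Real.exp (s * i) * Real.exp s := by
    rw [← Real.exp_add]; push_cast; ring_nf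
  have e2 : Real.exp (s * ((i - 1 : ℤ) : ℝ)) = Real.exp (s * i) * Real.exp (-s) := by
    rw [← Real.exp_add]; push_cast; ring_nf
  have k1 := mul_le_mul_of_nonneg_left (hφ i) h1
  have k2 := mul_le_mul_of_nonneg_left (hφ (i + 1)) (hb i)
  have k3 := mul_le_mul_of_nonneg_left (hφ (i - 1)) (hb i)
  rw [e1] at k2; rw [e2] at k3
  have hE : 0 ≤ Q * Real.exp (s * i) := by positivity
  have h2 := exp_add_exp_neg_le hs
  have h3 : b i * (Real.exp s + Real.exp (-s) - 2) ≤ s ^ 2 / 4 := by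
    calc _ ≤ b i * (2 * s ^ 2) := mul_le_mul_of_nonneg_left h2 (hb i)
      _ ≤ 1 / 8 * (2 * s ^ 2) := mul_le_mul_of_nonneg_right (hb8 i) (by positivity)
      _ = _ := by ring
  have h4 : (1 - 2 * b i + c i + b i * Real.exp s + b i * Real.exp (-s)) ≤ 1 + s ^ 2 / 4 + C := by
    linarith
  have := mul_le_mul_of_nonneg_right h4 hE
  nlinarith

/-- The exponential weight `e^{-h|i|}`. -/
def wt (h : ℝ) (i : ℤ) : ℝ := Real.exp (-(h * |(i : ℝ)|))

theorem wt_pos (h : ℝ) (i : ℤ) : 0 < wt h i := Real.exp_pos _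

theorem wt_le_one {h : ℝ} (hh : 0 ≤ h) (i : ℤ) : wt h i ≤ 1 := by
  rw [wt, Real.exp_le_one_iff]; have := mul_nonneg hh (abs_nonneg (i : ℝ)); linarith

theorem wt_hasSum {h : ℝ} (hh : 0 < h) : Summable (wt h) ∧
    ∑' i, wt h i ≤ 2 / (1 - Real.exp (-h)) := by
  have hr : Real.exp (-h) < 1 := Real.exp_lt_one_iff.2 (by linarith)
  have hr0 := (Real.exp_pos (-h)).le
  have e1 : ∀ n : ℕ, wt h (n : ℤ) = Real.exp (-h) ^ n := fun n => by
    rw [wt, ← Real.exp_nat_mul]; congr 1; simp; ring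
  have e2 : ∀ n : ℕ, wt h (-(n + 1 : ℤ)) = Real.exp (-h) * Real.exp (-h) ^ n := fun n => by
    rw [wt, ← Real.exp_nat_mul, ← Real.exp_add]; congr 1
    push_cast
    rw [abs_neg, abs_of_nonneg (by positivity)]; ring
  have g := hasSum_geometric_of_lt_one hr0 hr
  have s1 : HasSum (fun n : ℕ => wt h (n : ℤ)) (1 - Real.exp (-h))⁻¹ := by simp_rw [e1]; exact g
  have s2 : HasSum (fun n : ℕ => wt h (-(n + 1 : ℤ)))
      (Real.exp (-h) * (1 - Real.exp (-h))⁻¹) := by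
    simp_rw [e2]; exact g.mul_left _
  have s := HasSum.of_nat_of_neg_add_one s1 s2
  refine ⟨s.summable, s.tsum_eq ▸ ?_⟩
  have : 0 < (1 - Real.exp (-h))⁻¹ := by rw [inv_pos]; linarith
  rw [div_eq_mul_inv]
  nlinarith

theorem wt_summable {h : ℝ} (hh : 0 < h) : Summable (wt h) := (wt_hasSum hh).1

theorem wt_tsum_le {h : ℝ} (hh : 0 < h) (h1 : h ≤ 1) : h * ∑' i, wt h i ≤ 4 := by
  have hr : Real.exp (-h) < 1 := Real.exp_lt_one_iff.2 (by linarith)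
  have h2 := (abs_le.1 (Real.abs_exp_sub_one_sub_id_le (x := -h)
    (by rw [abs_neg, abs_of_pos hh]; exact h1))).2
  have h4 : h / 2 ≤ 1 - Real.exp (-h) := by
    have := Real.add_one_le_exp h
    have h5 : Real.exp (-h) ≤ 1 / (1 + h) := by
      rw [Real.exp_neg, ← one_div]
      exact one_div_le_one_div_of_le (by linarith) (by linarith)
    have h6 : 1 / (1 + h) ≤ 1 - h / 2 := by
      rw [div_le_iff₀ (by linarith)]; nlinarith
    linarith
  calc h * ∑' i, wt h i ≤ h * (2 / (1 - Real.exp (-h))) :=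
        mul_le_mul_of_nonneg_left (wt_hasSum hh).2 hh.le
    _ ≤ 4 := by
        rw [mul_div_assoc', div_le_iff₀ (by linarith)]; linarith

theorem wt_sub_one_le {h : ℝ} (hh : 0 < h) (h1 : h ≤ 1) (i : ℤ) : wt h (i - 1) ≤ 3 * wt h i := by
  have e : Real.exp h ≤ 3 := (Real.exp_le_exp.2 h1).trans (by linarith [Real.exp_one_lt_d9])
  calc wt h (i - 1) ≤ Real.exp (h + -(h * |(i : ℝ)|)) := by
        rw [wt, Real.exp_le_exp]
        push_cast
        have : |(i : ℝ)| ≤ |(i : ℝ) - 1| + 1 := by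
          have := abs_add_le ((i : ℝ) - 1) 1
          simpa using this
        nlinarith
    _ = Real.exp h * wt h i := by rw [Real.exp_add, wt]
    _ ≤ _ := mul_le_mul_of_nonneg_right e (wt_pos h i).le

theorem le_wt_of_exp {φ Q h : ℝ} {i : ℤ} (h1 : φ ≤ Q * Real.exp (h * i))
    (h2 : φ ≤ Q * Real.exp (-h * i)) : φ ≤ Q * wt h i := by
  rw [wt]
  rcases abs_cases (i : ℝ) with ⟨e, -⟩ | ⟨e, -⟩
  · rw [e, ← neg_mul]; exact h2
  · rw [e]; convert h1 using 3; ring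

/-! ### Backward dual iteration -/

theorem downward_induction {N : ℕ} {P : ℕ → Prop} (hN : P N) (hs : ∀ n < N, P (n + 1) → P n) :
    ∀ n ≤ N, P n := by
  intro n hn
  induction hn using Nat.decreasingInduction with
  | self => exact hN
  | of_succ k hk ih => exact hs k hk ih

/-- `φ` solves the backward scheme with coefficients `b`, `c` on the time levels `0, …, N`. -/
def IsDual (N : ℕ) (b c φ : ℕ → ℤ → ℝ) : Prop :=
  ∀ n < N, φ n = dualStep (b n) (c n) (φ (n + 1))

theorem exists_isDual (N : ℕ) (b c : ℕ → ℤ → ℝ) (ψ : ℤ → ℝ) :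
    ∃ φ, IsDual N b c φ ∧ φ N = ψ := by
  let g : ℕ → ℤ → ℝ := fun m => Nat.rec ψ (fun m φ =>
      dualStep (b (N - (m + 1))) (c (N - (m + 1))) φ) m
  refine ⟨fun n => g (N - n), fun n hn => ?_, by simp [g]⟩
  have e : N - n = (N - (n + 1)) + 1 := by omega
  have e2 : N - (N - (n + 1) + 1) = n := by omega
  show g (N - n) = dualStep (b n) (c n) (g (N - (n + 1)))
  rw [e]
  show dualStep (b (N - (N - (n + 1) + 1))) (c (N - (N - (n + 1) + 1))) (g (N - (n + 1))) = _
  rw [e2]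

theorem dualStep_comb (b c φ ψ : ℤ → ℝ) (x y : ℝ) (i : ℤ) :
    dualStep b c (fun i => x * φ i - y * ψ i) i = x * dualStep b c φ i - y * dualStep b c ψ i := by
  simp only [dualStep, lap]; ring

theorem IsDual.comb {N : ℕ} {b c φ ψ : ℕ → ℤ → ℝ} (h1 : IsDual N b c φ) (h2 : IsDual N b c ψ)
    (x y : ℝ) : IsDual N b c fun n i => x * φ n i - y * ψ n i := by
  intro n hn
  funext i
  rw [dualStep_comb, ← h1 n hn, ← h2 n hn]

theorem IsDual.box {N : ℕ} {b c φ : ℕ → ℤ → ℝ} (h : IsDual N b c φ) {J : ℤ}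
    (hJ : ∀ i, J < |i| → φ N i = 0) : ∃ J' : ℤ, ∀ n ≤ N, ∀ i, J' < |i| → φ n i = 0 := by
  have key : ∀ n ≤ N, ∀ i, J + 2 * (N - n : ℕ) < |i| → φ n i = 0 := by
    apply downward_induction
    · intro i hi; apply hJ; simpa using hi
    · intro n hn ih i hi
      have e : ((N - n : ℕ) : ℤ) = (N - (n + 1) : ℕ) + 1 := by omega
      obtain ⟨h0, h1, h2, -⟩ := box_neighbours ih (i := i) (by omega)
      rw [h n hn]; simp [dualStep, lap, h0, h1, h2]
  refine ⟨J + 2 * N, fun n hn i hi => key n hn i ?_⟩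
  have : ((N - n : ℕ) : ℤ) ≤ N := by omega
  omega

theorem IsDual.nonneg {N : ℕ} {b c φ : ℕ → ℤ → ℝ} (h : IsDual N b c φ)
    (hb : ∀ n i, 0 ≤ b n i) (hb8 : ∀ n i, b n i ≤ 1 / 8)
    (hc : ∀ n i, |c n i| ≤ 1 / 4) (hφ : ∀ i, 0 ≤ φ N i) : ∀ n ≤ N, ∀ i, 0 ≤ φ n i :=
  downward_induction hφ fun n hn ih i => by
    rw [h n hn]; exact dualStep_nonneg (hb n) (hb8 n) (hc n) ih i

theorem IsDual.posNeg {N : ℕ} {b c φ : ℕ → ℤ → ℝ} (h : IsDual N b c φ)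
    (hb : ∀ n i, 0 ≤ b n i) (hb8 : ∀ n i, b n i ≤ 1 / 8)
    (hc : ∀ n i, |c n i| ≤ 1 / 4) (hφ : PosNeg (φ N)) : PosNeg (φ 0) :=
  downward_induction (P := fun n => PosNeg (φ n)) hφ (fun n hn ih => by
    rw [h n hn]; exact PosNeg.dualStep (hb n) (hb8 n) (hc n) ih) 0 (Nat.zero_le _)

theorem IsDual.exp_le {N : ℕ} {b c φ : ℕ → ℤ → ℝ} (h : IsDual N b c φ)
    (hb : ∀ n i, 0 ≤ b n i) (hb8 : ∀ n i, b n i ≤ 1 / 8) {C Q s : ℝ}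
    (hc : ∀ n i, |c n i| ≤ C) (hC : C ≤ 1 / 4) (hs : |s| ≤ 1) (hQ : 0 ≤ Q)
    (hφ : ∀ i : ℤ, φ N i ≤ Q * Real.exp (s * i)) :
    ∀ n ≤ N, ∀ i, φ n i ≤ (1 + s ^ 2 / 4 + C) ^ N * Q * Real.exp (s * i) := by
  have hC0 : 0 ≤ C := (abs_nonneg _).trans (hc 0 0)
  have hρ : 1 ≤ 1 + s ^ 2 / 4 + C := by nlinarith [sq_nonneg s]
  have key : ∀ n ≤ N, ∀ i, φ n i ≤ (1 + s ^ 2 / 4 + C) ^ (N - n) * Q * Real.exp (s * i) := by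
    apply downward_induction
    · simpa using hφ
    · intro n hn ih i
      rw [h n hn]
      refine (dualStep_exp_le (hb n) (hb8 n) (hc n) hC hs (by positivity) ih i).trans_eq ?_
      have e : N - n = (N - (n + 1)) + 1 := by omega
      rw [e, pow_succ]; ring
  intro n hn i
  refine (key n hn i).trans ?_
  gcongr
  omega

/-- The sup-bound for the dual solution. -/
theorem IsDual.le_wt {N : ℕ} {b c φ : ℕ → ℤ → ℝ} (h : IsDual N b c φ)
    (hb : ∀ n i, 0 ≤ b n i) (hb8 : ∀ n i, b n i ≤ 1 / 8) {μ L k τ R₀ hh : ℝ} (hμ : 0 < μ)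
    (hL : 0 ≤ L) (hh0 : 0 < hh) (hh1 : hh ≤ 1) (hk : μ * hh ^ 2 = k) (hN : N * k = τ)
    (hc : ∀ n i, |c n i| ≤ k * L) (hC : k * L ≤ 1 / 4)
    (hφ1 : ∀ i, φ N i ≤ 1) (hφ0 : ∀ i : ℤ, R₀ < |i * hh| → φ N i = 0) :
    ∀ n ≤ N, ∀ i, φ n i ≤ Real.exp (R₀ + τ * (1 / (4 * μ) + L)) * wt hh i := by
  have hk0 : 0 < k := hk ▸ by positivity
  have base : ∀ s : ℝ, |s| = hh → ∀ i : ℤ, φ N i ≤ Real.exp R₀ * Real.exp (s * i) := by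
    intro s hs i
    by_cases hi : R₀ < |i * hh|
    · rw [hφ0 i hi]; positivity
    · refine (hφ1 i).trans ?_
      rw [← Real.exp_add, Real.one_le_exp_iff]
      have : |s * i| ≤ R₀ := by rw [abs_mul, hs]; rw [abs_mul, abs_of_pos hh0] at hi; linarith
      linarith [(abs_le.1 this).1]
  have step : ∀ s : ℝ, |s| = hh → ∀ n ≤ N, ∀ i : ℤ,
      φ n i ≤ Real.exp (R₀ + τ * (1 / (4 * μ) + L)) * Real.exp (s * i) := by
    intro s hs n hn i
    refine (h.exp_le hb hb8 hc hC (by rw [hs]; exact hh1) (Real.exp_pos R₀).le (base s hs) n hn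
      i).trans ?_
    refine mul_le_mul_of_nonneg_right ?_ (Real.exp_pos _).le
    rw [Real.exp_add, mul_comm]
    refine mul_le_mul_of_nonneg_left ?_ (Real.exp_pos _).le
    have e : 1 + s ^ 2 / 4 + k * L ≤ Real.exp (k * (1 / (4 * μ) + L)) := by
      have e1 : s ^ 2 / 4 = k * (1 / (4 * μ)) := by
        rw [← sq_abs, hs, ← hk]; field_simp
      rw [e1]; linarith [Real.add_one_le_exp (k * (1 / (4 * μ) + L))]
    calc _ ≤ Real.exp (k * (1 / (4 * μ) + L)) ^ N := by
            apply pow_le_pow_left₀ _ e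
            positivity
      _ = _ := by rw [← Real.exp_nat_mul, ← hN]; ring_nf
  intro n hn i
  apply le_wt_of_exp (step hh (abs_of_pos hh0) n hn i)
  exact step (-hh) (by rw [abs_neg, abs_of_pos hh0]) n hn i

/-- Energy estimate for the dual solution. -/
theorem IsDual.energy {N : ℕ} {b c φ : ℕ → ℤ → ℝ} (h : IsDual N b c φ) {J : ℤ}
    (hJ : ∀ n ≤ N, ∀ i, J < |i| → φ n i = 0)
    (hb : ∀ n i, 0 < b n i) (hb8 : ∀ n i, b n i ≤ 1 / 8) {F : ℝ}
    (hF : ∀ n < N, ∑' i, (c n i * φ (n + 1) i) ^ 2 / b n i ≤ F) :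
    (∀ n ≤ N, ∑' i, (φ n (i + 1) - φ n i) ^ 2 ≤ ∑' i, (φ N (i + 1) - φ N i) ^ 2 + 3 * N * F) ∧
    ∑ n ∈ Finset.range N, ∑' i, b n i * lap (φ (n + 1)) i ^ 2
      ≤ 2 * (∑' i, (φ N (i + 1) - φ N i) ^ 2 + 3 * N * F) := by
  have nn1 : ∀ n, 0 ≤ ∑' i, (φ n (i + 1) - φ n i) ^ 2 := fun n => tsum_nonneg fun i => sq_nonneg _
  have nn2 : ∀ n, 0 ≤ ∑' i, b n i * lap (φ (n + 1)) i ^ 2 := fun n =>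
    tsum_nonneg fun i => mul_nonneg (hb n i).le (sq_nonneg _)
  have key : ∀ n ≤ N, ∑' i, (φ n (i + 1) - φ n i) ^ 2
      + 1 / 2 * ∑ m ∈ Finset.Ico n N, ∑' i, b m i * lap (φ (m + 1)) i ^ 2
      ≤ ∑' i, (φ N (i + 1) - φ N i) ^ 2 + 3 * (N - n : ℝ) * F := by
    apply downward_induction
    · simp
    · intro n hn ih
      have s := energy_step (b := b n) (c := c n) J (hJ (n + 1) hn) (hb n) (hb8 n)
      rw [← h n hn] at s
      rw [Finset.sum_eq_sum_Ico_succ_bot hn]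
      have := hF n hn
      push_cast at ih
      linarith
  have hF0 : 0 < N → 0 ≤ F := fun h0 => (tsum_nonneg fun i => by
    have := (hb 0 i).le; positivity).trans (hF 0 h0)
  constructor
  · intro n hn
    have := key n hn
    have h2 : 0 ≤ ∑ m ∈ Finset.Ico n N, ∑' i, b m i * lap (φ (m + 1)) i ^ 2 :=
      Finset.sum_nonneg fun m _ => nn2 m
    rcases Nat.eq_zero_or_pos N with h0 | h0
    · subst h0; obtain rfl : n = 0 := by omega
      simp
    · have := hF0 h0
      have : 0 ≤ (n : ℝ) * F := by positivity
      linarith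
  · have := key 0 (Nat.zero_le _)
    have := nn1 0
    rw [Finset.range_eq_Ico]
    push_cast at *
    linarith

theorem mul_le_of_sq_le {a x y l : ℝ} (ha : 0 ≤ a) (hy : 0 ≤ y) (h : x ^ 2 ≤ 4 * a * y) :
    x * l ≤ a * l ^ 2 + y := by
  rcases ha.eq_or_lt with rfl | ha
  · have : x = 0 := by nlinarith [sq_nonneg x]
    subst this; simpa using hy
  · have h1 : 0 ≤ (2 * a * l - x) ^ 2 := sq_nonneg _
    have h2 : 0 ≤ 4 * a * (a * l ^ 2 + y - x * l) := by nlinarith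
    have := nonneg_of_mul_nonneg_right h2 (by positivity)
    linarith

theorem lap_mul_sub (η φ : ℤ → ℝ) (i : ℤ) :
    lap (fun i => η i * φ i) i - η i * lap φ i
      = (η (i + 1) - η i) * ((φ (i + 1) - φ i) + (φ i - φ (i - 1))) + lap η i * φ (i - 1) := by
  simp only [lap]; ring

theorem commutator_bound {w B₁ D x y l φm d₂ q s : ℝ} {P : ℝ}
    (hw : |w| ≤ B₁) (hs : 0 < s) (hD : D ^ 2 ≤ P) (hl : |l| ≤ d₂)
    (hφ : 0 ≤ φm) (hφq : φm ≤ q) :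
    w * (D * (x + y) + l * φm) ≤ B₁ * s * (x ^ 2 + y ^ 2) + B₁ * d₂ * q + B₁ * (P / (2 * s)) := by
  have hB : 0 ≤ B₁ := (abs_nonneg _).trans hw
  have hd : 0 ≤ d₂ := (abs_nonneg _).trans hl
  have h1 : |D * (x + y) + l * φm| ≤ s * (x ^ 2 + y ^ 2) + d₂ * q + P / (2 * s) := by
    have a1 : |D * (x + y)| ≤ s * (x ^ 2 + y ^ 2) + P / (2 * s) := by
      have e : P / (2 * s) = 2 * (P / (4 * s)) := by field_simp; ring
      have hP : 4 * s * (P / (4 * s)) = P := by field_simp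
      have hP0 : 0 ≤ P / (4 * s) := by have := (sq_nonneg D).trans hD; positivity
      have k1 := mul_le_of_sq_le (l := x) hs.le hP0 (x := D) (by linarith)
      have k2 := mul_le_of_sq_le (l := y) hs.le hP0 (x := D) (by linarith)
      have k3 := mul_le_of_sq_le (l := x) hs.le hP0 (x := -D) (by linarith [neg_sq D])
      have k4 := mul_le_of_sq_le (l := y) hs.le hP0 (x := -D) (by linarith [neg_sq D])
      rw [e, abs_le]; constructor <;> nlinarith
    have a2 : |l * φm| ≤ d₂ * q := by
      rw [abs_mul, abs_of_nonneg hφ]; exact mul_le_mul hl hφq hφ hd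
    linarith [abs_add_le (D * (x + y)) (l * φm)]
  calc _ ≤ |w| * |D * (x + y) + l * φm| := by rw [← abs_mul]; exact le_abs_self _
    _ ≤ B₁ * (s * (x ^ 2 + y ^ 2) + d₂ * q + P / (2 * s)) := mul_le_mul hw h1 (abs_nonneg _) hB
    _ = _ := by ring

theorem lap_term_bound {μ ε σ K W α Z e ê η l w : ℝ} (hμ : 0 < μ) (hε : 0 < ε) (hσ : 0 < σ)
    (hW : 0 ≤ W) (hw0 : 0 < w) (hw1 : w ≤ 1) (hη0 : 0 ≤ η) (hη1 : η ≤ 1)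
    (hα : |Z| ≤ α) (hZ : |Z| ≤ K) (he : η ≠ 0 → |e| ≤ ê ∧ 1 ≤ W * w ^ 2) :
    μ * η * (e - ε * w * Z) * l
      ≤ σ * (μ * (α + ε * w) * l ^ 2) + μ * (ê ^ 2 * W / ε + ε ^ 2 * K) / (2 * σ) * w := by
  have hα0 : 0 ≤ α := (abs_nonneg _).trans hα
  have hK0 : 0 ≤ K := (abs_nonneg _).trans hZ
  have hb0 : 0 < μ * (α + ε * w) := by positivity
  have k1 : μ * η * e * l ≤ σ * (μ * (α + ε * w)) / 2 * l ^ 2 + μ * (ê ^ 2 * W / ε) / (2 * σ)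
      * w := by
    apply mul_le_of_sq_le (by positivity) (by positivity)
    have e1 : 4 * (σ * (μ * (α + ε * w)) / 2) * (μ * (ê ^ 2 * W / ε) / (2 * σ) * w)
        = μ ^ 2 * ((α + ε * w) / ε * w * W) * ê ^ 2 := by field_simp; ring
    rw [e1]
    by_cases h0 : η = 0
    · subst h0; simp; positivity
    · obtain ⟨h1, h2⟩ := he h0
      have h3 : e ^ 2 ≤ ê ^ 2 := sq_le_sq' (abs_le.1 h1).1 (abs_le.1 h1).2
      have h4 : 1 ≤ (α + ε * w) / ε * w * W := by
        have : w ≤ (α + ε * w) / ε := by rw [le_div_iff₀ hε]; nlinarith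
        calc 1 ≤ w * w * W := by nlinarith
          _ ≤ _ := by gcongr
      have h5 : η ^ 2 ≤ 1 := by nlinarith
      calc (μ * η * e) ^ 2 = μ ^ 2 * η ^ 2 * e ^ 2 := by ring
        _ ≤ μ ^ 2 * 1 * e ^ 2 := by gcongr
        _ ≤ μ ^ 2 * ((α + ε * w) / ε * w * W) * ê ^ 2 := by gcongr
  have k2 : μ * η * (-(ε * w * Z)) * l
      ≤ σ * (μ * (α + ε * w)) / 2 * l ^ 2 + μ * (ε ^ 2 * K) / (2 * σ) * w := by
    apply mul_le_of_sq_le (by positivity) (by positivity)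
    have e1 : 4 * (σ * (μ * (α + ε * w)) / 2) * (μ * (ε ^ 2 * K) / (2 * σ) * w)
        = μ ^ 2 * ε ^ 2 * w * ((α + ε * w) * K) := by field_simp; ring
    rw [e1]
    have h5 : η ^ 2 ≤ 1 := by nlinarith
    have h6 : Z ^ 2 ≤ (α + ε * w) * K := by
      rw [← sq_abs, sq]
      exact mul_le_mul (hα.trans (by have := mul_pos hε hw0; linarith)) hZ (abs_nonneg _)
        (by positivity)
    calc (μ * η * (-(ε * w * Z))) ^ 2 = μ ^ 2 * ε ^ 2 * w * (η ^ 2 * w) * Z ^ 2 := by ring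
      _ ≤ μ ^ 2 * ε ^ 2 * w * (1 * 1) * ((α + ε * w) * K) := by gcongr
      _ = _ := by ring
  have e : μ * (ê ^ 2 * W / ε + ε ^ 2 * K) / (2 * σ) * w
      = μ * (ê ^ 2 * W / ε) / (2 * σ) * w + μ * (ε ^ 2 * K) / (2 * σ) * w := by ring
  rw [e]
  linarith

theorem indicator_box_tsum_le {f : ℤ → ℝ} {a : ℝ} {J : ℕ} (hf : ∀ i, f i ≤ a)
    (h0 : ∀ i : ℤ, (J : ℤ) < |i| → f i = 0) : ∑' i, f i ≤ (2 * J + 1) * a := by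
  rw [tsum_eq_sum (s := Finset.Icc (-(J : ℤ)) J)]
  · refine (Finset.sum_le_card_nsmul _ _ a fun i _ => hf i).trans_eq ?_
    rw [Int.card_Icc, nsmul_eq_mul]
    have : (((J : ℤ) + 1 - -(J : ℤ)).toNat : ℝ) = 2 * J + 1 := by
      have : ((J : ℤ) + 1 - -(J : ℤ)).toNat = 2 * J + 1 := by omega
      rw [this]; push_cast; ring
    rw [this]
  · intro i hi
    apply h0
    by_contra hle
    exact hi (Finset.mem_Icc.2 (abs_le.1 (not_lt.1 hle)))

/-- One step of the duality pairing. -/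
theorem pairing_step {μ ε σ s K W k h Q B₁ d₂ d ê rr : ℝ} {α Z Z' e r c η φ : ℤ → ℝ} {J : ℤ}
    {Jη : ℕ}
    (hμ : 0 < μ) (hε : 0 < ε) (hσ : 0 < σ) (hs : 0 < s) (hW : 0 ≤ W) (hh : 0 < h) (hh1 : h ≤ 1)
    (hk : 0 < k)
    (hα : ∀ i, |Z i| ≤ α i) (hZ : ∀ i, |Z i| ≤ K) (hB₁ : ∀ i, |α i * Z i + e i| ≤ B₁)
    (hη0 : ∀ i, 0 ≤ η i) (hη1 : ∀ i, η i ≤ 1)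
    (he : ∀ i, η i ≠ 0 → |e i| ≤ ê ∧ |r i| ≤ rr ∧ 1 ≤ W * wt h i ^ 2) (hrr : 0 ≤ rr)
    (hη2 : ∀ i, |lap η i| ≤ d₂) (hηd : ∀ i, |η (i + 1) - η i| ≤ d)
    (hηJ : ∀ i : ℤ, (Jη : ℤ) < |i| → η (i + 1) - η i = 0)
    (hφJ : ∀ i, J < |i| → φ i = 0) (hφ0 : ∀ i, 0 ≤ φ i) (hφQ : ∀ i, φ i ≤ Q * wt h i)
    (hZ' : ∀ i, Z' i ≤ Z i + μ * lap (fun i => α i * Z i + e i) i + c i * Z i + k * r i) :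
    ∑' i, η i * φ i * Z' i
      ≤ ∑' i, η i * dualStep (fun i => μ * (α i + ε * wt h i)) c φ i * Z i
        + (2 * (μ * B₁ * s) * ∑' i, (φ (i + 1) - φ i) ^ 2
          + σ * ∑' i, μ * (α i + ε * wt h i) * lap φ i ^ 2
          + (3 * μ * B₁ * Q * d₂ + μ * (ê ^ 2 * W / ε + ε ^ 2 * K) / (2 * σ) + k * rr * Q)
              * ∑' i, wt h i
          + (2 * Jη + 1) * (μ * B₁ * (d ^ 2 / (2 * s)))) := by
  have hB0 : 0 ≤ B₁ := (abs_nonneg _).trans (hB₁ 0)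
  have hd20 : 0 ≤ d₂ := (abs_nonneg _).trans (hη2 0)
  have hQ0 : 0 ≤ Q := by
    have := (hφ0 0).trans (hφQ 0)
    exact nonneg_of_mul_nonneg_left this (wt_pos h 0)
  set A := 3 * μ * B₁ * Q * d₂ + μ * (ê ^ 2 * W / ε + ε ^ 2 * K) / (2 * σ) + k * rr * Q with hA
  let χ : ℤ → ℝ := fun i => μ * B₁ * ((η (i + 1) - η i) ^ 2 / (2 * s))
  let E : ℤ → ℝ := fun i => (φ (i + 1) - φ i) ^ 2
  let D : ℤ → ℝ := fun i => μ * (α i + ε * wt h i) * lap φ i ^ 2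
  let w : ℤ → ℝ := fun i => α i * Z i + e i
  let v : ℤ → ℝ := fun i => η i * φ i
  have bx := fun (i : ℤ) (hi : J + 2 < |i|) => box_neighbours hφJ hi
  have sχ : Summable χ := summable_of_box Jη fun i hi => by simp [χ, hηJ i hi]
  have sE : Summable E := summable_of_box (J + 2) fun i hi => by
    obtain ⟨h0, h1, -, -⟩ := bx i hi; simp [E, h0, h1]
  have sD : Summable D := summable_of_box (J + 2) fun i hi => by
    obtain ⟨h0, h1, h2, -⟩ := bx i hi; simp [D, lap, h0, h1, h2]
  have sw := wt_summable hh
  have sE' : Summable fun i => E (i - 1) := summable_shift_sub sE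
  have s1 : Summable fun i => η i * dualStep (fun i => μ * (α i + ε * wt h i)) c φ i * Z i :=
    summable_of_box (J + 2) fun i hi => by
      obtain ⟨h0, h1, h2, -⟩ := bx i hi; simp [dualStep, lap, h0, h1, h2]
  have s0 : Summable fun i => η i * φ i * Z' i :=
    summable_of_box (J + 2) fun i hi => by
      obtain ⟨h0, h1, h2, -⟩ := bx i hi; simp [h0]
  have sT : Summable fun i => μ * (v (i - 1) * w i - w (i - 1) * v i) :=
    summable_of_box (J + 2) fun i hi => by
      obtain ⟨h0, h1, h2, -⟩ := bx i hi; simp [v, h0, h2]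
  let g : ℤ → ℝ := fun i => η i * dualStep (fun i => μ * (α i + ε * wt h i)) c φ i * Z i
    + ((μ * B₁ * s) * (E i + E (i - 1)) + σ * D i + A * wt h i + χ i)
  have sg2 : Summable fun i => (μ * B₁ * s) * (E i + E (i - 1)) + σ * D i + A * wt h i + χ i :=
    ((((sE.add sE').mul_left _).add (sD.mul_left _)).add (sw.mul_left _)).add sχ
  have main : ∑' i, η i * φ i * Z' i ≤ ∑' i, g i := by
    refine tsum_le_of_telescope s0 (s1.add sg2) sT fun i => ?_
    have hv0 : 0 ≤ η i * φ i := mul_nonneg (hη0 i) (hφ0 i)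
    have t1 := mul_le_mul_of_nonneg_left (hZ' i) hv0
    have t2 : v i * lap w i = w i * (η i * lap φ i + (lap v i - η i * lap φ i))
        + ((v i * w (i + 1) - w i * v (i + 1)) - (v (i - 1) * w i - w (i - 1) * v i)) := by
      simp only [lap]; ring
    rw [lap_mul_sub] at t2
    have t3 := commutator_bound (x := φ (i + 1) - φ i) (y := φ i - φ (i - 1)) (hB₁ i) hs
      (le_refl ((η (i + 1) - η i) ^ 2)) (hη2 i) (hφ0 (i - 1))
      ((hφQ (i - 1)).trans (mul_le_mul_of_nonneg_left (wt_sub_one_le hh hh1 i) hQ0))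
    have t4 := lap_term_bound (e := e i) (ê := ê) (l := lap φ i) (η := η i) hμ hε hσ hW (wt_pos h i)
      (wt_le_one hh.le i) (hη0 i) (hη1 i) (hα i) (hZ i) (fun h0 => ⟨(he i h0).1, (he i h0).2.2⟩)
    have t5 : k * r i * (η i * φ i) ≤ k * rr * Q * wt h i := by
      by_cases h0 : η i = 0
      · rw [h0]; simp; have := (wt_pos h i).le; positivity
      · obtain ⟨-, h2, -⟩ := he i h0
        calc k * r i * (η i * φ i) ≤ k * rr * (1 * (Q * wt h i)) := by
              apply mul_le_mul
              · exact mul_le_mul_of_nonneg_left ((le_abs_self _).trans h2) hk.le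
              · exact mul_le_mul (hη1 i) (hφQ i) (hφ0 i) zero_le_one
              · exact hv0
              · positivity
          _ = _ := by ring
    have t3' := mul_le_mul_of_nonneg_left t3 hμ.le
    simp only [g, E, D, χ, dualStep, hA, sub_add_cancel, add_sub_cancel_right]
    simp only [v, w] at t2 t3' ⊢
    have t2' := congrArg (fun x => μ * x) t2
    linear_combination t1 + t2' + t3' + t4 + t5
  have e1 : ∑' i, g i = ∑' i, η i * dualStep (fun i => μ * (α i + ε * wt h i)) c φ i * Z i
      + ((μ * B₁ * s) * (∑' i, E i + ∑' i, E i) + σ * ∑' i, D i + A * ∑' i, wt h i + ∑' i,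
        χ i) := by
    rw [s1.tsum_add sg2, ((((sE.add sE').mul_left _).add (sD.mul_left _)).add
      (sw.mul_left _)).tsum_add sχ,
      (((sE.add sE').mul_left _).add (sD.mul_left _)).tsum_add (sw.mul_left _),
      ((sE.add sE').mul_left _).tsum_add (sD.mul_left _), tsum_mul_left, tsum_mul_left,
        tsum_mul_left,
      sE.tsum_add sE', tsum_shift_sub]
  have e2 : ∑' i, χ i ≤ (2 * Jη + 1) * (μ * B₁ * (d ^ 2 / (2 * s))) := by
    apply indicator_box_tsum_le
    · intro i
      have : (η (i + 1) - η i) ^ 2 ≤ d ^ 2 := sq_le_sq' (abs_le.1 (hηd i)).1 (abs_le.1 (hηd i)).2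
      simp only [χ]; gcongr
    · intro i hi; simp [χ, hηJ i hi]
  rw [e1] at main
  refine main.trans ?_
  simp only [E, D] at *
  linarith

/-- The constant in the energy estimate. -/
def energyC (Λ R₀ τ L Q : ℝ) : ℝ := Λ ^ 2 * (2 * R₀ + 5) + 12 * τ * L ^ 2 * Q ^ 2

theorem exists_box_of_support {ψ : ℤ → ℝ} {R h : ℝ} (hR : 0 ≤ R) (hh : 0 < h)
    (hψ : ∀ i : ℤ, R < |i * h| → ψ i = 0) :
    ∃ J : ℕ, (J : ℝ) * h ≤ R + 2 * h ∧ ∀ i : ℤ, (J : ℤ) < |i| → ψ i = 0 ∧ ψ (i + 1) = 0 := by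
  refine ⟨⌈R / h⌉₊ + 1, ?_, ?_⟩
  · have := Nat.ceil_lt_add_one (div_nonneg hR hh.le)
    have h2 : (⌈R / h⌉₊ : ℝ) * h < (R / h + 1) * h := mul_lt_mul_of_pos_right this hh
    rw [add_mul, div_mul_cancel₀ _ hh.ne'] at h2
    push_cast; linarith
  · have key : ∀ i : ℤ, (⌈R / h⌉₊ : ℤ) < |i| → ψ i = 0 := fun i hi => by
      apply hψ
      rw [abs_mul, abs_of_pos hh]
      have h1 : R / h ≤ ⌈R / h⌉₊ := Nat.le_ceil _
      have h2 : ((⌈R / h⌉₊ : ℕ) : ℝ) < |(i : ℝ)| := by exact_mod_cast hi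
      rw [← div_lt_iff₀ hh]; linarith
    intro i hi
    refine ⟨key i (by push_cast at hi; omega), key _ ?_⟩
    push_cast at hi
    rcases abs_cases i with a | a <;> rw [lt_abs] <;> omega

set_option maxHeartbeats 1600000 in
theorem pairing_bound {N : ℕ} {μ L k h τ R₀ K B Λ ε R s S C₁ C₂ Q C : ℝ}
    {α Z e r b c φ : ℕ → ℤ → ℝ} {η : ℤ → ℝ} {ê rr : ℕ → ℝ}
    (hμ : 0 < μ) (hL : 0 ≤ L) (hh : 0 < h) (hh1 : h ≤ 1) (hk : μ * h ^ 2 = k) (hN : N * k = τ)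
    (hkL : k * L ≤ 1 / 4) (hε : 0 < ε) (hε1 : ε ≤ 1) (hR : 1 ≤ R) (hs : 0 < s) (hS : 0 < S)
    (hR₀ : 0 ≤ R₀)
    (hμK : μ * (2 * K + 1) ≤ 1 / 8) (hα : ∀ n i, |Z n i| ≤ α n i) (hα2 : ∀ n i, α n i ≤ 2 * K)
    (hZ : ∀ n i, |Z n i| ≤ K) (heB : ∀ n i, |e n i| ≤ B)
    (hb : ∀ n i, b n i = μ * (α n i + ε * wt h i)) (hc : ∀ n i, |c n i| ≤ k * L)
    (hη0 : ∀ i, 0 ≤ η i) (hη1 : ∀ i, η i ≤ 1) (hηR : ∀ i : ℤ, 2 * R < |i * h| → η i = 0)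
    (hηd : ∀ i, |η (i + 1) - η i| ≤ C₁ * h / R) (hη2 : ∀ i, |lap η i| ≤ C₂ * h ^ 2 / R ^ 2)
    (he : ∀ n < N, ∀ i : ℤ, |i * h| ≤ 2 * R → |e n i| ≤ ê n ∧ |r n i| ≤ rr n)
    (hrr : ∀ n < N, 0 ≤ rr n)
    (hrec : ∀ n < N, ∀ i, Z (n + 1) i ≤ Z n i + μ * lap (fun i => α n i * Z n i + e n i) i
      + c n i * Z n i + k * r n i)
    (hφ : IsDual N b c φ) (hφ0 : ∀ i, 0 ≤ φ N i) (hφ1 : ∀ i, φ N i ≤ 1)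
    (hφR : ∀ i : ℤ, R₀ < |i * h| → φ N i = 0) (hφd : ∀ i, |φ N (i + 1) - φ N i| ≤ Λ * h)
    (hQ : Q = Real.exp (R₀ + τ * (1 / (4 * μ) + L))) (hC : C = energyC Λ R₀ τ L Q) :
    (∀ i, 0 ≤ φ 0 i ∧ φ 0 i ≤ Q * wt h i) ∧ (∃ J : ℤ, ∀ i, J < |i| → φ 0 i = 0) ∧
    h * ∑' i, η i * φ N i * Z N i ≤ h * ∑' i, η i * φ 0 i * Z 0 i
      + (2 * τ * (2 * K ^ 2 + B) * C * (s / ε) + 2 * C * (S / ε)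
        + 12 * τ * (2 * K ^ 2 + B) * Q * C₂ / R ^ 2 + 2 * τ * K * (ε ^ 2 / S)
        + 2 * Real.exp (4 * R) / (ε * S) * (k * ∑ n ∈ Finset.range N, ê n ^ 2)
        + 4 * Q * (k * ∑ n ∈ Finset.range N, rr n)
        + 9 * τ * (2 * K ^ 2 + B) * C₁ ^ 2 / (2 * (R * s))) := by
  have hk0 : 0 < k := hk ▸ by positivity
  have hK : 0 ≤ K := (abs_nonneg _).trans (hZ 0 0)
  have hB : 0 ≤ B := (abs_nonneg _).trans (heB 0 0)
  have hτ : 0 ≤ τ := hN ▸ by positivity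
  have hR0 : 0 < R := by linarith
  have hQ0 : 0 < Q := hQ ▸ Real.exp_pos _
  have hα0 : ∀ n i, 0 ≤ α n i := fun n i => (abs_nonneg _).trans (hα n i)
  have hb0 : ∀ n i, 0 < b n i := fun n i => by
    rw [hb]; have := hα0 n i; have := wt_pos h i; positivity
  have hb8 : ∀ n i, b n i ≤ 1 / 8 := fun n i => by
    rw [hb]
    refine le_trans (mul_le_mul_of_nonneg_left ?_ hμ.le) hμK
    have := hα2 n i
    have := mul_le_one₀ hε1 (wt_pos h i).le (wt_le_one hh.le i)
    linarith
  have hc4 : ∀ n i, |c n i| ≤ 1 / 4 := fun n i => (hc n i).trans hkL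
  have hnn := hφ.nonneg (fun n i => (hb0 n i).le) hb8 hc4 hφ0
  have hwt := hφ.le_wt (fun n i => (hb0 n i).le) hb8 hμ hL hh hh1 hk hN hc hkL hφ1 hφR
  rw [← hQ] at hwt
  obtain ⟨J₀, hJ₀, hJ₀'⟩ := exists_box_of_support hR₀ hh hφR
  obtain ⟨J, hJ⟩ := hφ.box fun i hi => (hJ₀' i hi).1
  obtain ⟨Jη, hJη, hJη'⟩ := exists_box_of_support (by linarith) hh hηR
  have hW := wt_tsum_le hh hh1
  have hWs := wt_summable hh
  -- energy
  set F := k * L ^ 2 * Q ^ 2 * h / ε * 4 with hF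
  have hFb : ∀ n < N, ∑' i, (c n i * φ (n + 1) i) ^ 2 / b n i ≤ F := by
    intro n hn
    have h1 : ∀ i, (c n i * φ (n + 1) i) ^ 2 / b n i ≤ k * L ^ 2 * Q ^ 2 * h ^ 2 / ε * wt h i := by
      intro i
      rw [div_le_iff₀ (hb0 n i), hb]
      have hw := wt_pos h i
      have h2 : (c n i * φ (n + 1) i) ^ 2 ≤ (k * L * (Q * wt h i)) ^ 2 := by
        rw [← sq_abs, abs_mul, abs_of_nonneg (hnn (n + 1) hn i)]
        refine pow_le_pow_left₀ (mul_nonneg (abs_nonneg _) (hnn (n + 1) hn i)) ?_ 2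
        exact mul_le_mul (hc n i) (hwt (n + 1) hn i) (hnn (n + 1) hn i) (by positivity)
      refine h2.trans ?_
      have h3 : (k * L * (Q * wt h i)) ^ 2
          = k * L ^ 2 * Q ^ 2 * h ^ 2 / ε * wt h i * (μ * (0 + ε * wt h i)) := by
        nth_rewrite 1 [← hk]
        rw [← hk]
        field_simp; ring
      rw [h3]
      have := hα0 n i
      gcongr
    have h2 : Summable fun i => (c n i * φ (n + 1) i) ^ 2 / b n i :=
      summable_of_box J fun i hi => by rw [hJ (n + 1) hn i hi]; simp
    calc _ ≤ ∑' i, k * L ^ 2 * Q ^ 2 * h ^ 2 / ε * wt h i := h2.tsum_le_tsum h1 (hWs.mul_left _)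
      _ = k * L ^ 2 * Q ^ 2 * h / ε * (h * ∑' i, wt h i) := by rw [tsum_mul_left]; ring
      _ ≤ F := mul_le_mul_of_nonneg_left hW (by positivity)
  obtain ⟨en1, en2⟩ := hφ.energy hJ hb0 hb8 hFb
  have hEN : ∑' i, (φ N (i + 1) - φ N i) ^ 2 + 3 * N * F ≤ C * h / ε := by
    have h1 : ∑' i, (φ N (i + 1) - φ N i) ^ 2 ≤ (2 * J₀ + 1) * (Λ * h) ^ 2 := by
      apply indicator_box_tsum_le
      · intro i
        exact sq_le_sq' (abs_le.1 (hφd i)).1 (abs_le.1 (hφd i)).2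
      · intro i hi; obtain ⟨a, b⟩ := hJ₀' i hi; rw [a, b]; simp
    have h2 : (2 * J₀ + 1) * (Λ * h) ^ 2 ≤ Λ ^ 2 * (2 * R₀ + 5) * h / ε := by
      rw [le_div_iff₀ hε]
      have : (2 * J₀ + 1) * h ≤ 2 * R₀ + 5 := by linarith
      calc _ ≤ (2 * J₀ + 1) * (Λ * h) ^ 2 * 1 := mul_le_mul_of_nonneg_left hε1 (by positivity)
        _ = Λ ^ 2 * ((2 * J₀ + 1) * h) * h := by ring
        _ ≤ _ := by gcongr
    have h3 : 3 * N * F = 12 * τ * L ^ 2 * Q ^ 2 * h / ε := by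
      rw [hF, ← hN]; ring
    rw [h3, hC, energyC]
    refine (add_le_add_left (h1.trans h2) _).trans_eq ?_
    ring
  have hC0 : 0 ≤ C := by rw [hC, energyC]; positivity
  refine ⟨fun i => ⟨hnn 0 (Nat.zero_le _) i, hwt 0 (Nat.zero_le _) i⟩,
    ⟨J, hJ 0 (Nat.zero_le _)⟩, ?_⟩
  -- iterate the pairing step
  set B₁ := 2 * K ^ 2 + B with hB₁
  have hB₁0 : 0 ≤ B₁ := by positivity
  let D : ℕ → ℝ := fun n => ∑' i, b n i * lap (φ (n + 1)) i ^ 2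
  let err : ℕ → ℝ := fun n => k * (2 * B₁ * C * (s / ε)) + S / h * D n
    + k * (12 * B₁ * Q * C₂ / R ^ 2 + 2 * K * (ε ^ 2 / S) + 2 * Real.exp (4 * R) / (ε * S) * ê n ^ 2
      + 4 * Q * rr n + 9 * B₁ * C₁ ^ 2 / (2 * (R * s)))
  have step : ∀ n < N, h * ∑' i, η i * φ (n + 1) i * Z (n + 1) i
      ≤ h * ∑' i, η i * φ n i * Z n i + err n := by
    intro n hn
    have hσ : 0 < S / h ^ 2 := by positivity
    have hd2 : 0 ≤ C₂ * h ^ 2 / R ^ 2 := (abs_nonneg _).trans (hη2 0)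
    have ps := pairing_step (φ := φ (n + 1)) (Z' := Z (n + 1)) (Z := Z n) (α := α n) (e := e n)
      (r := r n) (c := c n) (η := η) (J := J) (Jη := Jη) (ê := ê n) (rr := rr n) (s := s) (Q := Q)
      (B₁ := B₁) (k := k)
      hμ hε hσ hs (Real.exp_pos (4 * R)).le hh hh1 hk0 (hα n) (hZ n)
      (fun i => by
        refine (abs_add_le _ _).trans (add_le_add ?_ (heB n i))
        rw [abs_mul, abs_of_nonneg (hα0 n i)]
        have := mul_le_mul (hα2 n i) (hZ n i) (abs_nonneg _) (by positivity)
        linarith) hη0 hη1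
      (fun i hi => by
        have hi2 : |i * h| ≤ 2 * R := by
          by_contra hcon; exact hi (hηR i (not_le.1 hcon))
        obtain ⟨a1, a2⟩ := he n hn i hi2
        refine ⟨a1, a2, ?_⟩
        rw [wt, ← Real.exp_nat_mul, ← Real.exp_add, Real.one_le_exp_iff]
        rw [abs_mul, abs_of_pos hh] at hi2
        push_cast; linarith) (hrr n hn) hη2 hηd
      (fun i hi => by obtain ⟨a, b⟩ := hJη' i hi; rw [a, b]; simp)
      (hJ (n + 1) hn) (hnn (n + 1) hn) (hwt (n + 1) hn) (hrec n hn)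
    have e2 : ∀ i, μ * (α n i + ε * wt h i) = b n i := fun i => (hb n i).symm
    simp only [e2] at ps
    rw [← hφ n hn] at ps
    have ps' := mul_le_mul_of_nonneg_left ps hh.le
    refine ps'.trans ?_
    rw [mul_add]
    gcongr
    have hE := (en1 (n + 1) hn).trans hEN
    have b1 : h * (2 * (μ * B₁ * s) * ∑' i, (φ (n + 1) (i + 1) - φ (n + 1) i) ^ 2)
        ≤ k * (2 * B₁ * C * (s / ε)) := by
      calc _ ≤ h * (2 * (μ * B₁ * s) * (C * h / ε)) := by gcongr
        _ = _ := by rw [← hk]; ring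
    have b2 : h * (S / h ^ 2 * D n) = S / h * D n := by field_simp
    have b3 : h * ((3 * μ * B₁ * Q * (C₂ * h ^ 2 / R ^ 2)
        + μ * (ê n ^ 2 * Real.exp (4 * R) / ε + ε ^ 2 * K) / (2 * (S / h ^ 2)) + k * rr n * Q)
          * ∑' i, wt h i)
        ≤ k * (12 * B₁ * Q * C₂ / R ^ 2 + 2 * K * (ε ^ 2 / S)
          + 2 * Real.exp (4 * R) / (ε * S) * ê n ^ 2 + 4 * Q * rr n) := by
      have := hrr n hn
      calc _ = (3 * μ * B₁ * Q * (C₂ * h ^ 2 / R ^ 2)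
        + μ * (ê n ^ 2 * Real.exp (4 * R) / ε + ε ^ 2 * K) / (2 * (S / h ^ 2)) + k * rr n * Q)
          * (h * ∑' i, wt h i) := by ring
        _ ≤ (3 * μ * B₁ * Q * (C₂ * h ^ 2 / R ^ 2)
        + μ * (ê n ^ 2 * Real.exp (4 * R) / ε + ε ^ 2 * K) / (2 * (S / h ^ 2)) + k * rr n * Q) *
          4 :=
          mul_le_mul_of_nonneg_left hW (by positivity)
        _ = _ := by rw [← hk]; field_simp; ring
    have b4 : h * ((2 * Jη + 1) * (μ * B₁ * ((C₁ * h / R) ^ 2 / (2 * s))))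
        ≤ k * (9 * B₁ * C₁ ^ 2 / (2 * (R * s))) := by
      have : h * (2 * Jη + 1) ≤ 9 * R := by linarith [mul_comm h (Jη : ℝ)]
      calc _ = h * (2 * Jη + 1) * (μ * B₁ * ((C₁ * h / R) ^ 2 / (2 * s))) := by ring
        _ ≤ 9 * R * (μ * B₁ * ((C₁ * h / R) ^ 2 / (2 * s))) := by gcongr
        _ = _ := by rw [← hk]; field_simp
    simp only [err]
    linarith
  have tot : ∀ n ≤ N, h * ∑' i, η i * φ n i * Z n i
      ≤ h * ∑' i, η i * φ 0 i * Z 0 i + ∑ m ∈ Finset.range n, err m := by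
    intro n
    induction n with
    | zero => intro _; simp
    | succ n ih =>
      intro hn
      have := ih (by omega)
      have := step n hn
      rw [Finset.sum_range_succ]; linarith
  refine (tot N le_rfl).trans (add_le_add_right ?_ _)
  simp only [err]
  rw [Finset.sum_add_distrib, Finset.sum_add_distrib, Finset.sum_const, Finset.card_range,
    ← Finset.mul_sum,
    ← Finset.mul_sum, Finset.sum_add_distrib, Finset.sum_add_distrib, Finset.sum_add_distrib,
    Finset.sum_const, Finset.card_range, Finset.sum_const, Finset.card_range, ← Finset.mul_sum,
    ← Finset.mul_sum]
  have hD : S / h * ∑ n ∈ Finset.range N, D n ≤ 2 * C * (S / ε) := by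
    calc _ ≤ S / h * (2 * (C * h / ε)) :=
          mul_le_mul_of_nonneg_left (en2.trans (by linarith)) (by positivity)
      _ = _ := by field_simp
  simp only [nsmul_eq_mul]
  rw [← hN]
  linear_combination hD

/-! ### Families of discrete sub- and supersolutions -/

/-- Time step of the grid with `N` time levels on `[0, τ]`. -/
def gk (τ : ℝ) (N : ℕ) : ℝ := τ / N

/-- Space step of the grid, tied to the time step by `μ h² = k`. -/
def gh (μ τ : ℝ) (N : ℕ) : ℝ := √(τ / N / μ)

theorem gk_pos {τ : ℝ} (hτ : 0 < τ) {N : ℕ} (hN : 0 < N) : 0 < gk τ N := by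
  unfold gk; positivity

theorem gh_pos {μ τ : ℝ} (hμ : 0 < μ) (hτ : 0 < τ) {N : ℕ} (hN : 0 < N) : 0 < gh μ τ N := by
  unfold gh; positivity

theorem gh_sq {μ τ : ℝ} (hμ : 0 < μ) (hτ : 0 < τ) (N : ℕ) : μ * gh μ τ N ^ 2 = gk τ N := by
  rw [gh, gk, Real.sq_sqrt (by positivity)]; field_simp

theorem mul_gk {τ : ℝ} {N : ℕ} (hN : 0 < N) : N * gk τ N = τ := by
  rw [gk]; field_simp

theorem tendsto_gk (τ : ℝ) : Tendsto (gk τ) atTop (nhds 0) :=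
  tendsto_const_div_atTop_nhds_zero_nat τ

theorem tendsto_gh (μ τ : ℝ) : Tendsto (gh μ τ) atTop (nhds 0) := by
  have : Tendsto (fun N : ℕ => √(gk τ N / μ)) atTop (nhds (√(0 / μ))) :=
    ((tendsto_gk τ).div_const μ).sqrt
  rw [zero_div, Real.sqrt_zero] at this
  exact this

/-- Bounded families of grid functions that become small, uniformly on compact sets away from
the initial time. -/
def GridSmall (μ τ : ℝ) (e : ℕ → ℕ → ℤ → ℝ) : Prop :=
  (∃ B, ∀ N n i, |e N n i| ≤ B) ∧ ∀ ω > 0, ∀ t > 0, ∀ R, ∀ᶠ N in atTop, ∀ n ≤ N, ∀ i : ℤ,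
    t ≤ n * gk τ N → |i * gh μ τ N| ≤ R → |e N n i| ≤ ω

theorem GridSmall.sub {μ τ : ℝ} {e e' : ℕ → ℕ → ℤ → ℝ} (h : GridSmall μ τ e)
    (h' : GridSmall μ τ e') : GridSmall μ τ fun N n i => e N n i - e' N n i := by
  obtain ⟨⟨B, hB⟩, h1⟩ := h
  obtain ⟨⟨B', hB'⟩, h1'⟩ := h'
  refine ⟨⟨B + B', fun N n i => (abs_sub _ _).trans (add_le_add (hB N n i) (hB' N n i))⟩, ?_⟩
  intro ω hω t ht R
  filter_upwards [h1 (ω / 2) (by positivity) t ht R, h1' (ω / 2) (by positivity) t ht R]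
    with N a a' n hn i h2 h3
  have := a n hn i h2 h3
  have := a' n hn i h2 h3
  have := abs_sub (e N n i) (e' N n i)
  linarith

/-- A family of approximate subsolutions of the explicit scheme. -/
def GridSub (G : ℝ → ℝ → ℝ) (K μ τ : ℝ) (X : ℕ → ℕ → ℤ → ℝ) : Prop :=
  (∀ N n i, 0 ≤ X N n i ∧ X N n i ≤ K) ∧ ∃ e r, GridSmall μ τ e ∧ GridSmall μ τ r ∧
    ∀ᶠ N in atTop, ∀ n < N, ∀ i : ℤ, X N (n + 1) i ≤ X N n i
      + μ * lap (fun i => X N n i ^ 2 + e N n i) i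
      + gk τ N * (G (i * gh μ τ N) (X N n i) + r N n i)

/-- A family of approximate supersolutions of the explicit scheme. -/
def GridSuper (G : ℝ → ℝ → ℝ) (K μ τ : ℝ) (X : ℕ → ℕ → ℤ → ℝ) : Prop :=
  (∀ N n i, 0 ≤ X N n i ∧ X N n i ≤ K) ∧ ∃ e r, GridSmall μ τ e ∧ GridSmall μ τ r ∧
    ∀ᶠ N in atTop, ∀ n < N, ∀ i : ℤ, X N n i
      + μ * lap (fun i => X N n i ^ 2 + e N n i) i
      + gk τ N * (G (i * gh μ τ N) (X N n i) + r N n i) ≤ X N (n + 1) i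

/-- Diffusion coefficient of the linearised backward scheme. -/
def diffCoef (μ τ κ : ℝ) (X Y : ℕ → ℕ → ℤ → ℝ) (N n : ℕ) (i : ℤ) : ℝ :=
  μ * (X N n i + Y N n i + κ ^ 2 * wt (gh μ τ N) i)

/-- Reaction coefficient of the linearised backward scheme. -/
def reactCoef (G : ℝ → ℝ → ℝ) (μ τ : ℝ) (X Y : ℕ → ℕ → ℤ → ℝ) (N n : ℕ) (i : ℤ) : ℝ :=
  gk τ N * ((G (i * gh μ τ N) (X N n i) - G (i * gh μ τ N) (Y N n i)) / (X N n i - Y N n i))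

theorem diffCoef_comm (μ τ κ : ℝ) (X Y : ℕ → ℕ → ℤ → ℝ) (N : ℕ) :
    diffCoef μ τ κ X Y N = diffCoef μ τ κ Y X N := by
  funext n i; simp only [diffCoef]; ring

theorem reactCoef_comm (G : ℝ → ℝ → ℝ) (μ τ : ℝ) (X Y : ℕ → ℕ → ℤ → ℝ) (N : ℕ) :
    reactCoef G μ τ X Y N = reactCoef G μ τ Y X N := by
  funext n i; simp only [reactCoef]
  rw [← neg_sub (G _ (Y N n i)), ← neg_sub (Y N n i), neg_div_neg_eq]

/-- Cutoff functions: `1` on `[-1,1]`, `0` outside `[-2,2]`, with controlled differences. -/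
def IsCutoff (β : ℝ → ℝ) (C₁ C₂ : ℝ) : Prop :=
  (∀ x, 0 ≤ β x) ∧ (∀ x, β x ≤ 1) ∧ (∀ x, |x| ≤ 1 → β x = 1) ∧ (∀ x, 2 < |x| → β x = 0) ∧
  (∀ x d, |β (x + d) - β x| ≤ C₁ * |d|) ∧ (∀ x d, |β (x + d) - 2 * β x + β (x - d)| ≤ C₂ * d ^ 2)

/-- Test sequences: values in `[0,1]`, supported in `[-R₀,R₀]`, `Λ`-Lipschitz. -/
def IsTest (R₀ Λ h : ℝ) (ψ : ℤ → ℝ) : Prop :=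
  (∀ i, 0 ≤ ψ i) ∧ (∀ i, ψ i ≤ 1) ∧ (∀ i : ℤ, R₀ < |i * h| → ψ i = 0) ∧
  ∀ i, |ψ (i + 1) - ψ i| ≤ Λ * h

theorem sum_early_le {k τ t a c : ℝ} {N : ℕ} (hk : 0 < k) (hN : N * k = τ) (ht : 0 ≤ t) (ha : 0 ≤ a)
    (hc : 0 ≤ c) :
    k * ∑ n ∈ Finset.range N, (if (n : ℝ) * k < t then a else c) ≤ τ * c + a * (t + k) := by
  have h1 : ∀ n ∈ Finset.range N, (if (n : ℝ) * k < t then a else c)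
      ≤ c + (if (n : ℝ) * k < t then a else 0) := fun n _ => by split_ifs <;> linarith
  have h2 : ∑ n ∈ Finset.range N, (if (n : ℝ) * k < t then a else 0) ≤ (t / k + 1) * a := by
    rw [← Finset.sum_filter, Finset.sum_const, nsmul_eq_mul]
    refine mul_le_mul_of_nonneg_right ?_ ha
    have hsub : (Finset.range N).filter (fun n : ℕ => (n : ℝ) * k < t) ⊆ Finset.range ⌈t / k⌉₊ := by
      intro n hn
      rw [Finset.mem_filter] at hn
      rw [Finset.mem_range, Nat.lt_ceil, lt_div_iff₀ hk]; exact hn.2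
    have := Finset.card_le_card hsub
    rw [Finset.card_range] at this
    calc (((Finset.range N).filter (fun n : ℕ => (n : ℝ) * k < t)).card : ℝ) ≤ ⌈t / k⌉₊ := by
          exact_mod_cast this
      _ ≤ t / k + 1 := (Nat.ceil_lt_add_one (by positivity)).le
  have h3 := Finset.sum_le_sum h1
  rw [Finset.sum_add_distrib, Finset.sum_const, Finset.card_range, nsmul_eq_mul] at h3
  calc _ ≤ k * (N * c + (t / k + 1) * a) := by gcongr; linarith
    _ = _ := by rw [← hN]; field_simp

set_option maxHeartbeats 1600000 in
theorem grid_pairing {G : ℝ → ℝ → ℝ} {K L μ τ : ℝ} {X Y : ℕ → ℕ → ℤ → ℝ} {β : ℝ → ℝ} {C₁ C₂ : ℝ}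
    (hμ : 0 < μ) (hτ : 0 < τ) (hL : 0 ≤ L) (hμK : μ * (2 * K + 1) ≤ 1 / 8)
    (hG : ∀ x a b, 0 ≤ a → a ≤ K → 0 ≤ b → b ≤ K → |G x a - G x b| ≤ L * |a - b|)
    (hX : GridSub G K μ τ X) (hY : GridSuper G K μ τ Y) (hβ : IsCutoff β C₁ C₂)
    {R₀ Λ : ℝ} (hR₀ : 0 ≤ R₀) :
    ∃ Q > 0, ∀ δ > 0, ∀ᶠ κ in nhdsWithin (0 : ℝ) (Ioi 0), ∀ᶠ N in atTop, ∀ φ,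
      IsDual N (diffCoef μ τ κ X Y N) (reactCoef G μ τ X Y N) φ → IsTest R₀ Λ (gh μ τ N) (φ N) →
      (∀ n i, 0 ≤ diffCoef μ τ κ X Y N n i) ∧ (∀ n i, diffCoef μ τ κ X Y N n i ≤ 1 / 8) ∧
      (∀ n i, |reactCoef G μ τ X Y N n i| ≤ 1 / 4) ∧
      (∀ i, 0 ≤ φ 0 i ∧ φ 0 i ≤ Q * wt (gh μ τ N) i) ∧ (∃ J : ℤ, ∀ i, J < |i| → φ 0 i = 0) ∧
      gh μ τ N * ∑' i : ℤ, β (i * gh μ τ N * κ ^ 6) * φ N i * (X N N i - Y N N i)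
        ≤ gh μ τ N * ∑' i : ℤ, β (i * gh μ τ N * κ ^ 6) * φ 0 i * (X N 0 i - Y N 0 i) + δ := by
  obtain ⟨hXb, e₁, r₁, he₁, hr₁, hXr⟩ := hX
  obtain ⟨hYb, e₂, r₂, he₂, hr₂, hYr⟩ := hY
  obtain ⟨⟨Be, hBe⟩, hes⟩ := he₁.sub he₂
  obtain ⟨⟨Br, hBr⟩, hrs⟩ := hr₁.sub hr₂
  obtain ⟨hβ0, hβ1, hβ2, hβ3, hβ4, hβ5⟩ := hβ
  have hBe0 : 0 ≤ Be := (abs_nonneg _).trans (hBe 0 0 0)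
  have hBr0 : 0 ≤ Br := (abs_nonneg _).trans (hBr 0 0 0)
  set Q := Real.exp (R₀ + τ * (1 / (4 * μ) + L)) with hQ
  set C := energyC Λ R₀ τ L Q with hC
  refine ⟨Q, Real.exp_pos _, fun δ hδ => ?_⟩
  have t1 : Tendsto (fun κ : ℝ => 2 * τ * (2 * K ^ 2 + Be) * C * κ ^ 2 + 2 * C * κ
        + 12 * τ * (2 * K ^ 2 + Be) * Q * C₂ * κ ^ 12 + 2 * τ * K * κ
        + 9 * τ * (2 * K ^ 2 + Be) * C₁ ^ 2 / 2 * κ ^ 2) (nhdsWithin (0 : ℝ) (Ioi 0)) (nhds 0) := by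
    refine tendsto_nhdsWithin_of_tendsto_nhds ?_
    have : Continuous (fun κ : ℝ => 2 * τ * (2 * K ^ 2 + Be) * C * κ ^ 2 + 2 * C * κ
        + 12 * τ * (2 * K ^ 2 + Be) * Q * C₂ * κ ^ 12 + 2 * τ * K * κ
        + 9 * τ * (2 * K ^ 2 + Be) * C₁ ^ 2 / 2 * κ ^ 2) := by fun_prop
    convert this.tendsto 0 using 2
    simp
  filter_upwards [t1.eventually (gt_mem_nhds (half_pos hδ)), self_mem_nhdsWithin,
    mem_nhdsWithin_of_mem_nhds (gt_mem_nhds (zero_lt_one (α := ℝ)))] with κ hκ1 hκ0 hκlt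
  rw [mem_Ioi] at hκ0
  set R := (κ ^ 6)⁻¹ with hR
  have hR1 : 1 ≤ R := (one_le_inv₀ (by positivity)).2 (pow_le_one₀ hκ0.le (le_of_lt hκlt))
  set P := 2 * Real.exp (4 * R) / (κ ^ 2 * κ ^ 3) with hP
  have t2 : Tendsto (fun x : ℝ => P * (τ * x ^ 2 + Be ^ 2 * (x + x))
      + 4 * Q * (τ * x + Br * (x + x))) (nhdsWithin (0 : ℝ) (Ioi 0)) (nhds 0) := by
    refine tendsto_nhdsWithin_of_tendsto_nhds ?_
    have : Continuous (fun x : ℝ => P * (τ * x ^ 2 + Be ^ 2 * (x + x))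
      + 4 * Q * (τ * x + Br * (x + x))) := by fun_prop
    convert this.tendsto 0 using 2
    simp
  obtain ⟨x, hx1, hx0⟩ := ((t2.eventually (gt_mem_nhds (half_pos hδ))).and
      self_mem_nhdsWithin).exists
  filter_upwards [hXr, hYr, hes x hx0 x hx0 (2 * R), hrs x hx0 x hx0 (2 * R),
    eventually_gt_atTop 0, (tendsto_gk τ).eventually (gt_mem_nhds hx0),
    (tendsto_gh μ τ).eventually (gt_mem_nhds one_pos),
    ((tendsto_gk τ).mul_const L).eventually (gt_mem_nhds (by norm_num : 0 * L < 1 / 4))]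
    with N hX' hY' he' hr' hN0 hkx hh1 hkL φ hφ hψ
  set h := gh μ τ N with hh
  set k := gk τ N with hk
  have hh0 : 0 < h := gh_pos hμ hτ hN0
  have hk0 : 0 < k := gk_pos hτ hN0
  have hα : ∀ n i, |X N n i - Y N n i| ≤ X N n i + Y N n i := fun n i => by
    have := hXb N n i; have := hYb N n i
    rw [abs_le]; constructor <;> linarith
  have hα2 : ∀ n i, X N n i + Y N n i ≤ 2 * K := fun n i => by
    have := hXb N n i; have := hYb N n i; linarith
  have hZK : ∀ n i, |X N n i - Y N n i| ≤ K := fun n i => by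
    have := hXb N n i; have := hYb N n i
    rw [abs_le]; constructor <;> linarith
  have hc : ∀ n i, |reactCoef G μ τ X Y N n i| ≤ k * L := fun n i => by
    rw [reactCoef, abs_mul, abs_of_pos hk0]
    refine mul_le_mul_of_nonneg_left ?_ hk0.le
    rw [abs_div]
    have := hXb N n i; have := hYb N n i
    exact div_le_of_le_mul₀ (abs_nonneg _) hL (hG _ _ _ (by tauto) (by tauto) (by tauto) (by tauto))
  have hcZ : ∀ n i, reactCoef G μ τ X Y N n i * (X N n i - Y N n i)
      = k * (G (i * h) (X N n i) - G (i * h) (Y N n i)) := fun n i => by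
    rw [reactCoef, mul_assoc]
    by_cases h0 : X N n i - Y N n i = 0
    · rw [h0, sub_eq_zero.1 h0]; simp
    · rw [div_mul_cancel₀ _ h0]
  obtain ⟨hψ0, hψ1, hψ2, hψ3⟩ := hψ
  have eh : ∀ i : ℤ, ((i + 1 : ℤ) : ℝ) * h * κ ^ 6 = i * h * κ ^ 6 + h * κ ^ 6 := fun i => by
    push_cast; ring
  have eh' : ∀ i : ℤ, ((i - 1 : ℤ) : ℝ) * h * κ ^ 6 = i * h * κ ^ 6 - h * κ ^ 6 := fun i => by
    push_cast; ring
  obtain ⟨pb1, pb2, pb3⟩ := pairing_bound (N := N) (μ := μ) (L := L) (k := k) (h := h) (τ := τ)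
      (R₀ := R₀)
    (K := K) (B := Be) (Λ := Λ) (ε := κ ^ 2) (R := R) (s := κ ^ 4) (S := κ ^ 3) (C₁ := C₁)
    (C₂ := C₂) (Q := Q) (C := C) (α := fun n i => X N n i + Y N n i)
    (Z := fun n i => X N n i - Y N n i) (e := fun n i => e₁ N n i - e₂ N n i)
    (r := fun n i => r₁ N n i - r₂ N n i) (b := diffCoef μ τ κ X Y N)
    (c := reactCoef G μ τ X Y N) (φ := φ) (η := fun i : ℤ => β (i * h * κ ^ 6))
    (ê := fun n => if (n : ℝ) * k < x then Be else x)
      (rr := fun n => if (n : ℝ) * k < x then Br else x)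
    hμ hL hh0 (le_of_lt hh1) (gh_sq hμ hτ N) (mul_gk hN0) (le_of_lt hkL) (by positivity)
    (pow_le_one₀ hκ0.le (le_of_lt hκlt)) hR1 (by positivity) (by positivity) hR₀ hμK hα hα2 hZK
    (fun n i => hBe N n i) (fun n i => rfl) hc (fun i => hβ0 _) (fun i => hβ1 _)
    (fun i hi => hβ3 _ (by
      rw [abs_mul, abs_of_pos (by positivity : 0 < κ ^ 6)]
      rw [hR, ← div_eq_mul_inv, div_lt_iff₀ (by positivity)] at hi
      exact hi))
    (fun i => by
      rw [eh]
      refine (hβ4 _ _).trans_eq ?_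
      rw [abs_of_pos (by positivity), hR]; field_simp)
    (fun i => by
      simp only [lap]
      rw [eh, eh']
      refine (hβ5 _ _).trans_eq ?_
      rw [hR]; field_simp)
    (fun n hn i hi => by
      by_cases hnx : (n : ℝ) * k < x
      · simp only [hnx, if_true]; exact ⟨hBe N n i, hBr N n i⟩
      · simp only [hnx, if_false]
        exact ⟨he' n hn.le i (not_lt.1 hnx) hi, hr' n hn.le i (not_lt.1 hnx) hi⟩)
    (fun n hn => by split_ifs <;> linarith)
    (fun n hn i => by
      have a := hX' n hn i
      have a' := hY' n hn i
      have a'' := hcZ n i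
      simp only [lap] at a a' ⊢
      linear_combination a + a' - a'')
    hφ hψ0 hψ1 hψ2 hψ3 hQ hC
  refine ⟨fun n i => ?_, fun n i => ?_, fun n i => (hc n i).trans (le_of_lt hkL), pb1, pb2,
    pb3.trans ?_⟩
  · have := hXb N n i; have := hYb N n i; have := (wt_pos h i).le
    rw [diffCoef]; rw [← hh]
    have : 0 ≤ X N n i + Y N n i := by linarith
    positivity
  · rw [diffCoef]
    refine le_trans (mul_le_mul_of_nonneg_left ?_ hμ.le) hμK
    have := hα2 n i
    have := mul_le_one₀ (pow_le_one₀ hκ0.le (le_of_lt hκlt) : κ ^ 2 ≤ 1) (wt_pos h i).le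
        (wt_le_one hh0.le i)
    linarith
  · have s1 := sum_early_le (t := x) (a := Be ^ 2) (c := x ^ 2) hk0 (mul_gk hN0) hx0.le
        (by positivity) (by positivity)
    have s2 := sum_early_le (t := x) (a := Br) (c := x) hk0 (mul_gk hN0) hx0.le (by positivity)
        (by positivity)
    have s1e : ∀ n : ℕ, (if (n : ℝ) * k < x then Be else x) ^ 2
        = if (n : ℝ) * k < x then Be ^ 2 else x ^ 2 := fun n => by split_ifs <;> rfl
    simp only [s1e]
    have s1' := mul_le_mul_of_nonneg_left (s1.trans (by gcongr : _ ≤ τ * x ^ 2 + Be ^ 2 * (x + x)))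
      (by positivity : 0 ≤ P)
    have s2' := mul_le_mul_of_nonneg_left (s2.trans (by gcongr : _ ≤ τ * x + Br * (x + x)))
      (by positivity : 0 ≤ 4 * Q)
    have e1 : κ ^ 4 / κ ^ 2 = κ ^ 2 := by field_simp
    have e2 : κ ^ 3 / κ ^ 2 = κ := by field_simp
    have e3 : 12 * τ * (2 * K ^ 2 + Be) * Q * C₂ / R ^ 2
        = 12 * τ * (2 * K ^ 2 + Be) * Q * C₂ * κ ^ 12 := by rw [hR]; field_simp
    have e4 : (κ ^ 2) ^ 2 / κ ^ 3 = κ := by field_simp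
    have e5 : 9 * τ * (2 * K ^ 2 + Be) * C₁ ^ 2 / (2 * (R * κ ^ 4))
        = 9 * τ * (2 * K ^ 2 + Be) * C₁ ^ 2 / 2 * κ ^ 2 := by rw [hR]; field_simp
    rw [e1, e2, e3, e4, e5]
    refine add_le_add_right ?_ _
    linarith

/-- The hat function of radius `ρ` centred at `x₀`, sampled on the grid of step `h`. -/
def gridHat (x₀ ρ h : ℝ) (i : ℤ) : ℝ := max 0 (1 - |i * h - x₀| / ρ)

theorem gridHat_eq_zero {x₀ ρ h : ℝ} (hρ : 0 < ρ) {i : ℤ} (hi : ρ ≤ |i * h - x₀|) :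
    gridHat x₀ ρ h i = 0 := by
  rw [gridHat, max_eq_left]
  have : 1 ≤ |i * h - x₀| / ρ := (one_le_div hρ).2 hi
  linarith

theorem gridHat_nonneg (x₀ ρ h : ℝ) (i : ℤ) : 0 ≤ gridHat x₀ ρ h i := le_max_left _ _

theorem isTest_gridHat {x₀ ρ h : ℝ} (hρ : 0 < ρ) (hh : 0 ≤ h) :
    IsTest (|x₀| + ρ) (1 / ρ) h (gridHat x₀ ρ h) := by
  refine ⟨gridHat_nonneg x₀ ρ h, fun i => ?_, fun i hi => ?_, fun i => ?_⟩
  · rw [gridHat]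
    refine max_le zero_le_one ?_
    have : 0 ≤ |i * h - x₀| / ρ := by positivity
    linarith
  · apply gridHat_eq_zero hρ
    have := abs_sub_abs_le_abs_sub (i * h) x₀
    linarith
  · rw [gridHat, gridHat]
    rw [max_comm 0, max_comm 0]
    refine (abs_max_sub_max_le_abs _ _ _).trans ?_
    have e : (1 - |((i + 1 : ℤ) : ℝ) * h - x₀| / ρ) - (1 - |(i : ℝ) * h - x₀| / ρ)
        = -((|((i + 1 : ℤ) : ℝ) * h - x₀| - |(i : ℝ) * h - x₀|) / ρ) := by ring
    rw [e, abs_neg, abs_div, abs_of_pos hρ, div_mul_eq_mul_div, one_mul]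
    refine div_le_div_of_nonneg_right ?_ hρ.le
    refine (abs_abs_sub_abs_le _ _).trans ?_
    push_cast
    have : ((i : ℝ) + 1) * h - x₀ - (i * h - x₀) = h := by ring
    rw [this, abs_of_nonneg hh]

theorem gridHat_pairing_ge {x₀ ρ h d : ℝ} (hρ : 0 < ρ) (hh : 0 < h) (hhρ : h ≤ ρ / 4) (hd : 0 ≤ d)
    {v : ℤ → ℝ} (hv : ∀ i : ℤ, |i * h - x₀| ≤ ρ → d ≤ v i) :
    d * ρ / 4 ≤ h * ∑' i, gridHat x₀ ρ h i * v i := by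
  have hnn : ∀ i, 0 ≤ gridHat x₀ ρ h i * v i := fun i => by
    by_cases hi : |i * h - x₀| ≤ ρ
    · exact mul_nonneg (gridHat_nonneg _ _ _ _) (hd.trans (hv i hi))
    · rw [gridHat_eq_zero hρ (not_le.1 hi).le, zero_mul]
  have hs : Summable fun i => gridHat x₀ ρ h i * v i := by
    obtain ⟨J, -, hJ⟩ := exists_box_of_support (R := |x₀| + ρ) (by positivity) hh
      (isTest_gridHat (x₀ := x₀) hρ hh.le).2.2.1
    exact summable_of_box J fun i hi => by rw [(hJ i hi).1, zero_mul]
  set S := Finset.Icc ⌈(x₀ - ρ / 2) / h⌉ ⌊(x₀ + ρ / 2) / h⌋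
  have h1 : ∑ i ∈ S, gridHat x₀ ρ h i * v i ≤ ∑' i, gridHat x₀ ρ h i * v i :=
    hs.sum_le_tsum S fun i _ => hnn i
  have h2 : ∀ i ∈ S, d / 2 ≤ gridHat x₀ ρ h i * v i := by
    intro i hi
    obtain ⟨a1, a2⟩ := Finset.mem_Icc.1 hi
    rw [Int.ceil_le, div_le_iff₀ hh] at a1
    rw [Int.le_floor, le_div_iff₀ hh] at a2
    have a3 : |i * h - x₀| ≤ ρ / 2 := by rw [abs_le]; constructor <;> linarith
    have a4 : 1 / 2 ≤ gridHat x₀ ρ h i := by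
      rw [gridHat]
      refine le_trans ?_ (le_max_right _ _)
      have : |i * h - x₀| / ρ ≤ 1 / 2 := by rw [div_le_iff₀ hρ]; linarith
      linarith
    have a5 := hv i (by linarith)
    nlinarith
  have h3 := Finset.card_nsmul_le_sum S _ _ h2
  rw [nsmul_eq_mul] at h3
  have h4 : ρ / h - 1 ≤ (S.card : ℝ) := by
    rw [Int.card_Icc]
    have a1 := Int.ceil_lt_add_one ((x₀ - ρ / 2) / h)
    have a2 := Int.lt_floor_add_one ((x₀ + ρ / 2) / h)
    have a3 : (x₀ + ρ / 2) / h - (x₀ - ρ / 2) / h = ρ / h := by ring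
    have a4 : ((⌊(x₀ + ρ / 2) / h⌋ + 1 - ⌈(x₀ - ρ / 2) / h⌉ : ℤ) : ℝ)
        ≤ (((⌊(x₀ + ρ / 2) / h⌋ + 1 - ⌈(x₀ - ρ / 2) / h⌉).toNat : ℤ) : ℝ) := by
      exact_mod_cast Int.self_le_toNat _
    push_cast at a4
    linarith
  have h5 : h * (ρ / h - 1) = ρ - h := by field_simp
  calc d * ρ / 4 ≤ (ρ - h) * (d / 2) := by nlinarith
    _ = h * ((ρ / h - 1) * (d / 2)) := by rw [← h5]; ring
    _ ≤ h * (S.card * (d / 2)) := by gcongr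
    _ ≤ _ := by gcongr; linarith

/-- Locally uniform convergence of the terminal grid values. -/
def GridLim (μ τ : ℝ) (X : ℕ → ℕ → ℤ → ℝ) (x : ℝ → ℝ) : Prop :=
  ∀ ω > 0, ∀ R, ∀ᶠ N in atTop, ∀ i : ℤ, |i * gh μ τ N| ≤ R → |X N N i - x (i * gh μ τ N)| ≤ ω

/-- If the limits are strictly ordered near a point, so are the grid functions, eventually. -/
theorem GridLim.gap {μ τ : ℝ} {X Y : ℕ → ℕ → ℤ → ℝ} {x y : ℝ → ℝ} (hX : GridLim μ τ X x)
    (hY : GridLim μ τ Y y) (hx : Continuous x) (hy : Continuous y) {z : ℝ} (hz : y z < x z)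
    {ρ₀ : ℝ} (hρ₀ : 0 < ρ₀) :
    ∃ d > 0, ∃ ρ > 0, ρ ≤ ρ₀ ∧ ∀ᶠ N in atTop, ∀ i : ℤ, |i * gh μ τ N - z| ≤ ρ →
      d ≤ X N N i - Y N N i := by
  have h1 : ∀ᶠ w in nhds z, (x z - y z) / 2 < x w - y w := by
    have : Tendsto (fun w => x w - y w) (nhds z) (nhds (x z - y z)) := (hx.sub hy).tendsto z
    exact this.eventually (lt_mem_nhds (by linarith))
  obtain ⟨r, hr, h2⟩ := Metric.eventually_nhds_iff.1 h1
  refine ⟨(x z - y z) / 4, by linarith, min (r / 2) ρ₀, by positivity, min_le_right _ _, ?_⟩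
  have hω : 0 < (x z - y z) / 8 := by linarith
  filter_upwards [hX _ hω (|z| + r), hY _ hω (|z| + r)] with N a1 a2 i hi
  have hi' : |i * gh μ τ N - z| ≤ r / 2 := hi.trans (min_le_left _ _)
  have h3 : |i * gh μ τ N| ≤ |z| + r := by
    have := abs_sub_abs_le_abs_sub (i * gh μ τ N) z
    linarith
  have h4 := h2 (y := i * gh μ τ N) (by rw [Real.dist_eq]; linarith)
  have h5 := (abs_le.1 (a1 i h3)).1
  have h6 := (abs_le.1 (a2 i h3)).2
  linarith

theorem eventually_cutoff_eq_one {β : ℝ → ℝ} {C₁ C₂ : ℝ} (hβ : IsCutoff β C₁ C₂) (R : ℝ) :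
    ∀ᶠ κ in nhdsWithin (0 : ℝ) (Ioi 0), ∀ x : ℝ, |x| ≤ R → β (x * κ ^ 6) = 1 := by
  have : Tendsto (fun κ : ℝ => R * κ ^ 6) (nhdsWithin (0 : ℝ) (Ioi 0)) (nhds 0) := by
    refine tendsto_nhdsWithin_of_tendsto_nhds ?_
    have h : Continuous fun κ : ℝ => R * κ ^ 6 := by fun_prop
    convert h.tendsto 0 using 2; simp
  filter_upwards [this.eventually (gt_mem_nhds one_pos), self_mem_nhdsWithin] with κ h1 h2 x hx
  rw [mem_Ioi] at h2
  apply hβ.2.2.1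
  rw [abs_mul, abs_of_pos (by positivity : 0 < κ ^ 6)]
  exact (mul_le_mul_of_nonneg_right hx (by positivity)).trans h1.le

theorem grid_comparison {G : ℝ → ℝ → ℝ} {K L μ τ : ℝ} {X Y : ℕ → ℕ → ℤ → ℝ} {β : ℝ → ℝ} {C₁ C₂ : ℝ}
    (hμ : 0 < μ) (hτ : 0 < τ) (hL : 0 ≤ L) (hμK : μ * (2 * K + 1) ≤ 1 / 8)
    (hG : ∀ x a b, 0 ≤ a → a ≤ K → 0 ≤ b → b ≤ K → |G x a - G x b| ≤ L * |a - b|)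
    (hX : GridSub G K μ τ X) (hY : GridSuper G K μ τ Y) (hβ : IsCutoff β C₁ C₂)
    {x y : ℝ → ℝ} (hXx : GridLim μ τ X x) (hYy : GridLim μ τ Y y) (hx : Continuous x)
    (hy : Continuous y) (h0 : ∀ ω > 0, ∀ᶠ N in atTop, ∀ i, X N 0 i ≤ Y N 0 i + ω) (z : ℝ) :
    x z ≤ y z := by
  by_contra hz
  obtain ⟨d, hd, ρ, hρ, -, hgap⟩ := hXx.gap hYy hx hy (not_le.1 hz) one_pos
  obtain ⟨Q, hQ, hp⟩ := grid_pairing (R₀ := |z| + ρ) (Λ := 1 / ρ) hμ hτ hL hμK hG hX hY hβ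
      (by positivity)
  have hδ : 0 < d * ρ / 16 := by positivity
  obtain ⟨κ, hκ1, hκ2⟩ := ((hp _ hδ).and (eventually_cutoff_eq_one hβ (|z| + ρ))).exists
  have hω : 0 < d * ρ / 16 / (4 * Q) := by positivity
  obtain ⟨N, hN1, hN2, hN3, hN4, hN5, hN6⟩ := (hκ1.and (hgap.and ((h0 _ hω).and
    (((tendsto_gh μ τ).eventually (gt_mem_nhds (by positivity : 0 < ρ / 4))).and
      (((tendsto_gh μ τ).eventually (gt_mem_nhds one_pos)).and (eventually_gt_atTop 0)))))).exists
  have hh : 0 < gh μ τ N := gh_pos hμ hτ hN6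
  obtain ⟨φ, hφ, hφN⟩ := exists_isDual N (diffCoef μ τ κ X Y N) (reactCoef G μ τ X Y N)
    (gridHat z ρ (gh μ τ N))
  obtain ⟨-, -, -, hφ0, ⟨J, hJ⟩, hmain⟩ := hN1 φ hφ (hφN ▸ isTest_gridHat hρ hh.le)
  have low : d * ρ / 4 ≤ gh μ τ N * ∑' i : ℤ, β (i * gh μ τ N * κ ^ 6) * φ N i *
      (X N N i - Y N N i) := by
    have := gridHat_pairing_ge (v := fun i : ℤ => β (i * gh μ τ N * κ ^ 6) * (X N N i - Y N N i))
      hρ hh (le_of_lt hN4) hd.le (fun i hi => by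
        have h3 : |i * gh μ τ N| ≤ |z| + ρ := by
          have := abs_sub_abs_le_abs_sub (i * gh μ τ N) z
          linarith
        rw [hκ2 _ h3, one_mul]; exact hN2 i hi)
    refine this.trans_eq ?_
    rw [hφN]; congr 1; refine tsum_congr fun i => ?_; ring
  have up : gh μ τ N * ∑' i : ℤ, β (i * gh μ τ N * κ ^ 6) * φ 0 i * (X N 0 i - Y N 0 i)
      ≤ d * ρ / 16 := by
    have hw := wt_summable hh
    have s : Summable fun i : ℤ => β (i * gh μ τ N * κ ^ 6) * φ 0 i * (X N 0 i - Y N 0 i) :=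
      summable_of_box J fun i hi => by rw [hJ i hi]; simp
    have h1 : ∀ i : ℤ, β (i * gh μ τ N * κ ^ 6) * φ 0 i * (X N 0 i - Y N 0 i)
        ≤ d * ρ / 16 / (4 * Q) * Q * wt (gh μ τ N) i := fun i => by
      have a := hN3 i
      have b1 := hβ.1 (i * gh μ τ N * κ ^ 6)
      have b2 := hβ.2.1 (i * gh μ τ N * κ ^ 6)
      have c1 : 0 ≤ β (i * gh μ τ N * κ ^ 6) * φ 0 i := mul_nonneg b1 (hφ0 i).1
      have c2 : β (i * gh μ τ N * κ ^ 6) * φ 0 i ≤ 1 * (Q * wt (gh μ τ N) i) :=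
        mul_le_mul b2 (hφ0 i).2 (hφ0 i).1 zero_le_one
      calc _ ≤ β (i * gh μ τ N * κ ^ 6) * φ 0 i * (d * ρ / 16 / (4 * Q)) :=
            mul_le_mul_of_nonneg_left (by linarith) c1
        _ ≤ 1 * (Q * wt (gh μ τ N) i) * (d * ρ / 16 / (4 * Q)) :=
            mul_le_mul_of_nonneg_right c2 hω.le
        _ = _ := by ring
    calc _ ≤ gh μ τ N * ∑' i, d * ρ / 16 / (4 * Q) * Q * wt (gh μ τ N) i :=
          mul_le_mul_of_nonneg_left (s.tsum_le_tsum h1 (hw.mul_left _)) hh.le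
      _ = d * ρ / 16 / (4 * Q) * Q * (gh μ τ N * ∑' i, wt (gh μ τ N) i) := by
          rw [tsum_mul_left]; ring
      _ ≤ d * ρ / 16 / (4 * Q) * Q * 4 :=
          mul_le_mul_of_nonneg_left (wt_tsum_le hh (le_of_lt hN5)) (by positivity)
      _ = _ := by field_simp
  nlinarith [mul_pos hd hρ]

/-- In a segment joining two one-signed sequences through `PosNeg` sequences, some member changes
sign exactly at the origin. -/
theorem exists_comb_sign {φ ψ : ℤ → ℝ} (hφ : ∀ i, 0 ≤ φ i) (hψ : ∀ i, 0 ≤ ψ i)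
    (h : ∀ x : ℝ, 0 ≤ x → x ≤ 1 → PosNeg fun i => x * φ i - (1 - x) * ψ i) :
    ∃ x : ℝ, 0 ≤ x ∧ x ≤ 1 ∧ (∀ i < 0, 0 ≤ x * φ i - (1 - x) * ψ i) ∧
      ∀ i ≥ 0, x * φ i - (1 - x) * ψ i ≤ 0 := by
  let P : Set ℝ := {x | ∀ i < 0, 0 ≤ x * φ i - (1 - x) * ψ i}
  let M : Set ℝ := {x | ∀ i ≥ 0, x * φ i - (1 - x) * ψ i ≤ 0}
  have hP : IsClosed P := by
    have : P = ⋂ i : ℤ, ⋂ _ : i < 0, {x : ℝ | 0 ≤ x * φ i - (1 - x) * ψ i} := by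
      ext x; simp [P]
    rw [this]
    exact isClosed_iInter fun i => isClosed_iInter fun _ => isClosed_le (by fun_prop) (by fun_prop)
  have hM : IsClosed M := by
    have : M = ⋂ i : ℤ, ⋂ _ : i ≥ 0, {x : ℝ | x * φ i - (1 - x) * ψ i ≤ 0} := by
      ext x; simp [M]
    rw [this]
    exact isClosed_iInter fun i => isClosed_iInter fun _ => isClosed_le (by fun_prop) (by fun_prop)
  have hcov : Icc (0 : ℝ) 1 ⊆ P ∪ M := by
    intro x hx
    obtain ⟨j, h1, h2⟩ := h x hx.1 hx.2
    rcases le_total 0 j with hj | hj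
    · exact Or.inl fun i hi => h1 i (by omega)
    · exact Or.inr fun i hi => h2 i (by omega)
  obtain ⟨x, hx, hx1, hx2⟩ := isPreconnected_closed_iff.1 isPreconnected_Icc P M hP hM hcov
    ⟨1, ⟨zero_le_one, le_rfl⟩, fun i _ => by simpa using hφ i⟩
    ⟨0, ⟨le_rfl, zero_le_one⟩, fun i _ => by simpa using hψ i⟩
  exact ⟨x, hx.1, hx.2, hx1, hx2⟩

theorem posNeg_gridHat {x₀ x₁ ρ h x : ℝ} (hρ : 0 < ρ) (hh : 0 < h) (hx : x₀ + ρ ≤ x₁ - ρ)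
    (h0 : 0 ≤ x) (h1 : x ≤ 1) :
    PosNeg fun i => x * gridHat x₀ ρ h i - (1 - x) * gridHat x₁ ρ h i := by
  refine ⟨⌈(x₀ + ρ) / h⌉, fun i hi => ?_, fun i hi => ?_⟩
  · rw [Int.lt_ceil, lt_div_iff₀ hh] at hi
    have : gridHat x₁ ρ h i = 0 := gridHat_eq_zero hρ (by
      rw [abs_of_neg (by linarith)]; linarith)
    simp only [this, mul_zero, sub_zero]
    exact mul_nonneg h0 (gridHat_nonneg _ _ _ _)
  · rw [ge_iff_le, Int.ceil_le, div_le_iff₀ hh] at hi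
    have : gridHat x₀ ρ h i = 0 := gridHat_eq_zero hρ (by
      rw [abs_of_pos (by linarith)]; linarith)
    simp only [this, mul_zero, zero_sub]
    have := mul_nonneg (sub_nonneg.2 h1) (gridHat_nonneg x₁ ρ h i)
    linarith

set_option maxHeartbeats 1600000 in
theorem grid_no_crossing {G : ℝ → ℝ → ℝ} {K L μ τ : ℝ} {X Y : ℕ → ℕ → ℤ → ℝ} {β : ℝ → ℝ} {C₁ C₂ : ℝ}
    (hμ : 0 < μ) (hτ : 0 < τ) (hK : 0 ≤ K) (hL : 0 ≤ L) (hμK : μ * (2 * K + 1) ≤ 1 / 8)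
    (hG : ∀ x a b, 0 ≤ a → a ≤ K → 0 ≤ b → b ≤ K → |G x a - G x b| ≤ L * |a - b|)
    (hX : GridSub G K μ τ X) (hX' : GridSuper G K μ τ X) (hY : GridSub G K μ τ Y)
    (hY' : GridSuper G K μ τ Y) (hβ : IsCutoff β C₁ C₂)
    {x y : ℝ → ℝ} (hXx : GridLim μ τ X x) (hYy : GridLim μ τ Y y) (hx : Continuous x)
    (hy : Continuous y)
    (h0 : ∀ᶠ N in atTop, (∀ i ≤ -2, X N 0 i ≤ Y N 0 i) ∧ ∀ i ≥ 2, Y N 0 i ≤ X N 0 i)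
    {x₀ x₁ : ℝ} (hlt : x₀ < x₁) (hx₀ : y x₀ < x x₀) : y x₁ ≤ x x₁ := by
  by_contra hx₁
  rw [not_le] at hx₁
  obtain ⟨d₀, hd₀, ρ₀, hρ₀, hρ₀', hgap₀⟩ := hXx.gap hYy hx hy hx₀ (by linarith : 0 < (x₁ - x₀) / 2)
  obtain ⟨d₁, hd₁, ρ, hρ, hρ', hgap₁⟩ := hYy.gap hXx hy hx hx₁ hρ₀
  set d := min d₀ d₁ with hd
  have hd0 : 0 < d := by positivity
  have hXb := hX.1
  have hYb := hY.1
  obtain ⟨Q₀, hQ₀, hp₀⟩ := grid_pairing (R₀ := |x₀| + ρ) (Λ := 1 / ρ) hμ hτ hL hμK hG hX hY' hβ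
      (by positivity)
  obtain ⟨Q₁, hQ₁, hp₁⟩ := grid_pairing (R₀ := |x₁| + ρ) (Λ := 1 / ρ) hμ hτ hL hμK hG hY hX' hβ
      (by positivity)
  have hδ : 0 < d * ρ / 16 := by positivity
  obtain ⟨κ, hκ1, hκ2, hκ3, hκ4⟩ := ((hp₀ _ hδ).and ((hp₁ _ hδ).and
    ((eventually_cutoff_eq_one hβ (|x₀| + ρ)).and (eventually_cutoff_eq_one hβ (|x₁| + ρ))))).exists
  have hsm : Tendsto (fun N => gh μ τ N * (3 * ((Q₀ + Q₁) * K))) atTop (nhds 0) := by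
    simpa using (tendsto_gh μ τ).mul_const (3 * ((Q₀ + Q₁) * K))
  obtain ⟨N, hN0, hN1, hN2, hN3, hN4, hN5, hN6, hN7⟩ := (hκ1.and (hκ2.and (hgap₀.and (hgap₁.and
    (h0.and (((tendsto_gh μ τ).eventually (gt_mem_nhds (by positivity : 0 < ρ / 4))).and
      ((hsm.eventually (gt_mem_nhds hδ)).and (eventually_gt_atTop 0)))))))).exists
  have hh : 0 < gh μ τ N := gh_pos hμ hτ hN7
  set h := gh μ τ N with hhdef
  obtain ⟨φ, hφ, hφN⟩ := exists_isDual N (diffCoef μ τ κ X Y N) (reactCoef G μ τ X Y N)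
    (gridHat x₀ ρ h)
  obtain ⟨ψ, hψ, hψN⟩ := exists_isDual N (diffCoef μ τ κ X Y N) (reactCoef G μ τ X Y N)
    (gridHat x₁ ρ h)
  obtain ⟨b1, b2, b3, hφ0, ⟨J, hJ⟩, hmain⟩ := hN0 φ hφ (hφN ▸ isTest_gridHat hρ hh.le)
  rw [diffCoef_comm, reactCoef_comm] at hN1
  obtain ⟨-, -, -, hψ0, ⟨J', hJ'⟩, hmain'⟩ := hN1 ψ hψ (hψN ▸ isTest_gridHat hρ hh.le)
  have low : d * ρ / 4 ≤ h * ∑' i : ℤ, β (i * h * κ ^ 6) * φ N i * (X N N i - Y N N i) := by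
    have := gridHat_pairing_ge (v := fun i : ℤ => β (i * h * κ ^ 6) * (X N N i - Y N N i))
      hρ hh (le_of_lt hN5) hd0.le (fun i hi => by
        have h3 : |i * h| ≤ |x₀| + ρ := by
          have := abs_sub_abs_le_abs_sub (i * h) x₀
          linarith
        rw [hκ3 _ h3, one_mul]
        exact (min_le_left _ _).trans (hN2 i (hi.trans hρ')))
    refine this.trans_eq ?_
    rw [hφN]; congr 1; refine tsum_congr fun i => ?_; ring
  have low' : d * ρ / 4 ≤ h * ∑' i : ℤ, β (i * h * κ ^ 6) * ψ N i * (Y N N i - X N N i) := by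
    have := gridHat_pairing_ge (v := fun i : ℤ => β (i * h * κ ^ 6) * (Y N N i - X N N i))
      hρ hh (le_of_lt hN5) hd0.le (fun i hi => by
        have h3 : |i * h| ≤ |x₁| + ρ := by
          have := abs_sub_abs_le_abs_sub (i * h) x₁
          linarith
        rw [hκ4 _ h3, one_mul]
        exact (min_le_right _ _).trans (hN3 i hi))
    refine this.trans_eq ?_
    rw [hψN]; congr 1; refine tsum_congr fun i => ?_; ring
  obtain ⟨x, hx0, hx1, hneg, hpos⟩ := exists_comb_sign (fun i => (hφ0 i).1) (fun i => (hψ0 i).1)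
    (fun x hx0 hx1 => by
      refine (hφ.comb hψ x (1 - x)).posNeg b1 b2 b3 ?_
      simp only [hφN, hψN]
      exact posNeg_gridHat hρ hh (by linarith) hx0 hx1)
  have sφ : Summable fun i : ℤ => β (i * h * κ ^ 6) * φ 0 i * (X N 0 i - Y N 0 i) :=
    summable_of_box J fun i hi => by rw [hJ i hi]; simp
  have sψ : Summable fun i : ℤ => β (i * h * κ ^ 6) * ψ 0 i * (Y N 0 i - X N 0 i) :=
    summable_of_box J' fun i hi => by rw [hJ' i hi]; simp
  have sφ' := sφ.mul_left x
  have sψ' := sψ.mul_left (1 - x)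
  set t : ℤ → ℝ := fun i => x * (β (i * h * κ ^ 6) * φ 0 i * (X N 0 i - Y N 0 i))
    + (1 - x) * (β (i * h * κ ^ 6) * ψ 0 i * (Y N 0 i - X N 0 i)) with ht
  have te : ∀ i, t i = β (i * h * κ ^ 6) * ((x * φ 0 i - (1 - x) * ψ 0 i) * (X N 0 i - Y N 0 i)) :=
    fun i => by rw [ht]; ring
  have hS : ∑' i, t i ≤ 3 * ((Q₀ + Q₁) * K) := by
    have hg : ∀ i, t i ≤ if i ∈ Finset.Icc (-1 : ℤ) 1 then (Q₀ + Q₁) * K else 0 := by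
      intro i
      have β0 := hβ.1 (i * h * κ ^ 6)
      have β1 := hβ.2.1 (i * h * κ ^ 6)
      split_ifs with hi
      · rw [te]
        have p1 := hφ0 i
        have p2 := hψ0 i
        have w1 := wt_le_one hh.le i
        have q1 : φ 0 i ≤ Q₀ := p1.2.trans (mul_le_of_le_one_right hQ₀.le w1)
        have q2 : ψ 0 i ≤ Q₁ := p2.2.trans (mul_le_of_le_one_right hQ₁.le w1)
        have c1 : |x * φ 0 i - (1 - x) * ψ 0 i| ≤ Q₀ + Q₁ := by
          have r1 := mul_nonneg hx0 p1.1
          have r2 := mul_nonneg (sub_nonneg.2 hx1) p2.1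
          have r3 := mul_le_of_le_one_left p1.1 hx1
          have r4 := mul_le_of_le_one_left p2.1 (by linarith : 1 - x ≤ 1)
          rw [abs_le]; constructor <;> linarith
        have c2 : |X N 0 i - Y N 0 i| ≤ K := by
          have := hXb N 0 i; have := hYb N 0 i
          rw [abs_le]; constructor <;> linarith
        have c3 : (x * φ 0 i - (1 - x) * ψ 0 i) * (X N 0 i - Y N 0 i) ≤ (Q₀ + Q₁) * K := by
          refine (le_abs_self _).trans ?_
          rw [abs_mul]; exact mul_le_mul c1 c2 (abs_nonneg _) (by positivity)
        have c4 : 0 ≤ (Q₀ + Q₁) * K := by positivity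
        exact (mul_le_mul_of_nonneg_left c3 β0).trans (mul_le_of_le_one_left c4 β1)
      · rw [te]
        rw [Finset.mem_Icc, not_and_or, not_le, not_le] at hi
        refine mul_nonpos_of_nonneg_of_nonpos β0 ?_
        rcases hi with hi | hi
        · exact mul_nonpos_of_nonneg_of_nonpos (hneg i (by omega))
            (by linarith [hN4.1 i (by omega)])
        · exact mul_nonpos_of_nonpos_of_nonneg (hpos i (by omega))
            (by linarith [hN4.2 i (by omega)])
    have hg2 : Summable fun i : ℤ => if i ∈ Finset.Icc (-1 : ℤ) 1 then (Q₀ + Q₁) * K else 0 :=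
      summable_of_box 1 fun i hi => if_neg (by
        rw [Finset.mem_Icc]; intro hc; have := abs_le.2 hc; omega)
    refine ((sφ'.add sψ').tsum_le_tsum hg hg2).trans_eq ?_
    rw [tsum_eq_sum (s := Finset.Icc (-1 : ℤ) 1) (fun i hi => if_neg hi),
      Finset.sum_ite_mem, Finset.inter_self, Finset.sum_const, Int.card_Icc, nsmul_eq_mul,
      show ((1 : ℤ) + 1 - -1).toNat = 3 by decide]
    norm_num
  have hsum : x * (h * ∑' i : ℤ, β (i * h * κ ^ 6) * φ 0 i * (X N 0 i - Y N 0 i))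
      + (1 - x) * (h * ∑' i : ℤ, β (i * h * κ ^ 6) * ψ 0 i * (Y N 0 i - X N 0 i))
      ≤ h * (3 * ((Q₀ + Q₁) * K)) := by
    rw [sφ'.tsum_add sψ', tsum_mul_left, tsum_mul_left] at hS
    linarith [mul_le_mul_of_nonneg_left hS hh.le]
  have f1 := mul_le_mul_of_nonneg_left (low.trans hmain) hx0
  have f2 := mul_le_mul_of_nonneg_left (low'.trans hmain') (by linarith : 0 ≤ 1 - x)
  have : 0 < d * ρ := by positivity
  linarith

/-- The sliding average `h⁻¹ ∫_{x-h/2}^{x+h/2} g`. -/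
def slide (h : ℝ) (g : ℝ → ℝ) (x : ℝ) : ℝ := h⁻¹ * ∫ y in (x - h / 2)..(x + h / 2), g y

theorem hasDerivAt_slide {h : ℝ} {g : ℝ → ℝ} (hg : Continuous g) (x : ℝ) :
    HasDerivAt (slide h g) (h⁻¹ * (g (x + h / 2) - g (x - h / 2))) x := by
  have key : slide h g = fun x => h⁻¹ * ((∫ y in (0 : ℝ)..(x + h / 2), g y)
      - ∫ y in (0 : ℝ)..(x - h / 2), g y) := by
    funext x
    rw [slide, intervalIntegral.integral_interval_sub_left] <;> exact hg.intervalIntegrable _ _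
  have h1 : ∀ y, HasDerivAt (fun z => ∫ y in (0 : ℝ)..z, g y) (g y) y := fun y =>
    intervalIntegral.integral_hasDerivAt_right (hg.intervalIntegrable _ _)
      hg.stronglyMeasurable.stronglyMeasurableAtFilter hg.continuousAt
  rw [key]
  exact (((h1 (x + h / 2)).comp_add_const x (h / 2)).sub
    ((h1 (x - h / 2)).comp_sub_const x (h / 2))).const_mul _

theorem contDiff_slide {h : ℝ} {g : ℝ → ℝ} (hg : ContDiff ℝ (⊤ : ℕ∞) g) :
    ContDiff ℝ (⊤ : ℕ∞) (slide h g) := by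
  rw [contDiff_infty_iff_deriv]
  refine ⟨fun x => (hasDerivAt_slide hg.continuous x).differentiableAt, ?_⟩
  rw [funext fun x => (hasDerivAt_slide (h := h) hg.continuous x).deriv]
  exact contDiff_const.mul ((hg.comp (contDiff_id.add contDiff_const)).sub
    (hg.comp (contDiff_id.sub contDiff_const)))

theorem slide_nonneg {h : ℝ} {g : ℝ → ℝ} (hh : 0 < h) (hg : ∀ x, 0 ≤ g x) (x : ℝ) :
    0 ≤ slide h g x :=
  mul_nonneg (by positivity) (intervalIntegral.integral_nonneg (by linarith) fun y _ => hg y)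

theorem slide_eq_zero {h r : ℝ} {g : ℝ → ℝ} (hh : 0 < h) (hg : ∀ x, r ≤ |x| → g x = 0) {x : ℝ}
    (hx : r + h / 2 ≤ |x|) : slide h g x = 0 := by
  have : EqOn g 0 (uIcc (x - h / 2) (x + h / 2)) := fun y hy => by
    rw [uIcc_of_le (by linarith)] at hy
    refine hg y ?_
    have := abs_sub_abs_le_abs_sub x y
    have : |x - y| ≤ h / 2 := by rw [abs_le]; constructor <;> linarith [hy.1, hy.2]
    linarith
  rw [slide, intervalIntegral.integral_congr this]
  simp

theorem integral_slide {h : ℝ} {g : ℝ → ℝ} (hh : 0 < h) (hg : Integrable g) :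
    ∫ x, slide h g x = ∫ x, g x := by
  have hI : Integrable (indicator (Ioc (-(h / 2)) (h / 2)) fun _ : ℝ => h⁻¹) := by
    rw [integrable_indicator_iff measurableSet_Ioc]
    exact integrableOn_const (by simp)
  have := integral_convolution (ContinuousLinearMap.lsmul ℝ ℝ) hI hg
  have e : ∀ x, slide h g x = convolution (indicator (Ioc (-(h / 2)) (h / 2)) fun _ : ℝ => h⁻¹) g
      (ContinuousLinearMap.lsmul ℝ ℝ) volume x := fun x => by
    rw [convolution_def, slide]
    have : ∀ t, (ContinuousLinearMap.lsmul ℝ ℝ)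
        (indicator (Ioc (-(h / 2)) (h / 2)) (fun _ : ℝ => h⁻¹) t) (g (x - t))
        = indicator (Ioc (-(h / 2)) (h / 2)) (fun t => h⁻¹ * g (x - t)) t := fun t => by
      by_cases ht : t ∈ Ioc (-(h / 2)) (h / 2) <;> simp [ht]
    simp only [this]
    rw [integral_indicator measurableSet_Ioc, ← intervalIntegral.integral_of_le (by linarith),
      intervalIntegral.integral_const_mul, intervalIntegral.integral_comp_sub_left (fun t => g t) x]
    congr 2; ring
  simp only [e]
  rw [this, integral_indicator measurableSet_Ioc, setIntegral_const]
  simp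
  rw [max_eq_left hh.le, mul_inv_cancel₀ hh.ne', one_mul]

/-- A smooth probability density supported in `[-r,r]`. -/
def IsKernel (r : ℝ) (θ : ℝ → ℝ) : Prop :=
  ContDiff ℝ (⊤ : ℕ∞) θ ∧ (∀ x, 0 ≤ θ x) ∧ (∀ x, r ≤ |x| → θ x = 0) ∧ ∫ x, θ x = 1

theorem IsKernel.hasCompactSupport {r : ℝ} {θ : ℝ → ℝ} (h : IsKernel r θ) : HasCompactSupport θ :=
  HasCompactSupport.intro (isCompact_Icc (a := -r) (b := r)) fun x hx => h.2.2.1 x (by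
    by_contra hc
    exact hx (abs_le.1 (not_le.1 hc).le))

theorem IsKernel.slide {r h : ℝ} {θ : ℝ → ℝ} (H : IsKernel r θ) (hh : 0 < h) :
    IsKernel (r + h / 2) (slide h θ) :=
  ⟨contDiff_slide H.1, slide_nonneg hh H.2.1, fun _ hx => slide_eq_zero hh H.2.2.1 hx, by
    rw [integral_slide hh (H.1.continuous.integrable_of_hasCompactSupport H.hasCompactSupport),
      H.2.2.2]⟩

/-- Smooth kernels whose second derivative is a discrete Laplacian. -/
theorem exists_kernel_pair {h : ℝ} (hh : 0 < h) : ∃ ζ Θ : ℝ → ℝ, IsKernel h ζ ∧ IsKernel (2 * h) Θ ∧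
    ∀ x, h ^ 2 * deriv (deriv Θ) x = ζ (x + h) - 2 * ζ x + ζ (x - h) := by
  let B : ContDiffBump (0 : ℝ) := ⟨h / 2, h, by linarith, by linarith⟩
  have hB : IsKernel h (B.normed volume) := by
    refine ⟨B.contDiff_normed, B.nonneg_normed, fun x hx => ?_, B.integral_normed⟩
    have := B.support_normed_eq (μ := volume)
    by_contra hc
    have hm : x ∈ Function.support (B.normed volume) := hc
    rw [this, Metric.mem_ball, dist_zero_right, Real.norm_eq_abs] at hm
    exact absurd hm (not_lt.2 hx)
  set ζ := B.normed volume
  refine ⟨ζ, slide h (slide h ζ), hB, by convert (hB.slide hh).slide hh using 1; ring, fun x => ?_⟩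
  rw [funext fun x => (hasDerivAt_slide (h := h) (hB.slide hh).1.continuous x).deriv]
  have d1 := (hasDerivAt_slide (h := h) hB.1.continuous (x + h / 2)).comp_add_const x (h / 2)
  have d2 := (hasDerivAt_slide (h := h) hB.1.continuous (x - h / 2)).comp_sub_const x (h / 2)
  have d3 := ((d1.sub d2).const_mul h⁻¹).deriv
  simp only [Pi.sub_apply] at d3
  rw [d3]
  have e1 : x + h / 2 + h / 2 = x + h := by ring
  have e2 : x + h / 2 - h / 2 = x := by ring
  have e3 : x - h / 2 + h / 2 = x := by ring
  have e4 : x - h / 2 - h / 2 = x - h := by ring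
  rw [e1, e2, e3, e4]
  field_simp
  ring

/-- Averages against a kernel stay close to a constant from which the function is close. -/
theorem IsKernel.avg_close {r c ω x : ℝ} {θ w : ℝ → ℝ} (H : IsKernel r θ)
    (hw : AEStronglyMeasurable w volume) (h : ∀ y, |y - x| < r → |w y - c| ≤ ω) :
    Integrable (fun y => w y * θ (y - x)) ∧ |(∫ y, w y * θ (y - x)) - c| ≤ ω := by
  have iθ : Integrable θ := H.1.continuous.integrable_of_hasCompactSupport H.hasCompactSupport
  have iθx : Integrable fun y => θ (y - x) := iθ.comp_sub_right x
  have mθ : AEStronglyMeasurable (fun y => θ (y - x)) volume := iθx.1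
  have hb : ∀ y, |(w y - c) * θ (y - x)| ≤ ω * θ (y - x) := fun y => by
    rw [abs_mul, abs_of_nonneg (H.2.1 _)]
    rcases lt_or_ge |y - x| r with hy | hy
    · exact mul_le_mul_of_nonneg_right (h y hy) (H.2.1 _)
    · simp [H.2.2.1 _ hy]
  have i1 : Integrable fun y => (w y - c) * θ (y - x) :=
    (iθx.const_mul ω).mono' ((hw.sub aestronglyMeasurable_const).mul mθ)
      (Eventually.of_forall fun y => hb y)
  have i2 : Integrable fun y => w y * θ (y - x) := by
    refine (i1.add (iθx.const_mul c)).congr (Eventually.of_forall fun y => ?_)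
    simp only [Pi.add_apply]; ring
  refine ⟨i2, ?_⟩
  have e1 : ∫ y, θ (y - x) = 1 := by rw [integral_sub_right_eq_self]; exact H.2.2.2
  have e : (∫ y, w y * θ (y - x)) - c = ∫ y, (w y - c) * θ (y - x) := by
    rw [show (fun y => (w y - c) * θ (y - x)) = fun y => w y * θ (y - x) - c * θ (y - x) from
      funext fun y => by ring, integral_sub i2 (iθx.const_mul c), integral_const_mul, e1, mul_one]
  rw [e]
  have := norm_integral_le_of_norm_le (f := fun y => (w y - c) * θ (y - x)) (iθx.const_mul ω)
    (Eventually.of_forall hb)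
  rwa [integral_const_mul, e1, mul_one] at this

theorem time_avg_close {a k c ω : ℝ} {F : ℝ → ℝ} (hk : 0 < k)
    (hF : IntervalIntegrable F volume a (a + k)) (h : ∀ s, a < s → s ≤ a + k → |F s - c| ≤ ω) :
    |k⁻¹ * (∫ s in a..(a + k), F s) - c| ≤ ω := by
  have e : k⁻¹ * (∫ s in a..(a + k), F s) - c = k⁻¹ * ∫ s in a..(a + k), (F s - c) := by
    rw [intervalIntegral.integral_sub hF intervalIntegrable_const, intervalIntegral.integral_const]
    simp only [smul_eq_mul]; field_simp; ring
  have := intervalIntegral.norm_integral_le_of_norm_le_const (a := a) (b := a + k) (C := ω)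
    (f := fun s => F s - c) (fun s hs => by
      rw [uIoc_of_le (by linarith)] at hs; exact h s hs.1 hs.2)
  rw [Real.norm_eq_abs, add_sub_cancel_left, abs_of_pos hk] at this
  rw [e, abs_mul, abs_of_pos (inv_pos.2 hk)]
  calc k⁻¹ * _ ≤ k⁻¹ * (ω * k) := mul_le_mul_of_nonneg_left this (by positivity)
    _ = ω := by field_simp

theorem exists_osc {w : ℝ → ℝ → ℝ}
    (hw : ContinuousOn (fun q : ℝ × ℝ => w q.1 q.2) (univ ×ˢ Ioi 0)) {ω t : ℝ} (hω : 0 < ω)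
    (ht : 0 < t) (R τ : ℝ) : ∃ δ > 0, ∀ x s y s', |x| ≤ R → t ≤ s → s ≤ τ → |y - x| < δ →
      |s' - s| < δ → |w y s' - w x s| ≤ ω := by
  have hc : IsCompact (Icc (-(R + 1)) (R + 1) ×ˢ Icc (t / 2) (τ + 1)) :=
      isCompact_Icc.prod isCompact_Icc
  have hu := hc.uniformContinuousOn_of_continuous (hw.mono (prod_mono (subset_univ _)
    fun s hs => (half_pos ht).trans_le hs.1))
  obtain ⟨δ, hδ, H⟩ := Metric.uniformContinuousOn_iff.1 hu ω hω
  refine ⟨min δ (min 1 (t / 2)), by positivity, fun x s y s' hx h1 h2 h3 h4 => ?_⟩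
  rw [lt_min_iff, lt_min_iff] at h3 h4
  rw [abs_le] at hx
  have a3 := abs_lt.1 h3.2.1
  have a4 := abs_lt.1 h4.2.1
  have a5 := abs_lt.1 h4.2.2
  have := H (y, s') ⟨⟨by simp only; linarith, by simp only; linarith⟩,
      ⟨by simp only; linarith, by simp only; linarith⟩⟩ (x, s)
    ⟨⟨by simp only; linarith, by simp only; linarith⟩,
      ⟨by simp only; linarith, by simp only; linarith⟩⟩
    (by rw [Prod.dist_eq, Real.dist_eq, Real.dist_eq]; exact max_lt h3.1 h4.1)
  exact this.le

/-- Functions with values in `[0,K]`, continuous for positive times; the value at time `0` is an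
initial datum. -/
def IsEvol (K : ℝ) (u : ℝ → ℝ → ℝ) : Prop :=
  (∀ x t, 0 ≤ t → 0 ≤ u x t ∧ u x t ≤ K) ∧ Measurable (fun x => u x 0) ∧
  ContinuousOn (fun q : ℝ × ℝ => u q.1 q.2) (univ ×ˢ Ioi 0)

/-- The weak form of `(u²)_{xx} + G(x,u)` at time `r`, tested with `Θ`. -/
def weakForm (G : ℝ → ℝ → ℝ) (u : ℝ → ℝ → ℝ) (Θ : ℝ → ℝ) (r : ℝ) : ℝ :=
  (∫ x, u x r ^ 2 * deriv (deriv Θ) x) + ∫ x, G x (u x r) * Θ x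

/-- Bounded nonnegative subsolutions of `u_t = (u²)_{xx} + G(x,u)` in integrated form. -/
def IsMildSub (G : ℝ → ℝ → ℝ) (K T : ℝ) (u : ℝ → ℝ → ℝ) : Prop :=
  IsEvol K u ∧ ∀ Θ : ℝ → ℝ, ContDiff ℝ (⊤ : ℕ∞) Θ → HasCompactSupport Θ → (∀ x, 0 ≤ Θ x) →
    ∀ s t, 0 ≤ s → s < t → t ≤ T →
    ∫ x, u x t * Θ x ≤ (∫ x, u x s * Θ x) + ∫ r in s..t, weakForm G u Θ r

/-- Bounded nonnegative supersolutions of `u_t = (u²)_{xx} + G(x,u)` in integrated form. -/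
def IsMildSuper (G : ℝ → ℝ → ℝ) (K T : ℝ) (u : ℝ → ℝ → ℝ) : Prop :=
  IsEvol K u ∧ ∀ Θ : ℝ → ℝ, ContDiff ℝ (⊤ : ℕ∞) Θ → HasCompactSupport Θ → (∀ x, 0 ≤ Θ x) →
    ∀ s t, 0 ≤ s → s < t → t ≤ T →
    (∫ x, u x s * Θ x) + ∫ r in s..t, weakForm G u Θ r ≤ ∫ x, u x t * Θ x

/-- Admissible reaction terms on the range `[0,K]`. -/
def IsReaction (G : ℝ → ℝ → ℝ) (K L : ℝ) : Prop :=
  Continuous (Function.uncurry G) ∧ (∀ x, G x 0 = 0) ∧ 0 ≤ K ∧ 0 ≤ L ∧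
  ∀ x a b, 0 ≤ a → a ≤ K → 0 ≤ b → b ≤ K → |G x a - G x b| ≤ L * |a - b|

theorem IsReaction.abs_le {G : ℝ → ℝ → ℝ} {K L : ℝ} (h : IsReaction G K L) {a : ℝ} (x : ℝ)
    (ha : 0 ≤ a) (hK : a ≤ K) : |G x a| ≤ L * K := by
  have := h.2.2.2.2 x a 0 ha hK le_rfl h.2.2.1
  rw [h.2.1, sub_zero, sub_zero, abs_of_nonneg ha] at this
  exact this.trans (mul_le_mul_of_nonneg_left hK h.2.2.2.1)

theorem IsEvol.measurable {K : ℝ} {u : ℝ → ℝ → ℝ} (hu : IsEvol K u) {t : ℝ}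
    (ht : 0 ≤ t) : Measurable fun x => u x t := by
  rcases ht.eq_or_lt with rfl | ht
  · exact hu.2.1
  · exact (continuousOn_univ.1 (hu.2.2.comp (f := fun x : ℝ => (x, t)) (by fun_prop)
      fun x _ => ⟨mem_univ _, ht⟩)).measurable

theorem IsEvol.continuous {K : ℝ} {u : ℝ → ℝ → ℝ} (hu : IsEvol K u) {t : ℝ}
    (ht : 0 < t) : Continuous fun x => u x t :=
  continuousOn_univ.1 (hu.2.2.comp (f := fun x : ℝ => (x, t)) (by fun_prop)
      fun x _ => ⟨mem_univ _, ht⟩)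

theorem IsEvol.continuousOn_reaction {G : ℝ → ℝ → ℝ} {K L : ℝ} {u : ℝ → ℝ → ℝ} (hu : IsEvol K u)
    (hG : IsReaction G K L) :
    ContinuousOn (fun q : ℝ × ℝ => G q.1 (u q.1 q.2)) (univ ×ˢ Ioi 0) :=
  hG.1.comp_continuousOn (f := fun q : ℝ × ℝ => (q.1, u q.1 q.2)) (continuousOn_fst.prodMk hu.2.2)

/-- Space averages of a function continuous for positive times are integrable in time. -/
theorem intervalIntegrable_avg {w : ℝ → ℝ → ℝ} {B r x a b : ℝ} {θ : ℝ → ℝ} (H : IsKernel r θ)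
    (hw : ContinuousOn (fun q : ℝ × ℝ => w q.1 q.2) (univ ×ˢ Ioi 0))
    (hB : ∀ x s, 0 < s → |w x s| ≤ B) (ha : 0 ≤ a) (hab : a ≤ b) :
    IntervalIntegrable (fun s => ∫ y, w y s * θ (y - x)) volume a b := by
  rw [intervalIntegrable_iff_integrableOn_Ioc_of_le hab]
  have hc : ContinuousOn (fun s => ∫ y, w y s * θ (y - x)) (Ioi 0) := by
    refine continuousOn_integral_of_compact_support (k := Icc (x - r) (x + r)) isCompact_Icc ?_ ?_
    · refine ContinuousOn.mul ?_ ?_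
      · exact hw.comp (f := fun q : ℝ × ℝ => (q.2, q.1)) (by fun_prop) fun q hq =>
            ⟨mem_univ _, hq.1⟩
      · exact (H.1.continuous.comp (f := fun q : ℝ × ℝ => q.2 - x) (by fun_prop)).continuousOn
    · intro s y _ hy
      rw [H.2.2.1 (y - x), mul_zero]
      by_contra hc
      have := abs_lt.1 (not_le.1 hc)
      exact hy ⟨by linarith, by linarith⟩
  refine Integrable.mono' (g := fun _ => B) (integrableOn_const (by simp))
    ((hc.mono fun s hs => ha.trans_lt hs.1).aestronglyMeasurable measurableSet_Ioc) ?_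
  filter_upwards [ae_restrict_mem measurableSet_Ioc] with s hs
  have hs0 : 0 < s := ha.trans_lt hs.1
  have hcw : Continuous fun y => w y s := continuousOn_univ.1 (hw.comp (f := fun x : ℝ => (x, s))
    (by fun_prop) fun x _ => ⟨mem_univ _, hs0⟩)
  have := (H.avg_close (c := 0) (ω := B) (x := x) (w := fun y => w y s) hcw.aestronglyMeasurable
    fun y _ => by rw [sub_zero]; exact hB y s hs0).2
  rwa [sub_zero] at this

/-- A positive width which agrees with `h` when `h > 0`. -/
def posWidth (h : ℝ) : ℝ := if 0 < h then h else 1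

theorem posWidth_pos (h : ℝ) : 0 < posWidth h := by
  unfold posWidth; split_ifs with hh
  · exact hh
  · exact one_pos

theorem posWidth_eq {h : ℝ} (hh : 0 < h) : posWidth h = h := if_pos hh

/-- The narrow smoothing kernel at scale `h`. -/
def narrowKer (h : ℝ) : ℝ → ℝ := (exists_kernel_pair (posWidth_pos h)).choose

/-- The wide smoothing kernel at scale `h`. -/
def wideKer (h : ℝ) : ℝ → ℝ := (exists_kernel_pair (posWidth_pos h)).choose_spec.choose

theorem ker_spec (h : ℝ) : IsKernel (posWidth h) (narrowKer h) ∧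
    IsKernel (2 * posWidth h) (wideKer h) ∧ ∀ x, posWidth h ^ 2 * deriv (deriv (wideKer h)) x
      = narrowKer h (x + posWidth h) - 2 * narrowKer h x + narrowKer h (x - posWidth h) :=
  (exists_kernel_pair (posWidth_pos h)).choose_spec.choose_spec

/-- Smoothed grid values of a function of space and time. -/
def gridAvg (μ τ : ℝ) (u : ℝ → ℝ → ℝ) (N n : ℕ) (i : ℤ) : ℝ :=
  ∫ y, u y (n * gk τ N) * wideKer (gh μ τ N) (y - i * gh μ τ N)

theorem gk_nonneg {τ : ℝ} (hτ : 0 < τ) (N : ℕ) : 0 ≤ gk τ N := by unfold gk; positivity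

/-- The smoothed flux of a mild solution, averaged over a time step. -/
def fluxAvg (μ τ : ℝ) (u : ℝ → ℝ → ℝ) (N n : ℕ) (i : ℤ) : ℝ :=
  (gk τ N)⁻¹ * ∫ s in (n * gk τ N)..(n * gk τ N + gk τ N),
    ∫ y, u y s ^ 2 * narrowKer (gh μ τ N) (y - i * gh μ τ N)

/-- The smoothed reaction of a mild solution, averaged over a time step. -/
def reactAvg (G : ℝ → ℝ → ℝ) (μ τ : ℝ) (u : ℝ → ℝ → ℝ) (N n : ℕ) (i : ℤ) : ℝ :=
  (gk τ N)⁻¹ * ∫ s in (n * gk τ N)..(n * gk τ N + gk τ N),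
    ∫ y, G y (u y s) * wideKer (gh μ τ N) (y - i * gh μ τ N)

theorem integral_second_diff {A B C : ℝ → ℝ} {ν : Measure ℝ} (hA : Integrable A ν)
    (hB : Integrable B ν) (hC : Integrable C ν) :
    ∫ y, (A y - 2 * B y + C y) ∂ν = (∫ y, A y ∂ν) - 2 * (∫ y, B y ∂ν) + ∫ y, C y ∂ν := by
  rw [integral_add (f := fun y => A y - 2 * B y) (hA.sub (hB.const_mul 2)) hC,
    integral_sub hA (hB.const_mul 2), integral_const_mul]

theorem intervalIntegral_second_diff {A B C D : ℝ → ℝ} {a b c : ℝ}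
    (hA : IntervalIntegrable A volume a b) (hB : IntervalIntegrable B volume a b)
    (hC : IntervalIntegrable C volume a b) (hD : IntervalIntegrable D volume a b) :
    ∫ y in a..b, (c * (A y - 2 * B y + C y) + D y) = c * ((∫ y in a..b, A y)
      - 2 * (∫ y in a..b, B y) + ∫ y in a..b, C y) + ∫ y in a..b, D y := by
  rw [intervalIntegral.integral_add (f := fun y => c * (A y - 2 * B y + C y))
    (((hA.sub (hB.const_mul 2)).add hC).const_mul c) hD, intervalIntegral.integral_const_mul,
    intervalIntegral.integral_add (f := fun y => A y - 2 * B y) (hA.sub (hB.const_mul 2)) hC,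
    intervalIntegral.integral_sub hA (hB.const_mul 2), intervalIntegral.integral_const_mul]

section
variable {G : ℝ → ℝ → ℝ} {K L μ τ : ℝ} {u : ℝ → ℝ → ℝ}

theorem IsEvol.gridAvg_mem (hu : IsEvol K u) (hτ : 0 < τ) (N n : ℕ) (i : ℤ) :
    0 ≤ gridAvg μ τ u N n i ∧ gridAvg μ τ u N n i ≤ K := by
  have ht : 0 ≤ n * gk τ N := mul_nonneg (by positivity) (gk_nonneg hτ N)
  have := ((ker_spec (gh μ τ N)).2.1.avg_close (c := K / 2) (ω := K / 2) (x := i * gh μ τ N)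
    (hu.measurable ht).aestronglyMeasurable fun y _ => by
      have := hu.1 y _ ht
      rw [abs_le]; constructor <;> linarith).2
  rw [abs_le] at this
  unfold gridAvg
  constructor <;> linarith

theorem IsEvol.sq_le (hu : IsEvol K u) (x s : ℝ) (hs : 0 < s) : |u x s ^ 2| ≤ K ^ 2 := by
  have := hu.1 x s hs.le
  rw [abs_of_nonneg (sq_nonneg _)]
  exact pow_le_pow_left₀ this.1 this.2 2

/-- Two-step averages stay close to a constant from which the function is close. -/
theorem space_time_avg_close {w : ℝ → ℝ → ℝ} {B r x a k c ω : ℝ} {θ : ℝ → ℝ} (H : IsKernel r θ)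
    (hw : ContinuousOn (fun q : ℝ × ℝ => w q.1 q.2) (univ ×ˢ Ioi 0))
    (hB : ∀ x s, 0 < s → |w x s| ≤ B) (ha : 0 ≤ a) (hk : 0 < k)
    (h : ∀ y s, |y - x| < r → a < s → s ≤ a + k → |w y s - c| ≤ ω) :
    |k⁻¹ * (∫ s in a..(a + k), ∫ y, w y s * θ (y - x)) - c| ≤ ω := by
  refine time_avg_close hk (intervalIntegrable_avg H hw hB ha (by linarith)) fun s h1 h2 => ?_
  have hs0 : 0 < s := ha.trans_lt h1
  have hcw : Continuous fun y => w y s := continuousOn_univ.1 (hw.comp (f := fun x : ℝ => (x, s))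
    (by fun_prop) fun x _ => ⟨mem_univ _, hs0⟩)
  exact (H.avg_close hcw.aestronglyMeasurable fun y hy => h y s hy h1 h2).2

theorem IsEvol.fluxAvg_abs_le (hu : IsEvol K u) (hτ : 0 < τ) (N n : ℕ) (i : ℤ) :
    |fluxAvg μ τ u N n i| ≤ K ^ 2 := by
  rcases (gk_nonneg hτ N).eq_or_lt with h | h
  · simp only [fluxAvg, ← h, inv_zero, zero_mul, abs_zero]; positivity
  · have := space_time_avg_close (w := fun y s => u y s ^ 2) (c := 0) (ω := K ^ 2)
      (x := i * gh μ τ N) (ker_spec (gh μ τ N)).1 (hu.2.2.pow 2) hu.sq_le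
      (mul_nonneg (by positivity) (gk_nonneg hτ N) : 0 ≤ (n : ℝ) * gk τ N) h
      fun y s _ h1 _ => by
        rw [sub_zero]
        exact hu.sq_le y s ((mul_nonneg (by positivity) (gk_nonneg hτ N)).trans_lt h1)
    rwa [sub_zero] at this

theorem IsEvol.reactAvg_abs_le (hu : IsEvol K u) (hG : IsReaction G K L) (hτ : 0 < τ)
    (N n : ℕ) (i : ℤ) : |reactAvg G μ τ u N n i| ≤ L * K := by
  have hLK : 0 ≤ L * K := mul_nonneg hG.2.2.2.1 hG.2.2.1
  have hb : ∀ x s, 0 < s → |G x (u x s)| ≤ L * K := fun x s hs =>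
    hG.abs_le x (hu.1 x s hs.le).1 (hu.1 x s hs.le).2
  rcases (gk_nonneg hτ N).eq_or_lt with h | h
  · simp only [reactAvg, ← h, inv_zero, zero_mul, abs_zero]; exact hLK
  · have := space_time_avg_close (w := fun y s => G y (u y s)) (c := 0) (ω := L * K)
      (x := i * gh μ τ N) (ker_spec (gh μ τ N)).2.1 (hu.continuousOn_reaction hG) hb
      (mul_nonneg (by positivity) (gk_nonneg hτ N) : 0 ≤ (n : ℝ) * gk τ N) h
      fun y s _ h1 _ => by
        rw [sub_zero]
        exact hb y s ((mul_nonneg (by positivity) (gk_nonneg hτ N)).trans_lt h1)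
    rwa [sub_zero] at this

/-- The weak form tested with a shifted wide kernel is the discrete right-hand side. -/
theorem IsEvol.integral_weakForm (hu : IsEvol K u) (hG : IsReaction G K L) (hμ : 0 < μ) (hτ : 0 < τ)
    {N : ℕ} (hN : 0 < N) (n : ℕ) (i : ℤ) :
    ∫ s in (n * gk τ N)..(n * gk τ N + gk τ N),
        weakForm G u (fun y => wideKer (gh μ τ N) (y - i * gh μ τ N)) s
      = μ * lap (fluxAvg μ τ u N n) i + gk τ N * reactAvg G μ τ u N n i := by
  have hk := gk_pos hτ hN
  have hh := gh_pos hμ hτ hN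
  have hμk := gh_sq hμ hτ N
  obtain ⟨k1, k2, k3⟩ := ker_spec (gh μ τ N)
  rw [posWidth_eq hh] at k1 k2 k3
  unfold weakForm fluxAvg reactAvg lap
  generalize gk τ N = k at *
  generalize narrowKer (gh μ τ N) = ζ at *
  generalize wideKer (gh μ τ N) = Θ at *
  generalize gh μ τ N = h at *
  have ht : (0 : ℝ) ≤ n * k := by positivity
  have hd : ∀ y, deriv (deriv fun y => Θ (y - i * h)) y = deriv (deriv Θ) (y - i * h) := fun y => by
    rw [show (deriv fun y => Θ (y - i * h)) = fun y => deriv Θ (y - i * h) from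
      funext fun y => deriv_comp_sub_const _ _ _]
    exact deriv_comp_sub_const _ _ _
  have I : ∀ j : ℤ, IntervalIntegrable (fun s => ∫ y, u y s ^ 2 * ζ (y - j * h)) volume
      (n * k) (n * k + k) := fun j =>
    intervalIntegrable_avg (w := fun y s => u y s ^ 2) k1 (hu.2.2.pow 2) hu.sq_le ht (by linarith)
  have J : IntervalIntegrable (fun s => ∫ y, G y (u y s) * Θ (y - i * h)) volume
      (n * k) (n * k + k) :=
    intervalIntegrable_avg (w := fun y s => G y (u y s)) k2 (hu.continuousOn_reaction hG)
      (fun x s hs => hG.abs_le x (hu.1 x s hs.le).1 (hu.1 x s hs.le).2) ht (by linarith)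
  have hS : ∀ s ∈ uIoc (n * k) (n * k + k), (∫ y,
      u y s ^ 2 * deriv (deriv fun y => Θ (y - i * h)) y)
      + ∫ y, G y (u y s) * Θ (y - i * h) = (h ^ 2)⁻¹ * ((∫ y, u y s ^ 2 * ζ (y - (i + 1 : ℤ) * h))
        - 2 * (∫ y, u y s ^ 2 * ζ (y - i * h)) + ∫ y, u y s ^ 2 * ζ (y - (i - 1 : ℤ) * h))
        + ∫ y, G y (u y s) * Θ (y - i * h) := fun s hs => by
    rw [uIoc_of_le (by linarith)] at hs
    have hs0 : 0 < s := ht.trans_lt hs.1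
    have i1 : ∀ j : ℤ, Integrable fun y => u y s ^ 2 * ζ (y - j * h) := fun j =>
      (k1.avg_close (c := 0) (ω := K ^ 2) ((hu.measurable hs0.le).pow_const 2).aestronglyMeasurable
        fun y _ => by rw [sub_zero]; exact hu.sq_le y s hs0).1
    congr 1
    rw [← integral_second_diff (i1 _) (i1 _) (i1 _), ← integral_const_mul]
    refine integral_congr_ae (Eventually.of_forall fun y => ?_)
    simp only
    rw [hd]
    have := k3 (y - i * h)
    rw [show y - i * h + h = y - ((i - 1 : ℤ) : ℝ) * h by push_cast; ring,
      show y - i * h - h = y - ((i + 1 : ℤ) : ℝ) * h by push_cast; ring] at this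
    rw [show deriv (deriv Θ) (y - i * h) = (h ^ 2)⁻¹ * (h ^ 2 * deriv (deriv Θ) (y - i * h)) by
      field_simp, this]
    ring
  rw [intervalIntegral.integral_congr_ae (Eventually.of_forall hS),
    intervalIntegral_second_diff (I _) (I _) (I _) J]
  have : μ * k⁻¹ = (h ^ 2)⁻¹ := by rw [← hμk]; field_simp
  rw [← this]
  field_simp

end

section
variable {G : ℝ → ℝ → ℝ} {K L μ τ : ℝ} {u : ℝ → ℝ → ℝ}

theorem eventually_steps_small (hμ : 0 < μ) (hτ : 0 < τ) {δ : ℝ} (hδ : 0 < δ) :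
    ∀ᶠ N in atTop, 0 < N ∧ 0 < gk τ N ∧ gk τ N < δ ∧ 0 < gh μ τ N ∧ 2 * gh μ τ N < δ ∧
      ∀ n ≤ N, (n : ℝ) * gk τ N ≤ τ := by
  filter_upwards [eventually_gt_atTop 0, (tendsto_gk τ).eventually (gt_mem_nhds hδ),
    (tendsto_gh μ τ).eventually (gt_mem_nhds (half_pos hδ))] with N h1 h2 h3
  refine ⟨h1, gk_pos hτ h1, h2, gh_pos hμ hτ h1, by linarith, fun n hn => ?_⟩
  exact (mul_le_mul_of_nonneg_right (Nat.cast_le.2 hn) (gk_nonneg hτ N)).trans_eq (mul_gk h1)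

theorem IsEvol.gridAvg_close (hu : IsEvol K u) (hμ : 0 < μ) (hτ : 0 < τ) {ω t : ℝ} (hω : 0 < ω)
    (ht : 0 < t) (R : ℝ) : ∀ᶠ N in atTop, ∀ n ≤ N, ∀ i : ℤ, t ≤ n * gk τ N → |i * gh μ τ N| ≤ R →
      |gridAvg μ τ u N n i - u (i * gh μ τ N) (n * gk τ N)| ≤ ω := by
  obtain ⟨δ, hδ, H⟩ := exists_osc hu.2.2 hω ht R τ
  filter_upwards [eventually_steps_small hμ hτ hδ] with N ⟨h1, h2, h3, h4, h5, h6⟩ n hn i hi1 hi2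
  have k2 := (ker_spec (gh μ τ N)).2.1
  rw [posWidth_eq h4] at k2
  exact (k2.avg_close (hu.measurable (ht.le.trans hi1)).aestronglyMeasurable fun y hy =>
    H _ _ y _ hi2 hi1 (h6 n hn) (hy.trans h5) (by simpa using hδ)).2

/-- Space-time averages at grid points are close to the point values. -/
theorem eventually_avg_close {w : ℝ → ℝ → ℝ} {B : ℝ} {θ : ℕ → ℝ → ℝ} (hμ : 0 < μ) (hτ : 0 < τ)
    (hθ : ∀ᶠ N in atTop, IsKernel (2 * gh μ τ N) (θ N))
    (hw : ContinuousOn (fun q : ℝ × ℝ => w q.1 q.2) (univ ×ˢ Ioi 0))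
    (hB : ∀ x s, 0 < s → |w x s| ≤ B) {ω t : ℝ} (hω : 0 < ω) (ht : 0 < t) (R : ℝ) :
    ∀ᶠ N in atTop, ∀ n ≤ N, ∀ i : ℤ, t ≤ n * gk τ N → |i * gh μ τ N| ≤ R →
      |(gk τ N)⁻¹ * (∫ s in (n * gk τ N)..(n * gk τ N + gk τ N),
        ∫ y, w y s * θ N (y - i * gh μ τ N)) - w (i * gh μ τ N) (n * gk τ N)| ≤ ω := by
  obtain ⟨δ, hδ, H⟩ := exists_osc hw hω ht R τ
  filter_upwards [eventually_steps_small hμ hτ hδ, hθ] with N ⟨h1, h2, h3, h4, h5, h6⟩ k2 n hn i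
    hi1 hi2
  exact space_time_avg_close k2 hw hB (ht.le.trans hi1) h2 fun y s hy hs1 hs2 =>
    H _ _ y s hi2 hi1 (h6 n hn) (hy.trans h5) (by rw [abs_of_pos] <;> linarith)

theorem IsKernel.mono {r r' : ℝ} {θ : ℝ → ℝ} (h : IsKernel r θ) (hr : r ≤ r') : IsKernel r' θ :=
  ⟨h.1, h.2.1, fun x hx => h.2.2.1 x (hr.trans hx), h.2.2.2⟩

theorem IsEvol.gridSmall_flux (hu : IsEvol K u) (hG : IsReaction G K L) (hμ : 0 < μ) (hτ : 0 < τ) :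
    GridSmall μ τ fun N n i => fluxAvg μ τ u N n i - gridAvg μ τ u N n i ^ 2 := by
  have hK := hG.2.2.1
  refine ⟨⟨K ^ 2 + K ^ 2, fun N n i => (abs_sub _ _).trans
    (add_le_add (hu.fluxAvg_abs_le hτ N n i) ?_)⟩,
    fun ω hω t ht R => ?_⟩
  · have := hu.gridAvg_mem (μ := μ) hτ N n i
    rw [abs_of_nonneg (sq_nonneg _)]
    exact pow_le_pow_left₀ this.1 this.2 2
  · have hω2 : 0 < ω / (4 * (K + 1)) := by positivity
    filter_upwards [hu.gridAvg_close hμ hτ hω2 ht R, eventually_avg_close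
      (w := fun y s => u y s ^ 2) (θ := fun N => narrowKer (gh μ τ N)) hμ hτ (by
        filter_upwards [eventually_steps_small hμ hτ one_pos] with N h
        have k1 := (ker_spec (gh μ τ N)).1
        rw [posWidth_eq h.2.2.2.1] at k1
        exact k1.mono (by linarith [h.2.2.2.1])) (hu.2.2.pow 2) hu.sq_le (half_pos hω) ht R]
      with N h1 h2 n hn i hi1 hi2
    have a1 := h1 n hn i hi1 hi2
    have a2 := h2 n hn i hi1 hi2
    have b1 := hu.gridAvg_mem (μ := μ) hτ N n i
    have b2 := hu.1 (i * gh μ τ N) _ (ht.le.trans hi1)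
    change |fluxAvg μ τ u N n i - _| ≤ _ at a2
    have a3 : |gridAvg μ τ u N n i ^ 2 - u (i * gh μ τ N) (n * gk τ N) ^ 2| ≤ ω / 2 := by
      rw [sq_sub_sq, abs_mul, abs_of_nonneg (by linarith)]
      calc _ ≤ (2 * K) * (ω / (4 * (K + 1))) :=
            mul_le_mul (by linarith) a1 (abs_nonneg _) (by linarith)
        _ ≤ ω / 2 := by
            rw [mul_div_assoc', div_le_div_iff₀ (by positivity) two_pos]; nlinarith
    rw [abs_le] at *
    constructor <;> linarith [a2.1, a2.2, a3.1, a3.2]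

theorem IsEvol.gridSmall_react (hu : IsEvol K u) (hG : IsReaction G K L) (hμ : 0 < μ) (hτ : 0 < τ) :
    GridSmall μ τ fun N n i => reactAvg G μ τ u N n i - G (i * gh μ τ N) (gridAvg μ τ u N n i) := by
  have hL := hG.2.2.2.1
  refine ⟨⟨L * K + L * K, fun N n i => (abs_sub _ _).trans
    (add_le_add (hu.reactAvg_abs_le hG hτ N n i) ?_)⟩, fun ω hω t ht R => ?_⟩
  · have := hu.gridAvg_mem (μ := μ) hτ N n i
    exact hG.abs_le _ this.1 this.2
  · have hω2 : 0 < ω / (2 * (L + 1)) := by positivity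
    filter_upwards [hu.gridAvg_close hμ hτ hω2 ht R, eventually_avg_close
      (w := fun y s => G y (u y s)) (θ := fun N => wideKer (gh μ τ N)) hμ hτ (by
        filter_upwards [eventually_steps_small hμ hτ one_pos] with N h
        have k1 := (ker_spec (gh μ τ N)).2.1
        rwa [posWidth_eq h.2.2.2.1] at k1) (hu.continuousOn_reaction hG)
        (fun x s hs => hG.abs_le x (hu.1 x s hs.le).1 (hu.1 x s hs.le).2) (half_pos hω) ht R]
      with N h1 h2 n hn i hi1 hi2
    have a1 := h1 n hn i hi1 hi2
    have a2 := h2 n hn i hi1 hi2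
    have b1 := hu.gridAvg_mem (μ := μ) hτ N n i
    have b2 := hu.1 (i * gh μ τ N) _ (ht.le.trans hi1)
    change |reactAvg G μ τ u N n i - _| ≤ _ at a2
    have a3 := hG.2.2.2.2 (i * gh μ τ N) _ _ b1.1 b1.2 b2.1 b2.2
    have a4 : L * |gridAvg μ τ u N n i - u (i * gh μ τ N) (n * gk τ N)| ≤ ω / 2 := by
      calc _ ≤ L * (ω / (2 * (L + 1))) := mul_le_mul_of_nonneg_left a1 hL
        _ ≤ ω / 2 := by
            rw [mul_div_assoc', div_le_div_iff₀ (by positivity) two_pos]; nlinarith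
    have a5 := a3.trans a4
    rw [abs_le] at a2 a5 ⊢
    constructor <;> linarith [a2.1, a2.2, a5.1, a5.2]

theorem IsEvol.gridLim (hu : IsEvol K u) (hμ : 0 < μ) (hτ : 0 < τ) :
    GridLim μ τ (gridAvg μ τ u) fun x => u x τ := fun ω hω R => by
  filter_upwards [hu.gridAvg_close hμ hτ hω hτ R, eventually_gt_atTop 0] with N h hN i hi
  have := h N le_rfl i (mul_gk hN).ge hi
  rwa [mul_gk hN] at this

theorem IsMildSub.gridSub {T : ℝ} (hu : IsMildSub G K T u) (hG : IsReaction G K L) (hμ : 0 < μ)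
    (hτ : 0 < τ)
    (hT : τ ≤ T) : GridSub G K μ τ (gridAvg μ τ u) := by
  refine ⟨fun N n i => hu.1.gridAvg_mem hτ N n i, _, _, hu.1.gridSmall_flux hG hμ hτ,
    hu.1.gridSmall_react hG hμ hτ, ?_⟩
  filter_upwards [eventually_gt_atTop 0] with N hN n hn i
  have hk := gk_pos hτ hN
  have ht : (0 : ℝ) ≤ n * gk τ N := by positivity
  have hn1 : n * gk τ N + gk τ N ≤ T := by
    have := mul_le_mul_of_nonneg_right (Nat.cast_le (α := ℝ).2 (Nat.succ_le_of_lt hn)) hk.le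
    rw [mul_gk hN] at this
    push_cast at this
    linarith
  obtain ⟨-, k2, -⟩ := ker_spec (gh μ τ N)
  have main := hu.2 (fun y => wideKer (gh μ τ N) (y - i * gh μ τ N))
    (k2.1.comp (contDiff_id.sub contDiff_const))
    (k2.hasCompactSupport.comp_homeomorph (Homeomorph.subRight ((i : ℝ) * gh μ τ N)))
    (fun x => k2.2.1 _) (n * gk τ N) (n * gk τ N + gk τ N) ht (by linarith) hn1
  rw [hu.1.integral_weakForm hG hμ hτ hN, ← add_assoc] at main
  simp only [add_sub_cancel]
  rwa [gridAvg, show ((n + 1 : ℕ) : ℝ) * gk τ N = n * gk τ N + gk τ N by push_cast; ring]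

theorem IsMildSuper.gridSuper {T : ℝ} (hu : IsMildSuper G K T u) (hG : IsReaction G K L)
    (hμ : 0 < μ)
    (hτ : 0 < τ) (hT : τ ≤ T) : GridSuper G K μ τ (gridAvg μ τ u) := by
  refine ⟨fun N n i => hu.1.gridAvg_mem hτ N n i, _, _, hu.1.gridSmall_flux hG hμ hτ,
    hu.1.gridSmall_react hG hμ hτ, ?_⟩
  filter_upwards [eventually_gt_atTop 0] with N hN n hn i
  have hk := gk_pos hτ hN
  have ht : (0 : ℝ) ≤ n * gk τ N := by positivity
  have hn1 : n * gk τ N + gk τ N ≤ T := by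
    have := mul_le_mul_of_nonneg_right (Nat.cast_le (α := ℝ).2 (Nat.succ_le_of_lt hn)) hk.le
    rw [mul_gk hN] at this
    push_cast at this
    linarith
  obtain ⟨-, k2, -⟩ := ker_spec (gh μ τ N)
  have main := hu.2 (fun y => wideKer (gh μ τ N) (y - i * gh μ τ N))
    (k2.1.comp (contDiff_id.sub contDiff_const))
    (k2.hasCompactSupport.comp_homeomorph (Homeomorph.subRight ((i : ℝ) * gh μ τ N)))
    (fun x => k2.2.1 _) (n * gk τ N) (n * gk τ N + gk τ N) ht (by linarith) hn1
  rw [hu.1.integral_weakForm hG hμ hτ hN, ← add_assoc] at main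
  simp only [add_sub_cancel]
  rwa [gridAvg.eq_1 _ _ _ _ (n + 1),
    show ((n + 1 : ℕ) : ℝ) * gk τ N = n * gk τ N + gk τ N by push_cast; ring]

end

/-- A second-difference bound from a bound on the second derivative. -/
theorem second_diff_le {g g' g'' : ℝ → ℝ} {C : ℝ} (h1 : ∀ x, HasDerivAt g (g' x) x)
    (h2 : ∀ x, HasDerivAt g' (g'' x) x) (hC : ∀ x, |g'' x| ≤ C) (x d : ℝ) :
    |g (x + d) - 2 * g x + g (x - d)| ≤ C * d ^ 2 := by
  wlog hd : 0 ≤ d generalizing d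
  · have := this (-d) (by linarith)
    rw [sub_neg_eq_add, ← sub_eq_add_neg, neg_sq] at this
    rwa [show g (x + d) - 2 * g x + g (x - d) = g (x - d) - 2 * g x + g (x + d) by ring]
  have hg1 : ∀ a b, |g' a - g' b| ≤ C * |a - b| := fun a b => by
    have := convex_univ.norm_image_sub_le_of_norm_hasDerivWithin_le (f := g') (f' := g'') (C := C)
      (fun x _ => (h2 x).hasDerivWithinAt) (fun x _ => hC x) (mem_univ b) (mem_univ a)
    exact this
  have hC0 : 0 ≤ C := (abs_nonneg _).trans (hC 0)
  let D : ℝ → ℝ := fun s => g (x + s) + g (x - s)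
  have hD : ∀ s, HasDerivAt D (g' (x + s) - g' (x - s)) s := fun s => by
    have a1 := (h1 (x + s)).comp_const_add x s
    have a2 := (h1 (x - s)).comp_const_sub x s
    exact a1.add a2
  have h3 := image_norm_le_of_norm_deriv_right_le_deriv_boundary (f := fun s => D s - D 0)
    (f' := fun s => g' (x + s) - g' (x - s)) (a := 0) (b := d) (B := fun s => C * s ^ 2)
    (B' := fun s => C * (2 * s)) (fun s _ => ((hD s).sub_const _).continuousAt.continuousWithinAt)
    (fun s _ => ((hD s).sub_const _).hasDerivWithinAt) (by simp)
    (fun s => by simpa using (hasDerivAt_pow 2 s).const_mul C)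
    (fun s hs => by
      refine (hg1 _ _).trans (mul_le_mul_of_nonneg_left ?_ hC0)
      rw [abs_of_nonneg] <;> linarith [hs.1]) (right_mem_Icc.2 hd)
  simp only [D, add_zero, sub_zero, Real.norm_eq_abs] at h3
  rwa [show g (x + d) - 2 * g x + g (x - d) = g (x + d) + g (x - d) - (g x + g x) by ring]

theorem exists_isCutoff : ∃ β C₁ C₂, IsCutoff β C₁ C₂ := by
  let B : ContDiffBump (0 : ℝ) := ⟨1, 2, by norm_num, by norm_num⟩
  have hs : ContDiff ℝ (⊤ : ℕ∞) B := B.contDiff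
  have hc : HasCompactSupport (B : ℝ → ℝ) := B.hasCompactSupport
  obtain ⟨C₁, h1⟩ := hc.deriv.exists_bound_of_continuous (hs.continuous_deriv (by simp))
  have hs' : ContDiff ℝ (⊤ : ℕ∞) (deriv B) := (contDiff_infty_iff_deriv.1 hs).2
  obtain ⟨C₂, h2⟩ := hc.deriv.deriv.exists_bound_of_continuous (hs'.continuous_deriv (by simp))
  have d1 : ∀ x, HasDerivAt B (deriv B x) x := fun x =>
    (hs.differentiable (by simp) x).hasDerivAt
  refine ⟨B, C₁, C₂, fun x => B.nonneg, fun x => B.le_one, fun x hx => ?_, fun x hx => ?_,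
    fun x d => ?_, second_diff_le d1 (fun x => (hs'.differentiable (by simp) x).hasDerivAt) h2⟩
  · exact B.one_of_mem_closedBall (by simpa using hx)
  · exact B.zero_of_le_dist (by simpa using hx.le)
  · have := convex_univ.norm_image_sub_le_of_norm_hasDerivWithin_le (f := B) (f' := deriv B)
        (C := C₁)
      (fun x _ => (d1 x).hasDerivWithinAt) (fun x _ => h1 x) (mem_univ x) (mem_univ (x + d))
    simpa using this

section
variable {G : ℝ → ℝ → ℝ} {K L T T' s₀ a : ℝ} {u w : ℝ → ℝ → ℝ}

theorem IsEvol.shift (hu : IsEvol K u) (a : ℝ) (hs : 0 ≤ s₀) :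
    IsEvol K fun x t => u (x + a) (t + s₀) := by
  refine ⟨fun x t ht => hu.1 _ _ (by linarith), ?_, ?_⟩
  · exact (hu.measurable (by simpa using hs)).comp (measurable_add_const a)
  · exact hu.2.2.comp (f := fun q : ℝ × ℝ => (q.1 + a, q.2 + s₀)) (by fun_prop)
      fun q hq => ⟨mem_univ _, add_pos_of_pos_of_nonneg (mem_Ioi.1 hq.2) hs⟩

theorem integral_mul_translate (w Θ : ℝ → ℝ) (a : ℝ) :
    ∫ x, w (x + a) * Θ x = ∫ x, w x * Θ (x - a) := by
  rw [← integral_add_right_eq_self (fun x => w x * Θ (x - a)) a]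
  simp

theorem weakForm_shift (hper : ∀ x v, G (x + a) v = G x v) (Θ : ℝ → ℝ) (r : ℝ) :
    weakForm G (fun x t => u (x + a) (t + s₀)) Θ r = weakForm G u (fun x => Θ (x - a))
      (r + s₀) := by
  unfold weakForm
  have h : deriv (deriv fun x => Θ (x - a)) = fun x => deriv (deriv Θ) (x - a) := by
    have : deriv (fun x => Θ (x - a)) = fun x => deriv Θ (x - a) :=
      funext fun x => deriv_comp_sub_const ..
    rw [this]
    exact funext fun x => deriv_comp_sub_const ..
  rw [h, ← integral_mul_translate, ← integral_mul_translate (fun x => G x (u x (r + s₀)))]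
  simp only [hper]

theorem IsMildSub.shift (hu : IsMildSub G K T u) (hper : ∀ x v, G (x + a) v = G x v)
    (hs : 0 ≤ s₀) (hT : T' + s₀ ≤ T) : IsMildSub G K T' fun x t => u (x + a) (t + s₀) := by
  refine ⟨hu.1.shift a hs, fun Θ h1 h2 h3 s t h4 h5 h6 => ?_⟩
  have := hu.2 (fun x => Θ (x - a)) (h1.comp (contDiff_id.sub contDiff_const))
    (h2.comp_homeomorph (Homeomorph.subRight a)) (fun x => h3 _) (s + s₀) (t + s₀) (by linarith)
    (by linarith) (by linarith)
  rw [← integral_mul_translate, ← integral_mul_translate,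
    ← intervalIntegral.integral_comp_add_right] at this
  simpa only [weakForm_shift hper] using this

theorem IsMildSuper.shift (hu : IsMildSuper G K T u) (hper : ∀ x v, G (x + a) v = G x v)
    (hs : 0 ≤ s₀) (hT : T' + s₀ ≤ T) : IsMildSuper G K T' fun x t => u (x + a) (t + s₀) := by
  refine ⟨hu.1.shift a hs, fun Θ h1 h2 h3 s t h4 h5 h6 => ?_⟩
  have := hu.2 (fun x => Θ (x - a)) (h1.comp (contDiff_id.sub contDiff_const))
    (h2.comp_homeomorph (Homeomorph.subRight a)) (fun x => h3 _) (s + s₀) (t + s₀) (by linarith)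
    (by linarith) (by linarith)
  rw [← integral_mul_translate, ← integral_mul_translate,
    ← intervalIntegral.integral_comp_add_right] at this
  simpa only [weakForm_shift hper] using this

theorem IsEvol.gridAvg_zero_le (hu : IsEvol K u) (hw : IsEvol K w) {μ τ : ℝ} {N : ℕ} {i : ℤ}
    (h : ∀ y, |y - i * gh μ τ N| < 2 * posWidth (gh μ τ N) → u y 0 ≤ w y 0) :
    gridAvg μ τ u N 0 i ≤ gridAvg μ τ w N 0 i := by
  have k := (ker_spec (gh μ τ N)).2.1
  have I : ∀ {v : ℝ → ℝ → ℝ}, IsEvol K v →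
      Integrable fun y => v y 0 * wideKer (gh μ τ N) (y - i * gh μ τ N) := fun {v} hv =>
    (k.avg_close (c := 0) (ω := K) hv.2.1.aestronglyMeasurable fun y _ => by
      rw [sub_zero, abs_of_nonneg (hv.1 y 0 le_rfl).1]; exact (hv.1 y 0 le_rfl).2).1
  simp only [gridAvg, Nat.cast_zero, zero_mul]
  refine integral_mono (I hu) (I hw) fun y => ?_
  by_cases hy : |y - i * gh μ τ N| < 2 * posWidth (gh μ τ N)
  · exact mul_le_mul_of_nonneg_right (h y hy) (k.2.1 _)
  · simp [k.2.2.1 _ (not_lt.1 hy)]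

theorem courant_pos (hK : 0 ≤ K) : 0 < 1 / (8 * (2 * K + 1)) := by positivity

theorem courant_le (hK : 0 ≤ K) : 1 / (8 * (2 * K + 1)) * (2 * K + 1) ≤ 1 / 8 := by
  have : 0 < 2 * K + 1 := by linarith
  rw [one_div, mul_inv, mul_assoc, inv_mul_cancel₀ this.ne']
  norm_num

/-- Comparison principle. -/
theorem IsMildSub.le (hu : IsMildSub G K T u) (hw : IsMildSuper G K T w) (hG : IsReaction G K L)
    (h0 : ∀ x, u x 0 ≤ w x 0) {t : ℝ} (ht : 0 < t) (hT : t ≤ T) (x : ℝ) : u x t ≤ w x t := by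
  have hK := hG.2.2.1
  have hμ := courant_pos hK
  obtain ⟨β, C₁, C₂, hβ⟩ := exists_isCutoff
  exact grid_comparison hμ ht hG.2.2.2.1 (courant_le hK) hG.2.2.2.2 (hu.gridSub hG hμ ht hT)
    (hw.gridSuper hG hμ ht hT) hβ (hu.1.gridLim hμ ht) (hw.1.gridLim hμ ht) (hu.1.continuous ht)
    (hw.1.continuous ht) (fun ω hω => Eventually.of_forall fun N i =>
      (hu.1.gridAvg_zero_le hw.1 fun y _ => h0 y).trans (by linarith)) x

/-- If the initial data cross only once, at the origin, the solutions cross at most once later. -/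
theorem IsMildSub.no_crossing (hu : IsMildSub G K T u) (hu' : IsMildSuper G K T u)
    (hw : IsMildSub G K T w) (hw' : IsMildSuper G K T w) (hG : IsReaction G K L)
    (hl : ∀ x ≤ 0, u x 0 ≤ w x 0) (hr : ∀ x > 0, w x 0 ≤ u x 0) {t : ℝ} (ht : 0 < t)
    (hT : t ≤ T) {x₀ x₁ : ℝ} (hlt : x₀ < x₁) (hx₀ : w x₀ t < u x₀ t) : w x₁ t ≤ u x₁ t := by
  have hK := hG.2.2.1
  have hμ := courant_pos hK
  obtain ⟨β, C₁, C₂, hβ⟩ := exists_isCutoff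
  refine grid_no_crossing hμ ht hK hG.2.2.2.1 (courant_le hK) hG.2.2.2.2 (hu.gridSub hG hμ ht hT)
    (hu'.gridSuper hG hμ ht hT) (hw.gridSub hG hμ ht hT) (hw'.gridSuper hG hμ ht hT) hβ
    (hu.1.gridLim hμ ht) (hw.1.gridLim hμ ht) (hu.1.continuous ht) (hw.1.continuous ht) ?_ hlt hx₀
  filter_upwards [eventually_gt_atTop 0] with N hN
  have hh := gh_pos hμ ht hN
  refine ⟨fun i hi => hu.1.gridAvg_zero_le hw.1 fun y hy => hl y ?_,
    fun i hi => hw.1.gridAvg_zero_le hu.1 fun y hy => hr y ?_⟩ <;>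
  rw [posWidth_eq hh, abs_lt] at hy
  · have : (i : ℝ) ≤ -2 := by exact_mod_cast hi
    nlinarith [hy.2]
  · have : (2 : ℝ) ≤ i := by exact_mod_cast hi
    nlinarith [hy.1]

end

/-- Spatial averages of a function continuous for positive times are integrable in time. -/
theorem intervalIntegrable_test {w : ℝ → ℝ → ℝ} {B a b : ℝ} {Θ : ℝ → ℝ} (hΘ : Continuous Θ)
    (hs : HasCompactSupport Θ)
    (hw : ContinuousOn (fun q : ℝ × ℝ => w q.1 q.2) (univ ×ˢ Ioi 0))
    (hB : ∀ x s, 0 < s → |w x s| ≤ B) (ha : 0 ≤ a) (hb : 0 ≤ b) :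
    IntervalIntegrable (fun s => ∫ y, w y s * Θ y) volume a b := by
  have h0 : 0 ≤ min a b := le_min ha hb
  rw [intervalIntegrable_iff]
  have hc : ContinuousOn (fun s => ∫ y, w y s * Θ y) (Ioi 0) := by
    refine continuousOn_integral_of_compact_support (k := tsupport Θ) hs ?_ ?_
    · refine ContinuousOn.mul ?_ ?_
      · exact hw.comp (f := fun q : ℝ × ℝ => (q.2, q.1)) (by fun_prop) fun q hq =>
            ⟨mem_univ _, hq.1⟩
      · exact (hΘ.comp continuous_snd).continuousOn
    · intro s y _ hy
      rw [image_eq_zero_of_notMem_tsupport hy, mul_zero]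
  refine Integrable.mono' (g := fun _ => ∫ y, B * |Θ y|) (integrableOn_const (by simp))
    ((hc.mono fun s hs => h0.trans_lt hs.1).aestronglyMeasurable measurableSet_uIoc) ?_
  filter_upwards [ae_restrict_mem measurableSet_uIoc] with s hs'
  refine norm_integral_le_of_norm_le
    ((hΘ.abs.integrable_of_hasCompactSupport hs.norm).const_mul B)
      (Eventually.of_forall fun y => ?_)
  rw [Real.norm_eq_abs, abs_mul]
  exact mul_le_mul_of_nonneg_right (hB y s (h0.trans_lt hs'.1)) (abs_nonneg _)

section
variable {G : ℝ → ℝ → ℝ} {K L T : ℝ} {u : ℝ → ℝ → ℝ}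

theorem IsEvol.intervalIntegrable_weakForm (hu : IsEvol K u) (hG : IsReaction G K L) {Θ : ℝ → ℝ}
    (h1 : ContDiff ℝ (⊤ : ℕ∞) Θ) (h2 : HasCompactSupport Θ) {a b : ℝ} (ha : 0 ≤ a) (hb : 0 ≤ b) :
    IntervalIntegrable (fun s => ∫ y, u y s ^ 2 * deriv (deriv Θ) y) volume a b ∧
    IntervalIntegrable (fun s => ∫ y, G y (u y s) * Θ y) volume a b := by
  have h1' : ContDiff ℝ (⊤ : ℕ∞) (deriv Θ) := (contDiff_infty_iff_deriv.1 h1).2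
  exact ⟨intervalIntegrable_test (w := fun y s => u y s ^ 2) (h1'.continuous_deriv (by simp))
    h2.deriv.deriv (hu.2.2.pow 2) hu.sq_le ha hb,
    intervalIntegrable_test (w := fun y s => G y (u y s)) h1.continuous h2
      (hu.continuousOn_reaction hG)
      (fun x s hs => hG.abs_le x (hu.1 x s hs.le).1 (hu.1 x s hs.le).2) ha hb⟩

theorem IsEvol.mild_of_eq (hu : IsEvol K u) (hG : IsReaction G K L)
    (h : ∀ Θ : ℝ → ℝ, ContDiff ℝ (⊤ : ℕ∞) Θ → HasCompactSupport Θ → ∀ t, 0 < t → t ≤ T →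
      ∫ x, u x t * Θ x = (∫ x, u x 0 * Θ x) + ∫ r in 0..t, weakForm G u Θ r) :
    IsMildSub G K T u ∧ IsMildSuper G K T u := by
  have key : ∀ Θ : ℝ → ℝ, ContDiff ℝ (⊤ : ℕ∞) Θ → HasCompactSupport Θ → ∀ s t, 0 ≤ s → s < t →
      t ≤ T → ∫ x, u x t * Θ x = (∫ x, u x s * Θ x) + ∫ r in s..t, weakForm G u Θ r := by
    intro Θ h1 h2 s t hs hst hT
    have I : ∀ {a b : ℝ}, 0 ≤ a → 0 ≤ b → IntervalIntegrable (weakForm G u Θ) volume a b :=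
      fun ha hb => (hu.intervalIntegrable_weakForm hG h1 h2 ha hb).1.add
        (hu.intervalIntegrable_weakForm hG h1 h2 ha hb).2
    rcases hs.eq_or_lt with rfl | hs'
    · exact h Θ h1 h2 t hst hT
    · rw [h Θ h1 h2 t (hs'.trans hst) hT, h Θ h1 h2 s hs' (hst.le.trans hT), add_assoc,
        intervalIntegral.integral_add_adjacent_intervals (I le_rfl hs) (I hs (hs.trans hst.le))]
  exact ⟨⟨hu, fun Θ h1 h2 _ s t hs hst hT => (key Θ h1 h2 s t hs hst hT).le⟩,
    ⟨hu, fun Θ h1 h2 _ s t hs hst hT => (key Θ h1 h2 s t hs hst hT).ge⟩⟩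

/-- The extension of `u` by its initial datum at time `0`, frozen after time `T`. -/
def extendInit (T : ℝ) (u₀ : ℝ → ℝ) (u : ℝ → ℝ → ℝ) (x t : ℝ) : ℝ :=
  if t ≤ 0 then u₀ x else u x (min t T)

/-- A nonnegative very weak solution on a time horizon satisfies the integrated equation. -/
theorem mild_of_veryWeak {f : ℝ → ℝ → ℝ} {κ u₀ : ℝ → ℝ} (hT : 0 < T)
    (hG : IsReaction (fun x v => f x v * (κ x - v)) K L)
    (h0 : ∀ x, 0 ≤ u₀ x ∧ u₀ x ≤ K) (hm : Measurable u₀)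
    (hb : ∀ x, ∀ t ∈ Ioc 0 T, 0 ≤ u x t ∧ u x t ≤ K)
    (hsol : ∀ t ∈ Ioc 0 T, VeryWeakSol 2 f κ t u₀ u) :
    IsMildSub (fun x v => f x v * (κ x - v)) K T (extendInit T u₀ u) ∧
    IsMildSuper (fun x v => f x v * (κ x - v)) K T (extendInit T u₀ u) := by
  have e0 : ∀ x, extendInit T u₀ u x 0 = u₀ x := fun x => if_pos le_rfl
  have e1 : ∀ x t, 0 < t → extendInit T u₀ u x t = u x (min t T) := fun x t ht => if_neg ht.not_ge
  have hev : IsEvol K (extendInit T u₀ u) := by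
    refine ⟨fun x t ht => ?_, by simpa only [e0] using hm, ?_⟩
    · rcases ht.eq_or_lt with rfl | ht
      · rw [e0]; exact h0 x
      · rw [e1 _ _ ht]; exact hb _ _ ⟨lt_min ht hT, min_le_right _ _⟩
    · refine ContinuousOn.congr (f := fun q : ℝ × ℝ => u q.1 (min q.2 T)) ?_
        fun q hq => e1 _ _ hq.2
      exact (hsol T ⟨hT, le_rfl⟩).1.comp (f := fun q : ℝ × ℝ => (q.1, min q.2 T))
        (by fun_prop) fun q hq => ⟨mem_univ _, lt_min hq.2 hT, min_le_right _ _⟩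
  refine hev.mild_of_eq hG fun Θ h1 h2 t ht htT => ?_
  let B : ContDiffBump (0 : ℝ) := ⟨t + 1, t + 2, by linarith, by linarith⟩
  have hB : ∀ s ∈ Icc 0 t, B s = 1 := fun s hs => B.one_of_mem_closedBall (by
    rw [mem_closedBall_zero_iff, Real.norm_of_nonneg hs.1]; change s ≤ t + 1; linarith [hs.2])
  have hB' : ∀ s ∈ Ioo 0 t, deriv B s = 0 := fun s hs => by
    have : (B : ℝ → ℝ) =ᶠ[nhds s] fun _ => 1 := by
      filter_upwards [Ioo_mem_nhds hs.1 hs.2] with r hr using hB r ⟨hr.1.le, hr.2.le⟩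
    rw [this.deriv_eq, deriv_const]
  have main := (hsol t ⟨ht, htT⟩).2.2 (fun x s => Θ x * B s)
    ((h1.comp contDiff_fst).mul (B.contDiff.comp contDiff_snd)) (by
      refine HasCompactSupport.intro (K := tsupport Θ ×ˢ tsupport B)
        (h2.isCompact.prod B.hasCompactSupport.isCompact) fun q hq => ?_
      rw [mem_prod, not_and_or] at hq
      rcases hq with hq | hq
      · change Θ q.1 * B q.2 = 0
        rw [image_eq_zero_of_notMem_tsupport hq, zero_mul]
      · change Θ q.1 * B q.2 = 0
        rw [image_eq_zero_of_notMem_tsupport hq, mul_zero])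
  rw [hB t ⟨ht.le, le_rfl⟩, hB 0 ⟨le_rfl, ht.le⟩] at main
  simp only [mul_one] at main
  have i1 : ∫ s in Ioo 0 t, ∫ x, f x (u x s) * (κ x - u x s) * (Θ x * B s)
      = ∫ s in 0..t, ∫ x, f x (extendInit T u₀ u x s) * (κ x - extendInit T u₀ u x s) * Θ x := by
    rw [intervalIntegral.integral_of_le ht.le, integral_Ioc_eq_integral_Ioo]
    refine setIntegral_congr_fun measurableSet_Ioo fun s hs => ?_
    simp only [e1 _ s hs.1, min_eq_left (hs.2.le.trans htT), hB s ⟨hs.1.le, hs.2.le⟩, mul_one]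
  have i2 : ∫ s in Ioo 0 t, ∫ x, (u x s * deriv (fun r => Θ x * B r) s
        + u x s ^ (2 : ℝ) * deriv (deriv fun y => Θ y * B s) x)
      = ∫ s in 0..t, ∫ x, extendInit T u₀ u x s ^ 2 * deriv (deriv Θ) x := by
    rw [intervalIntegral.integral_of_le ht.le, integral_Ioc_eq_integral_Ioo]
    refine setIntegral_congr_fun measurableSet_Ioo fun s hs => ?_
    simp only [e1 _ s hs.1, min_eq_left (hs.2.le.trans htT), hB s ⟨hs.1.le, hs.2.le⟩, mul_one,
      deriv_const_mul_field', hB' s hs, mul_zero, zero_add, Real.rpow_two]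
  rw [i1, i2] at main
  have I := hev.intervalIntegrable_weakForm hG h1 h2 le_rfl ht.le
  simp only [e0, e1 _ _ ht, min_eq_left htT]
  rw [main]
  unfold weakForm
  rw [intervalIntegral.integral_add I.1 I.2]
  ring

end

/-- Double integration by parts against a test function. -/
theorem integral_parts_twice {a b : ℝ} (hab : a ≤ b) {g g' g'' Θ : ℝ → ℝ}
    (h0 : ContinuousOn g (Icc a b)) (h1 : ContinuousOn g' (Icc a b))
    (h2 : ContinuousOn g'' (Icc a b)) (d1 : ∀ x ∈ Ioo a b, HasDerivAt g (g' x) x)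
    (d2 : ∀ x ∈ Ioo a b, HasDerivAt g' (g'' x) x) (hΘ : ContDiff ℝ (⊤ : ℕ∞) Θ) :
    ∫ x in a..b, g x * deriv (deriv Θ) x = g b * deriv Θ b - g a * deriv Θ a
      - (g' b * Θ b - g' a * Θ a) + ∫ x in a..b, g'' x * Θ x := by
  have hΘ' : ContDiff ℝ (⊤ : ℕ∞) (deriv Θ) := (contDiff_infty_iff_deriv.1 hΘ).2
  have c0 := hΘ.continuous
  have c1 := hΘ'.continuous
  have c2 : Continuous (deriv (deriv Θ)) := hΘ'.continuous_deriv (by simp)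
  rw [← uIcc_of_le hab] at h0 h1 h2
  rw [intervalIntegral.integral_mul_deriv_eq_deriv_mul_of_hasDerivAt h0 c1.continuousOn
    (by rwa [min_eq_left hab, max_eq_right hab])
    (fun x _ => (hΘ'.differentiable (by simp) x).hasDerivAt) h1.intervalIntegrable
    (c2.intervalIntegrable _ _),
    intervalIntegral.integral_mul_deriv_eq_deriv_mul_of_hasDerivAt h1 c0.continuousOn
    (by rwa [min_eq_left hab, max_eq_right hab])
    (fun x _ => (hΘ.differentiable (by simp) x).hasDerivAt) h2.intervalIntegrable
    (c1.intervalIntegrable _ _)]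
  ring

/-- A continuous function with compact support is integrated over any large interval. -/
theorem exists_interval_of_compactSupport {Θ : ℝ → ℝ} (h : HasCompactSupport Θ) (C : ℝ) :
    ∃ R, C ≤ R ∧ 0 < R ∧ tsupport Θ ⊆ Ioo (-R) R := by
  obtain ⟨R, hR⟩ := h.isCompact.isBounded.subset_ball (0 : ℝ)
  refine ⟨max (max R C) 1, (le_max_right _ _).trans (le_max_left _ _),
    one_pos.trans_le (le_max_right _ _), fun x hx => ?_⟩
  have := hR hx
  rw [mem_ball_zero_iff, Real.norm_eq_abs, abs_lt] at this
  have h2 : R ≤ max (max R C) 1 := (le_max_left _ _).trans (le_max_left _ _)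
  exact ⟨by linarith [this.1], by linarith [this.2]⟩

theorem integral_eq_interval {w Θ : ℝ → ℝ} {R : ℝ} (h : tsupport Θ ⊆ Ioo (-R) R) :
    ∫ x, w x * Θ x = ∫ x in -R..R, w x * Θ x := by
  refine (intervalIntegral.integral_eq_integral_of_support_subset fun x hx => ?_).symm
  have : x ∈ tsupport Θ := subset_tsupport _ (right_ne_zero_of_mul hx)
  exact ⟨(h this).1, (h this).2.le⟩

section
variable {G : ℝ → ℝ → ℝ} {K T : ℝ}

/-- Stationary solutions are supersolutions. -/
theorem stationary_mildSuper {p : ℝ → ℝ} (hp : ContDiff ℝ 2 p)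
    (hb : ∀ x, 0 ≤ p x ∧ p x ≤ K)
    (hs : ∀ x, deriv (deriv fun y => p y ^ 2) x + G x (p x) = 0) :
    IsMildSuper G K T fun x _ => p x := by
  have hev : IsEvol K fun x (_ : ℝ) => p x :=
    ⟨fun x _ _ => hb x, hp.continuous.measurable, (hp.continuous.comp continuous_fst).continuousOn⟩
  refine ⟨hev, fun Θ h1 h2 _ s t _ _ _ => ?_⟩
  obtain ⟨R, -, hR, hsub⟩ := exists_interval_of_compactSupport h2 0
  have hg : ContDiff ℝ 2 fun y => p y ^ 2 := hp.pow 2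
  have hg' : ContDiff ℝ 1 (deriv fun y => p y ^ 2) :=
    (contDiff_succ_iff_deriv (n := 1).1 (by simpa [one_add_one_eq_two] using hg)).2.2
  have z : ∀ x ∉ tsupport Θ, Θ x = 0 := fun x hx => image_eq_zero_of_notMem_tsupport hx
  have z' : ∀ x ∉ tsupport Θ, deriv Θ x = 0 := fun x hx =>
    image_eq_zero_of_notMem_tsupport fun h => hx (tsupport_deriv_subset h)
  have e1 : R ∉ tsupport Θ := fun h => lt_irrefl _ (hsub h).2
  have e2 : -R ∉ tsupport Θ := fun h => lt_irrefl _ (hsub h).1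
  have key : weakForm G (fun x _ => p x) Θ = fun _ => 0 := by
    funext r
    unfold weakForm
    rw [integral_eq_interval (((tsupport_deriv_subset).trans (tsupport_deriv_subset)).trans hsub),
      integral_eq_interval hsub, integral_parts_twice (by linarith) hg.continuous.continuousOn
      hg'.continuous.continuousOn (hg'.continuous_deriv le_rfl).continuousOn
      (fun x _ => (hg.differentiable (by simp) x).hasDerivAt)
      (fun x _ => (hg'.differentiable (by simp) x).hasDerivAt) h1]
    rw [z _ e1, z _ e2, z' _ e1, z' _ e2, intervalIntegral.integral_congr (g := fun x =>
      -(G x (p x) * Θ x)) fun x _ => by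
        change deriv (deriv fun y => p y ^ 2) x * Θ x = -(G x (p x) * Θ x)
        rw [← neg_mul]; congr 1; linarith [hs x], intervalIntegral.integral_neg]
    ring
  rw [key]
  simp

theorem hasDerivAt_integral_travel {Ψ Θ : ℝ → ℝ} (hΨ : Continuous Ψ) (h1 : ContDiff ℝ (⊤ : ℕ∞) Θ)
    (h2 : HasCompactSupport Θ) (d c t : ℝ) :
    HasDerivAt (fun t => ∫ x, Ψ (x + (d - c * t)) * Θ x)
      (c * ∫ x, Ψ (x + (d - c * t)) * deriv Θ x) t := by
  have hg : ContDiff ℝ 1 fun v => Θ (-v) := (h1.of_le (by simp)).comp contDiff_neg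
  have hgs : HasCompactSupport fun v => Θ (-v) := h2.comp_homeomorph (Homeomorph.neg ℝ)
  have key := hgs.hasDerivAt_convolution_right (ContinuousLinearMap.mul ℝ ℝ)
    (hΨ.locallyIntegrable (μ := volume)) hg (d - c * t)
  have hlin : HasDerivAt (fun t => d - c * t) (-c) t := by
    simpa using ((hasDerivAt_id t).const_mul c).const_sub d
  have := key.comp t hlin
  have e1 : (convolution Ψ (fun v => Θ (-v)) (ContinuousLinearMap.mul ℝ ℝ) volume ∘
      fun t => d - c * t) = fun t => ∫ x, Ψ (x + (d - c * t)) * Θ x := by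
    funext t
    simp only [Function.comp, convolution, ContinuousLinearMap.mul_apply']
    rw [integral_mul_translate Ψ]
    simp
  rw [e1] at this
  refine this.congr_deriv ?_
  simp only [convolution, ContinuousLinearMap.mul_apply']
  rw [integral_mul_translate Ψ]
  simp only [deriv_comp_neg, neg_sub, mul_neg, integral_neg]
  ring

end

/-- The profile equal to `q` on `[a,b]` and constant outside. -/
def clampProfile (q : ℝ → ℝ) (a b : ℝ) (z : ℝ) : ℝ := q (max a (min z b))

section
variable {G : ℝ → ℝ → ℝ} {K L T a b c : ℝ} {q q' q'' : ℝ → ℝ}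

theorem clampProfile_left (hab : a ≤ b) {z : ℝ} (hz : z ≤ a) : clampProfile q a b z = q a := by
  rw [clampProfile, min_eq_left (hz.trans hab), max_eq_left hz]

theorem clampProfile_right (hab : a ≤ b) {z : ℝ} (hz : b ≤ z) : clampProfile q a b z = q b := by
  rw [clampProfile, min_eq_right hz, max_eq_right hab]

theorem clampProfile_mid {z : ℝ} (hz : z ∈ Icc a b) : clampProfile q a b z = q z := by
  rw [clampProfile, min_eq_left hz.2, max_eq_right hz.1]

theorem continuous_clampProfile (hab : a ≤ b) (hq : ContinuousOn q (Icc a b)) :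
    Continuous (clampProfile q a b) :=
  hq.comp_continuous (by fun_prop) fun z => ⟨le_max_left _ _, max_le hab (min_le_right _ _)⟩

theorem integral_split {w Θ : ℝ → ℝ} {R : ℝ} (hw : Continuous w) (hΘ : Continuous Θ)
    (h : tsupport Θ ⊆ Ioo (-R) R) (a b : ℝ) :
    ∫ x, w x * Θ x = (∫ x in -R..a, w x * Θ x) + (∫ x in a..b, w x * Θ x)
      + ∫ x in b..R, w x * Θ x := by
  have I : ∀ c d, IntervalIntegrable (fun x => w x * Θ x) volume c d :=
    fun c d => (hw.mul hΘ).intervalIntegrable _ _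
  rw [integral_eq_interval h, intervalIntegral.integral_add_adjacent_intervals (I _ _) (I _ _),
    intervalIntegral.integral_add_adjacent_intervals (I _ _) (I _ _)]

/-- The stationary inequality for a front profile in the moving frame, tested with `Θ`. -/
theorem front_weak_ineq (hab : a ≤ b) (hG : Continuous (Function.uncurry G))
    (hG0 : ∀ x, G x 0 = 0) (hGM : ∀ x, 0 ≤ G x (q a)) (h0 : ContinuousOn q (Icc a b))
    (h1 : ContinuousOn q' (Icc a b)) (h2 : ContinuousOn q'' (Icc a b))
    (d1 : ∀ x ∈ Ioo a b, HasDerivAt q (q' x) x) (d2 : ∀ x ∈ Ioo a b, HasDerivAt q' (q'' x) x)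
    (hqa : 0 ≤ q a) (hqb : q b = 0) (hqa' : 0 ≤ q' a)
    (hineq : ∀ x, ∀ z ∈ Icc a b, 0 ≤ 2 * q' z ^ 2 + 2 * q z * q'' z + c * q' z + G x (q z))
    {Θ : ℝ → ℝ} (hΘ : ContDiff ℝ (⊤ : ℕ∞) Θ) (hs : HasCompactSupport Θ) (hΘ0 : ∀ x, 0 ≤ Θ x) :
    c * ∫ z, clampProfile q a b z * deriv Θ z
      ≤ (∫ z, clampProfile q a b z ^ 2 * deriv (deriv Θ) z)
        + ∫ z, G z (clampProfile q a b z) * Θ z := by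
  obtain ⟨R, hC, hR, hsub⟩ := exists_interval_of_compactSupport hs (max (-a) b)
  have hRa : -R ≤ a := by linarith [(le_max_left (-a) b).trans hC]
  have hRb : b ≤ R := (le_max_right (-a) b).trans hC
  have hΘ' : ContDiff ℝ (⊤ : ℕ∞) (deriv Θ) := (contDiff_infty_iff_deriv.1 hΘ).2
  have c0 := hΘ.continuous
  have c1 := hΘ'.continuous
  have c2 : Continuous (deriv (deriv Θ)) := hΘ'.continuous_deriv (by simp)
  have hΨ := continuous_clampProfile hab h0
  have hGΨ : Continuous fun z => G z (clampProfile q a b z) := hG.comp (continuous_id.prodMk hΨ)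
  have z0 : Θ (-R) = 0 := image_eq_zero_of_notMem_tsupport fun h => lt_irrefl _ (hsub h).1
  have z1 : deriv Θ (-R) = 0 := image_eq_zero_of_notMem_tsupport fun h =>
    lt_irrefl _ (hsub (tsupport_deriv_subset h)).1
  rw [integral_split hΨ c1 (tsupport_deriv_subset.trans hsub) a b,
    integral_split (w := fun z => clampProfile q a b z ^ 2) (hΨ.pow 2) c2
      ((tsupport_deriv_subset.trans tsupport_deriv_subset).trans hsub) a b,
    integral_split hGΨ c0 hsub a b]
  have left : ∀ {w Φ : ℝ → ℝ} {v : ℝ}, (∀ z ≤ a, w z = v) →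
      ∫ z in -R..a, w z * Φ z = v * ∫ z in -R..a, Φ z := fun {w Φ v} hw => by
    rw [← intervalIntegral.integral_const_mul]
    refine intervalIntegral.integral_congr fun z hz => ?_
    rw [uIcc_of_le hRa] at hz
    simp only [hw z hz.2]
  have right : ∀ {w Φ : ℝ → ℝ}, (∀ z, b ≤ z → w z = 0) → ∫ z in b..R, w z * Φ z = 0 :=
    fun {w Φ} hw => by
    rw [intervalIntegral.integral_congr (g := fun _ => 0) fun z hz => ?_,
      intervalIntegral.integral_zero]
    rw [uIcc_of_le hRb] at hz
    simp only [hw z hz.1, zero_mul]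
  have mid : ∀ {w v Φ : ℝ → ℝ}, (∀ z ∈ Icc a b, w z = v z) →
      ∫ z in a..b, w z * Φ z = ∫ z in a..b, v z * Φ z := fun {w v Φ} hw => by
    refine intervalIntegral.integral_congr fun z hz => ?_
    rw [uIcc_of_le hab] at hz
    simp only [hw z hz]
  have ha1 : ∀ z ≤ a, clampProfile q a b z = q a := fun z hz => clampProfile_left hab hz
  have hb1 : ∀ z, b ≤ z → clampProfile q a b z = 0 := fun z hz =>
    (clampProfile_right hab hz).trans hqb
  rw [left ha1, left (w := fun z => clampProfile q a b z ^ 2) (v := q a ^ 2)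
      fun z hz => by rw [ha1 z hz],
    right hb1, right (w := fun z => clampProfile q a b z ^ 2) fun z hz => by
      rw [hb1 z hz]; norm_num,
    right (w := fun z => G z (clampProfile q a b z)) fun z hz => by rw [hb1 z hz, hG0],
    mid (v := q) fun z hz => clampProfile_mid hz,
    mid (w := fun z => clampProfile q a b z ^ 2) (v := fun z => q z ^ 2)
      fun z hz => by rw [clampProfile_mid hz],
    mid (w := fun z => G z (clampProfile q a b z)) (v := fun z => G z (q z))
      fun z hz => by rw [clampProfile_mid hz],
    intervalIntegral.integral_deriv_eq_sub (fun x _ => hΘ.differentiable (by simp) x)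
      (c1.intervalIntegrable _ _),
    intervalIntegral.integral_deriv_eq_sub (fun x _ => hΘ'.differentiable (by simp) x)
      (c2.intervalIntegrable _ _),
    integral_parts_twice (g := fun z => q z ^ 2) (g' := fun z => 2 * q z * q' z)
      (g'' := fun z => 2 * q' z ^ 2 + 2 * q z * q'' z) hab (h0.pow 2)
      ((continuousOn_const.mul h0).mul h1)
      ((continuousOn_const.mul (h1.pow 2)).add ((continuousOn_const.mul h0).mul h2))
      (fun x hx => by have := (d1 x hx).pow 2; exact this.congr_deriv (by simp))
      (fun x hx => (((d1 x hx).const_mul 2).mul (d2 x hx)).congr_deriv (by ring)) hΘ]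
  have u1 : ContinuousOn q (uIcc a b) := by rwa [uIcc_of_le hab]
  have u2 : ContinuousOn q' (uIcc a b) := by rwa [uIcc_of_le hab]
  rw [intervalIntegral.integral_mul_deriv_eq_deriv_mul_of_hasDerivAt u1 c0.continuousOn
    (by rwa [min_eq_left hab, max_eq_right hab])
    (fun x _ => (hΘ.differentiable (by simp) x).hasDerivAt) u2.intervalIntegrable
    (c1.intervalIntegrable _ _)]
  have hGl : 0 ≤ ∫ z in -R..a, G z (clampProfile q a b z) * Θ z :=
    intervalIntegral.integral_nonneg hRa fun z hz => by
      rw [ha1 z hz.2]; exact mul_nonneg (hGM z) (hΘ0 z)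
  have hGq : ContinuousOn (fun z => G z (q z)) (Icc a b) :=
    hG.comp_continuousOn (continuousOn_id.prodMk h0)
  have I1 : IntervalIntegrable (fun z => (2 * q' z ^ 2 + 2 * q z * q'' z) * Θ z) volume a b :=
    ContinuousOn.intervalIntegrable_of_Icc hab
      (((continuousOn_const.mul (h1.pow 2)).add ((continuousOn_const.mul h0).mul h2)).mul
        c0.continuousOn)
  have I2 : IntervalIntegrable (fun z => q' z * Θ z) volume a b :=
    ContinuousOn.intervalIntegrable_of_Icc hab (h1.mul c0.continuousOn)
  have I3 : IntervalIntegrable (fun z => G z (q z) * Θ z) volume a b :=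
    ContinuousOn.intervalIntegrable_of_Icc hab (hGq.mul c0.continuousOn)
  have hmain : 0 ≤ (∫ z in a..b, (2 * q' z ^ 2 + 2 * q z * q'' z) * Θ z)
      + c * (∫ z in a..b, q' z * Θ z) + ∫ z in a..b, G z (q z) * Θ z := by
    rw [← intervalIntegral.integral_const_mul, ← intervalIntegral.integral_add I1 (I2.const_mul c),
      ← intervalIntegral.integral_add (I1.add (I2.const_mul c)) I3]
    refine intervalIntegral.integral_nonneg hab fun z hz => ?_
    have := mul_nonneg (hineq z z hz) (hΘ0 z)
    linarith
  have hbd : 0 ≤ 2 * q a * q' a * Θ a := by have := hΘ0 a; positivity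
  rw [hqb, z0, z1]
  ring_nf at hmain hGl hbd ⊢
  linarith

theorem front_mildSub (hab : a ≤ b) (hG : IsReaction G K L)
    (hGM : ∀ x, 0 ≤ G x (q a)) (h0 : ContinuousOn q (Icc a b))
    (h1 : ContinuousOn q' (Icc a b)) (h2 : ContinuousOn q'' (Icc a b))
    (d1 : ∀ x ∈ Ioo a b, HasDerivAt q (q' x) x) (d2 : ∀ x ∈ Ioo a b, HasDerivAt q' (q'' x) x)
    (hqb : q b = 0) (hqa' : 0 ≤ q' a) (hK : ∀ z ∈ Icc a b, 0 ≤ q z ∧ q z ≤ K)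
    (hineq : ∀ x, ∀ z ∈ Icc a b, 0 ≤ 2 * q' z ^ 2 + 2 * q z * q'' z + c * q' z + G x (q z))
    (d : ℝ) :
    IsMildSub G K T fun x t => clampProfile q a b (x + (d - c * t)) := by
  have hΨ := continuous_clampProfile hab h0
  have hev : IsEvol K fun x t => clampProfile q a b (x + (d - c * t)) :=
    ⟨fun x t _ => hK _ ⟨le_max_left _ _, max_le hab (min_le_right _ _)⟩,
      (hΨ.comp (by fun_prop : Continuous fun x : ℝ => x + (d - c * 0))).measurable,
      (hΨ.comp (by fun_prop : Continuous fun q : ℝ × ℝ => q.1 + (d - c * q.2))).continuousOn⟩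
  refine ⟨hev, fun Θ k1 k2 k3 s t hs hst _ => ?_⟩
  have k1' : ContDiff ℝ (⊤ : ℕ∞) (deriv Θ) := (contDiff_infty_iff_deriv.1 k1).2
  have I := hev.intervalIntegrable_weakForm hG k1 k2 hs (hs.trans hst.le)
  have J := (intervalIntegrable_test k1'.continuous k2.deriv hev.2.2 (B := K)
    (fun x r hr => by
      rw [abs_of_nonneg (hev.1 x r hr.le).1]; exact (hev.1 x r hr.le).2) hs
      (hs.trans hst.le)).const_mul c
  have ftc := intervalIntegral.integral_eq_sub_of_hasDerivAt
    (fun r _ => hasDerivAt_integral_travel hΨ k1 k2 d c r) J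
  have mono := intervalIntegral.integral_mono_on hst.le J (I.1.add I.2) fun r _ => by
    have := front_weak_ineq (G := fun x v => G (x - (d - c * r)) v) (c := c) hab
      (hG.1.comp (by fun_prop : Continuous fun q : ℝ × ℝ => (q.1 - (d - c * r), q.2)))
      (fun x => hG.2.1 _) (fun x => hGM _) h0 h1 h2 d1 d2 (hK a ⟨le_rfl, hab⟩).1 hqb hqa'
      (fun x z hz => hineq _ z hz) (Θ := fun x => Θ (x - (d - c * r)))
      (k1.comp (contDiff_id.sub contDiff_const))
      (k2.comp_homeomorph (Homeomorph.subRight (d - c * r))) (fun x => k3 _)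
    have e1 : deriv (fun x => Θ (x - (d - c * r))) = fun x => deriv Θ (x - (d - c * r)) :=
      funext fun x => deriv_comp_sub_const ..
    have e2 : deriv (fun x => deriv Θ (x - (d - c * r)))
        = fun x => deriv (deriv Θ) (x - (d - c * r)) := funext fun x => deriv_comp_sub_const ..
    rw [e1, e2, ← integral_mul_translate, ← integral_mul_translate
      (fun z => clampProfile q a b z ^ 2),
      ← integral_mul_translate (fun z => G (z - (d - c * r)) _)] at this
    simpa only [add_sub_cancel_right] using this
  rw [ftc] at mono
  change _ ≤ _ + ∫ r in s..t, (_ + _)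
  linarith

end

section
variable {φ : ℝ → ℝ} {l m : ℝ}

theorem hasDerivWithinAt_of_contDiffOn (hl : 0 < l) (hφ : ContDiffOn ℝ 2 φ (Icc (-l) l)) :
    (∀ z ∈ Icc (-l) l, HasDerivWithinAt φ (derivWithin φ (Icc (-l) l) z) (Icc (-l) l) z) ∧
    (∀ z ∈ Icc (-l) l, HasDerivWithinAt (derivWithin φ (Icc (-l) l))
      (derivWithin (derivWithin φ (Icc (-l) l)) (Icc (-l) l) z) (Icc (-l) l) z) ∧
    ContinuousOn (derivWithin (derivWithin φ (Icc (-l) l)) (Icc (-l) l)) (Icc (-l) l) := by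
  have hU : UniqueDiffOn ℝ (Icc (-l) l) := uniqueDiffOn_Icc (by linarith)
  have h1 : ContDiffOn ℝ 1 (derivWithin φ (Icc (-l) l)) (Icc (-l) l) :=
    hφ.derivWithin hU (by norm_num)
  exact ⟨fun z hz => (hφ.differentiableOn (by simp) z hz).hasDerivWithinAt,
    fun z hz => (h1.differentiableOn (by simp) z hz).hasDerivWithinAt,
    h1.continuousOn_derivWithin hU le_rfl⟩

theorem derivWithin_rpow_profile (hl : 0 < l) (hm : 1 < m) (hφ : ContDiffOn ℝ 2 φ (Icc (-l) l))
    {z : ℝ} (hz : z ∈ Icc (-l) l) :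
    derivWithin (fun w => φ w ^ m) (Icc (-l) l) z
      = derivWithin φ (Icc (-l) l) z * m * φ z ^ (m - 1) :=
  (((hasDerivWithinAt_of_contDiffOn hl hφ).1 z hz).rpow_const (Or.inr hm.le)).derivWithin
    (uniqueDiffOn_Icc (by linarith) z hz)

/-- The second derivative of `φ^m` can be positive at a zero of finite nonzero slope only for
`m = 2`. -/
theorem exponent_eq_two (hl : 0 < l) (hm : 1 < m) (hφ : ContDiffOn ℝ 2 φ (Icc (-l) l))
    (h0 : φ l = 0) (hpos : ∀ z ∈ Ioo (-l) l, 0 < φ z)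
    (h1 : derivWithin φ (Icc (-l) l) l ≠ 0)
    (h2 : derivWithin (derivWithin (fun w => φ w ^ m) (Icc (-l) l)) (Icc (-l) l) l ≠ 0) :
    m = 2 := by
  have hll : l ∈ Icc (-l) l := ⟨by linarith, le_rfl⟩
  obtain ⟨d1, d2, -⟩ := hasDerivWithinAt_of_contDiffOn hl hφ
  have dg : DifferentiableWithinAt ℝ (derivWithin (fun w => φ w ^ m) (Icc (-l) l)) (Icc (-l) l)
      l := by
    by_contra h
    exact h2 (derivWithin_zero_of_not_differentiableWithinAt h)
  set D := derivWithin (derivWithin (fun w => φ w ^ m) (Icc (-l) l)) (Icc (-l) l) l with hD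
  set φ1 := derivWithin φ (Icc (-l) l) with hφ1
  have hsub : Ioo (-l) l ⊆ Icc (-l) l := Ioo_subset_Icc_self
  have hnot : l ∉ Ioo (-l) l := fun h => lt_irrefl _ h.2
  have tg := (hasDerivWithinAt_iff_tendsto_slope' hnot).1 (dg.hasDerivWithinAt.mono hsub)
  have tφ := (hasDerivWithinAt_iff_tendsto_slope' hnot).1 ((d1 l hll).mono hsub)
  have t1 : Tendsto φ1 (nhdsWithin l (Ioo (-l) l)) (nhds (φ1 l)) :=
    ((d2 l hll).continuousWithinAt.mono hsub).tendsto
  have t0 : Tendsto φ (nhdsWithin l (Ioo (-l) l)) (nhdsWithin 0 (Ioi 0)) := by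
    refine tendsto_nhdsWithin_iff.2 ⟨?_, ?_⟩
    · have := ((d1 l hll).continuousWithinAt.mono hsub).tendsto
      rwa [h0] at this
    · filter_upwards [self_mem_nhdsWithin] with z hz using hpos z hz
  have hne : NeBot (nhdsWithin l (Ioo (-l) l)) := by
    rw [nhdsWithin_Ioo_eq_nhdsLT (by linarith)]; infer_instance
  have tq : Tendsto (fun z => φ z ^ (m - 2)) (nhdsWithin l (Ioo (-l) l))
      (nhds (D / (φ1 l * m * φ1 l))) := by
    refine (tg.div ((t1.mul_const m).mul tφ) (by positivity)).congr' ?_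
    have hev : ∀ᶠ z in nhdsWithin l (Ioo (-l) l), φ1 z ≠ 0 := t1.eventually_ne h1
    filter_upwards [hev, self_mem_nhdsWithin] with z hz hz2
    have hp := hpos z hz2
    have hzl : z - l ≠ 0 := by linarith [hz2.2]
    rw [Pi.div_apply]
    rw [slope_def_field, slope_def_field, derivWithin_rpow_profile hl hm hφ (hsub hz2),
      derivWithin_rpow_profile hl hm hφ hll, h0, Real.zero_rpow (by linarith), mul_zero, sub_zero,
      sub_zero, show m - 1 = m - 2 + 1 by ring, Real.rpow_add_one hp.ne']
    have hm0 : m ≠ 0 := by linarith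
    rw [← hφ1]
    field_simp
  have hlim : D / (φ1 l * m * φ1 l) ≠ 0 := div_ne_zero h2 (by positivity)
  rcases lt_trichotomy m 2 with h | h | h
  · exfalso
    have := (tendsto_rpow_neg_nhdsGT_zero (by linarith : m - 2 < 0)).comp t0
    exact not_tendsto_nhds_of_tendsto_atTop this _ tq
  · exact h
  · exfalso
    have hc : Tendsto (fun x : ℝ => x ^ (m - 2)) (nhdsWithin 0 (Ioi 0)) (nhds 0) := by
      have := (Real.continuousAt_rpow_const 0 (m - 2) (Or.inr (by linarith))).tendsto
      rw [Real.zero_rpow (by linarith)] at this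
      exact this.mono_left nhdsWithin_le_nhds
    exact hlim (tendsto_nhds_unique tq (hc.comp t0))

theorem condF2_exponent {f : ℝ → ℝ → ℝ} {κ : ℝ → ℝ} {c₀ : ℝ} (hm : 1 < m)
    (hf0 : ∀ x, f x 0 = 0) (h : CondF2 m f κ c₀ l φ) : m = 2 := by
  obtain ⟨hc, hl, hφ, -, h0, hpos, hs, hineq⟩ := h
  have := hineq 0 l ⟨by linarith, le_rfl⟩
  rw [h0, hf0, zero_mul, add_zero] at this
  refine exponent_eq_two hl hm hφ h0 hpos (by linarith) fun h2 => ?_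
  rw [h2] at this
  nlinarith

/-- The profile inequality for `m = 2` written out. -/
theorem condF2_two {f : ℝ → ℝ → ℝ} {κ : ℝ → ℝ} {c₀ : ℝ} (h : CondF2 2 f κ c₀ l φ)
    (x : ℝ) {z : ℝ} (hz : z ∈ Icc (-l) l) :
    0 ≤ 2 * derivWithin φ (Icc (-l) l) z ^ 2
      + 2 * φ z * derivWithin (derivWithin φ (Icc (-l) l)) (Icc (-l) l) z
      + c₀ * derivWithin φ (Icc (-l) l) z + f x (φ z) * (κ x - φ z) := by
  obtain ⟨-, hl, hφ, -, -, -, -, hineq⟩ := h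
  obtain ⟨d1, d2, -⟩ := hasDerivWithinAt_of_contDiffOn hl hφ
  have hU := uniqueDiffOn_Icc (by linarith : -l < l) z hz
  have e := hineq x z hz
  have e1 : derivWithin (derivWithin (fun w => φ w ^ (2 : ℝ)) (Icc (-l) l)) (Icc (-l) l) z
      = derivWithin (fun w => derivWithin φ (Icc (-l) l) w * 2 * φ w) (Icc (-l) l) z :=
    derivWithin_congr (fun w hw => by
      rw [derivWithin_rpow_profile hl one_lt_two hφ hw]; norm_num)
      (by rw [derivWithin_rpow_profile hl one_lt_two hφ hz]; norm_num)
  have e2 := (((d2 z hz).mul_const 2).mul (d1 z hz)).derivWithin hU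
  rw [e1, show (fun w => derivWithin φ (Icc (-l) l) w * 2 * φ w)
    = (fun w => derivWithin φ (Icc (-l) l) w * 2) * φ from rfl, e2] at e
  linarith

end

theorem exists_faster_profile {φ φ1 φ2 : ℝ → ℝ} {G : ℝ → ℝ → ℝ} {a l c₀ M K L σ : ℝ} (hal : a < l)
    (h0 : ContinuousOn φ (Icc a l)) (h1 : ContinuousOn φ1 (Icc a l))
    (h2 : ContinuousOn φ2 (Icc a l)) (d1 : ∀ x ∈ Ioo a l, HasDerivAt φ (φ1 x) x)
    (d2 : ∀ x ∈ Ioo a l, HasDerivAt φ1 (φ2 x) x) (hφa : φ a = M) (hφ1a : φ1 a = 0)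
    (hφl : φ l = 0) (hφ1l : φ1 l = -σ) (hpos : ∀ z ∈ Ico a l, 0 < φ z)
    (hM : ∀ z ∈ Icc a l, φ z ≤ M) (hMK : M < K) (hc₀ : 0 < c₀) (hσ : c₀ < σ)
    (hG : IsReaction G K L)
    (hineq : ∀ x, ∀ z ∈ Icc a l, 0 ≤ 2 * φ1 z ^ 2 + 2 * φ z * φ2 z + c₀ * φ1 z + G x (φ z)) :
    ∃ c q q1 q2, c₀ < c ∧ ContinuousOn q (Icc a l) ∧ ContinuousOn q1 (Icc a l) ∧
      ContinuousOn q2 (Icc a l) ∧ (∀ x ∈ Ioo a l, HasDerivAt q (q1 x) x) ∧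
      (∀ x ∈ Ioo a l, HasDerivAt q1 (q2 x) x) ∧ q a = M ∧ 0 ≤ q1 a ∧ q l = 0 ∧
      (∀ z ∈ Ico a l, 0 < q z) ∧ (∀ z ∈ Icc a l, 0 ≤ q z ∧ q z ≤ K) ∧
      ∀ x, ∀ z ∈ Icc a l, 0 ≤ 2 * q1 z ^ 2 + 2 * q z * q2 z + c * q1 z + G x (q z) := by
  have hal' := hal.le
  have hll : l ∈ Icc a l := ⟨hal', le_rfl⟩
  have hL := hG.2.2.2.1
  have hφ0 : ∀ z ∈ Icc a l, 0 ≤ φ z := fun z hz => by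
    rcases hz.2.eq_or_lt with h | h
    · rw [h, hφl]
    · exact (hpos z ⟨hz.1, h⟩).le
  have hM0 : 0 ≤ M := (hφ0 l hll).trans (hM l hll)
  -- slack near the endpoint
  obtain ⟨ρ, hρ, hρl, hslack⟩ : ∃ ρ > 0, ρ < l - a ∧ ∀ x, ∀ z ∈ Icc (l - ρ) l,
      σ * (2 * σ - c₀) / 2 ≤ 2 * φ1 z ^ 2 + 2 * φ z * φ2 z + c₀ * φ1 z + G x (φ z) := by
    have hc : ContinuousWithinAt
        (fun z => 2 * φ1 z ^ 2 + 2 * φ z * φ2 z + c₀ * φ1 z - L * φ z) (Icc a l) l :=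
      (((continuousOn_const.mul (h1.pow 2)).add ((continuousOn_const.mul h0).mul h2)).add
        (continuousOn_const.mul h1)).sub (continuousOn_const.mul h0) l hll
    have hv : σ * (2 * σ - c₀) / 2 <
        (fun z => 2 * φ1 z ^ 2 + 2 * φ z * φ2 z + c₀ * φ1 z - L * φ z) l := by
      simp only [hφl, hφ1l]; nlinarith
    have hev := hc.tendsto.eventually (lt_mem_nhds hv)
    rw [nhdsWithin_Icc_eq_nhdsLE hal] at hev
    obtain ⟨e, he, hsub⟩ := (mem_nhdsLE_iff_exists_Icc_subset).1 hev
    have he : e < l := he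
    refine ⟨min (l - e) ((l - a) / 2), lt_min (by linarith) (by linarith),
      (min_le_right _ _).trans_lt (by linarith), fun x z hz => ?_⟩
    have hz1 : e ≤ z := by linarith [hz.1, min_le_left (l - e) ((l - a) / 2)]
    have hz2 : z ∈ Icc a l := ⟨by linarith [hz.1, min_le_right (l - e) ((l - a) / 2)], hz.2⟩
    have k1 : σ * (2 * σ - c₀) / 2 < 2 * φ1 z ^ 2 + 2 * φ z * φ2 z + c₀ * φ1 z - L * φ z :=
      hsub ⟨hz1, hz.2⟩
    have k2 := hG.2.2.2.2 x (φ z) 0 (hφ0 z hz2) ((hM z hz2).trans hMK.le) le_rfl hG.2.2.1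
    rw [hG.2.1, sub_zero, sub_zero, abs_of_nonneg (hφ0 z hz2)] at k2
    linarith [(abs_le.1 k2).1]
  set η := σ * (2 * σ - c₀) / 2 with hη
  have hη0 : 0 < η := by rw [hη]; have : 0 < 2 * σ - c₀ := by linarith
                         have : 0 < σ := by linarith
                         positivity
  -- lower bound away from the endpoint
  obtain ⟨r, hr, hrφ⟩ : ∃ r > 0, ∀ z ∈ Icc a (l - ρ), r ≤ φ z := by
    obtain ⟨z₀, hz₀, hmin⟩ := isCompact_Icc.exists_isMinOn
        (nonempty_Icc.2 (by linarith : a ≤ l - ρ))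
      (h0.mono (Icc_subset_Icc_right (by linarith : l - ρ ≤ l)))
    exact ⟨φ z₀, hpos z₀ ⟨hz₀.1, by linarith [hz₀.2]⟩, fun z hz => hmin hz⟩
  obtain ⟨A₁, hA₁⟩ := isCompact_Icc.exists_bound_of_continuousOn h1
  obtain ⟨A₂, hA₂⟩ := isCompact_Icc.exists_bound_of_continuousOn h2
  set A := max A₁ A₂
  have hA1 : ∀ z ∈ Icc a l, |φ1 z| ≤ A := fun z hz => (hA₁ z hz).trans (le_max_left _ _)
  have hA2 : ∀ z ∈ Icc a l, |φ2 z| ≤ A := fun z hz => (hA₂ z hz).trans (le_max_right _ _)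
  have hA0 : 0 ≤ A := (abs_nonneg _).trans (hA1 l hll)
  set W := l - a
  have hW : 0 < W := by simp only [W]; linarith
  set C := (4 * A + c₀ + 1) * (W + 1) + (2 * A + L) * W + A with hC
  have hC0 : 0 ≤ C := by positivity
  obtain ⟨Λ, hΛ1, hΛρ, hΛC⟩ : ∃ Λ : ℝ, 1 ≤ Λ ∧ 4 ≤ Λ * ρ ∧ C ≤ r * Λ * ρ := by
    refine ⟨1 + 4 / ρ + C / (r * ρ), ?_, ?_, ?_⟩
    · have : 0 ≤ 4 / ρ + C / (r * ρ) := by positivity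
      linarith
    · rw [add_mul, add_mul, div_mul_cancel₀ _ hρ.ne']
      have : 0 ≤ C / (r * ρ) * ρ := by positivity
      linarith
    · have e : r * (1 + 4 / ρ + C / (r * ρ)) * ρ = r * ρ + 4 * r + C := by field_simp
      rw [e]; nlinarith
  let E : ℝ → ℝ := fun z => Real.exp (Λ * (z - a))
  let χ : ℝ → ℝ := fun z => (E z - 1) * (l - z)
  let χ1 : ℝ → ℝ := fun z => Λ * E z * (l - z) - (E z - 1)
  let χ2 : ℝ → ℝ := fun z => Λ ^ 2 * E z * (l - z) - 2 * Λ * E z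
  have hE : ∀ z, HasDerivAt E (Λ * E z) z := fun z => by
    have := ((hasDerivAt_id z).sub_const a).const_mul Λ |>.exp
    refine this.congr_deriv ?_
    simp only [E, id]; ring
  have hlz : ∀ z, HasDerivAt (fun z => l - z) (-1) z := fun z => (hasDerivAt_id z).const_sub l
  have dχ : ∀ z, HasDerivAt χ (χ1 z) z := fun z =>
    (((hE z).sub_const 1).mul (hlz z)).congr_deriv (by simp only [χ1]; ring)
  have dχ1 : ∀ z, HasDerivAt χ1 (χ2 z) z := fun z =>
    ((((hE z).const_mul Λ).mul (hlz z)).sub ((hE z).sub_const 1)).congr_deriv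
      (by simp only [χ2]; ring)
  have cE : Continuous E := by fun_prop
  have cχ : Continuous χ := by fun_prop
  have cχ1 : Continuous χ1 := by fun_prop
  have cχ2 : Continuous χ2 := by fun_prop
  have hE1 : ∀ z ∈ Icc a l, 1 ≤ E z := fun z hz => Real.one_le_exp
    (mul_nonneg (by linarith) (by linarith [hz.1]))
  have hχ0 : ∀ z ∈ Icc a l, 0 ≤ χ z := fun z hz =>
    mul_nonneg (by linarith [hE1 z hz]) (by linarith [hz.2])
  obtain ⟨B₀, hB₀⟩ := (isCompact_Icc (a := a) (b := l)).exists_bound_of_continuousOn cχ.continuousOn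
  obtain ⟨B₁, hB₁⟩ := (isCompact_Icc (a := a) (b := l)).exists_bound_of_continuousOn
      cχ1.continuousOn
  obtain ⟨B₂, hB₂⟩ := (isCompact_Icc (a := a) (b := l)).exists_bound_of_continuousOn
      cχ2.continuousOn
  set B := max B₀ (max B₁ B₂)
  have hB0 : ∀ z ∈ Icc a l, |χ z| ≤ B := fun z hz => (hB₀ z hz).trans (le_max_left _ _)
  have hB1 : ∀ z ∈ Icc a l, |χ1 z| ≤ B := fun z hz =>
    (hB₁ z hz).trans ((le_max_left _ _).trans (le_max_right _ _))
  have hB2 : ∀ z ∈ Icc a l, |χ2 z| ≤ B := fun z hz =>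
    (hB₂ z hz).trans ((le_max_right _ _).trans (le_max_right _ _))
  have hBn : 0 ≤ B := (abs_nonneg _).trans (hB0 l hll)
  set Q := 4 * A * B + 2 * A * B + 2 * M * B + 2 * B ^ 2 + c₀ * B + A + B + L * B + 1 with hQ
  have hQ0 : 0 < Q := by positivity
  obtain ⟨ε, hε, hε1, hεQ, hεK⟩ : ∃ ε > 0, ε ≤ 1 ∧ ε * Q ≤ η ∧ ε * B ≤ K - M := by
    refine ⟨min 1 (min (η / Q) ((K - M) / (B + 1))), ?_, min_le_left _ _, ?_, ?_⟩
    · have : 0 < K - M := by linarith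
      positivity
    · calc _ ≤ η / Q * Q := mul_le_mul_of_nonneg_right
            ((min_le_right _ _).trans (min_le_left _ _)) hQ0.le
        _ = η := div_mul_cancel₀ _ hQ0.ne'
    · have : 0 < K - M := by linarith
      calc _ ≤ (K - M) / (B + 1) * (B + 1) := mul_le_mul
            ((min_le_right _ _).trans (min_le_right _ _)) (by linarith) hBn (by positivity)
        _ = K - M := div_mul_cancel₀ _ (by positivity)
  have hqb : ∀ z ∈ Icc a l, φ z ≤ φ z + ε * χ z ∧ φ z + ε * χ z ≤ K := fun z hz => by
    have k1 := mul_nonneg hε.le (hχ0 z hz)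
    have k2 := mul_le_mul_of_nonneg_left ((le_abs_self _).trans (hB0 z hz)) hε.le
    exact ⟨by linarith, by linarith [hM z hz]⟩
  refine ⟨c₀ + ε, fun z => φ z + ε * χ z, fun z => φ1 z + ε * χ1 z, fun z => φ2 z + ε * χ2 z,
    by linarith, h0.add (cχ.const_mul ε).continuousOn, h1.add (cχ1.const_mul ε).continuousOn,
    h2.add (cχ2.const_mul ε).continuousOn, fun x hx => (d1 x hx).add ((dχ x).const_mul ε),
    fun x hx => (d2 x hx).add ((dχ1 x).const_mul ε), ?_, ?_, ?_, ?_, ?_, ?_⟩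
  · simp [χ, E, hφa]
  · simp only [χ1, E, hφ1a, sub_self, mul_zero, Real.exp_zero, zero_add, mul_one, sub_zero]
    have : 0 ≤ Λ * (l - a) := mul_nonneg (by linarith) (by linarith)
    positivity
  · simp [χ, hφl]
  · exact fun z hz => (hpos z hz).trans_le (hqb z ⟨hz.1, hz.2.le⟩).1
  · exact fun z hz => ⟨(hφ0 z hz).trans (hqb z hz).1, (hqb z hz).2⟩
  · intro x z hz
    have kG := hG.2.2.2.2 x (φ z + ε * χ z) (φ z) ((hφ0 z hz).trans (hqb z hz).1) (hqb z hz).2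
      (hφ0 z hz) ((hM z hz).trans hMK.le)
    rw [add_sub_cancel_left, abs_of_nonneg (mul_nonneg hε.le (hχ0 z hz))] at kG
    have kG1 := (abs_le.1 kG).1
    have n1 := neg_abs_le (φ1 z)
    have a1 := hA1 z hz
    have a2 := hA2 z hz
    have b0 := hB0 z hz
    have b1 := hB1 z hz
    have b2 := hB2 z hz
    have x0 := hχ0 z hz
    have p1 : -(A * |χ1 z|) ≤ φ1 z * χ1 z := by
      have := neg_abs_le (φ1 z * χ1 z)
      rw [abs_mul] at this
      linarith [mul_le_mul_of_nonneg_right a1 (abs_nonneg (χ1 z))]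
    have p2 : -(A * χ z) ≤ φ2 z * χ z := by
      linarith [mul_le_mul_of_nonneg_right ((neg_le_neg a2).trans (neg_abs_le _)) x0]
    have p3 := neg_abs_le (χ1 z)
    suffices h : -(2 * φ1 z ^ 2 + 2 * φ z * φ2 z + c₀ * φ1 z + G x (φ z)) ≤
        ε * (-(4 * A * |χ1 z|) - 2 * A * χ z + 2 * φ z * χ2 z + 2 * ε * (χ z * χ2 z)
          - c₀ * |χ1 z| - A - |χ1 z| - L * χ z) by
      have q1 := mul_le_mul_of_nonneg_left p1 hε.le
      have q2 := mul_le_mul_of_nonneg_left p2 hε.le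
      have q3 := mul_le_mul_of_nonneg_left p3 (mul_nonneg hc₀.le hε.le)
      have q4 := mul_le_mul_of_nonneg_left (n1.trans' (neg_le_neg a1)) hε.le
      have q5 : -(ε * |χ1 z|) ≤ ε * ε * χ1 z := by
        have e1 := mul_le_mul_of_nonneg_left p3 (mul_nonneg hε.le hε.le)
        have e2 := mul_le_mul_of_nonneg_right (mul_le_mul_of_nonneg_left hε1 hε.le)
          (abs_nonneg (χ1 z))
        linarith
      have q6 : 0 ≤ ε ^ 2 * χ1 z ^ 2 := by positivity
      linarith
    rcases le_total z (l - ρ) with hzρ | hzρ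
    · refine (neg_nonpos.2 (hineq x z hz)).trans (mul_nonneg hε.le ?_)
      have e1 := hE1 z hz
      have hlz1 : ρ ≤ l - z := by linarith
      have hlz2 : l - z ≤ W := by simp only [W]; linarith [hz.1]
      have c2 : Λ ^ 2 * E z * ρ / 2 ≤ χ2 z := by
        have t1 : Λ * E z * 4 ≤ Λ * E z * (Λ * ρ) :=
          mul_le_mul_of_nonneg_left hΛρ (by positivity)
        have t2 : Λ ^ 2 * E z * ρ ≤ Λ ^ 2 * E z * (l - z) :=
          mul_le_mul_of_nonneg_left hlz1 (by positivity)
        simp only [χ2]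
        linarith
      have c20 : 0 ≤ χ2 z := c2.trans' (by positivity)
      have c1 : |χ1 z| ≤ Λ * E z * (W + 1) := by
        have t1 : Λ * E z * (l - z) ≤ Λ * E z * W := mul_le_mul_of_nonneg_left hlz2 (by positivity)
        have t2 : 0 ≤ Λ * E z * (l - z) := mul_nonneg (by positivity) (by linarith)
        have t3 : E z ≤ Λ * E z := le_mul_of_one_le_left (by positivity) hΛ1
        have t4 : 0 ≤ Λ * E z * W := by positivity
        rw [abs_le]
        simp only [χ1]
        constructor <;> linarith
      have c0 : χ z ≤ Λ * E z * W := by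
        have t3 : E z ≤ Λ * E z := le_mul_of_one_le_left (by positivity) hΛ1
        exact mul_le_mul (by linarith) hlz2 (by linarith) (by positivity)
      have cA : A ≤ Λ * E z * A := le_mul_of_one_le_left hA0 (one_le_mul_of_one_le_of_one_le hΛ1 e1)
      have r1 : r * (Λ ^ 2 * E z * ρ) ≤ 2 * φ z * χ2 z := by
        have := mul_le_mul (hrφ z ⟨hz.1, hzρ⟩) c2 (by positivity) (hφ0 z hz)
        linarith
      have r2 : Λ * E z * C ≤ Λ * E z * (r * Λ * ρ) :=
        mul_le_mul_of_nonneg_left hΛC (by positivity)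
      have r3 : (4 * A + c₀ + 1) * |χ1 z| ≤ (4 * A + c₀ + 1) * (Λ * E z * (W + 1)) :=
        mul_le_mul_of_nonneg_left c1 (by positivity)
      have r4 : (2 * A + L) * χ z ≤ (2 * A + L) * (Λ * E z * W) :=
        mul_le_mul_of_nonneg_left c0 (by positivity)
      have r5 : 0 ≤ 2 * ε * (χ z * χ2 z) := by positivity
      rw [hC] at r2
      linarith
    · have s1 := hslack x z ⟨hzρ, hz.2⟩
      have hMz := hM z hz
      have hz0 := hφ0 z hz
      suffices h : -Q ≤ -(4 * A * |χ1 z|) - 2 * A * χ z + 2 * φ z * χ2 z + 2 * ε * (χ z * χ2 z)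
          - c₀ * |χ1 z| - A - |χ1 z| - L * χ z by
        have := mul_le_mul_of_nonneg_left h hε.le
        linarith
      have b0' := (le_abs_self _).trans b0
      have u1 := mul_le_mul_of_nonneg_left b1 (by positivity : 0 ≤ 4 * A + c₀ + 1)
      have u2 := mul_le_mul_of_nonneg_left b0' (by positivity : 0 ≤ 2 * A + L)
      have u3 : -(M * B) ≤ φ z * χ2 z := by
        have := neg_abs_le (φ z * χ2 z)
        rw [abs_mul, abs_of_nonneg hz0] at this
        linarith [mul_le_mul hMz b2 (abs_nonneg _) hM0]
      have u4 : -(B * B) ≤ ε * (χ z * χ2 z) := by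
        have := neg_abs_le (ε * (χ z * χ2 z))
        rw [abs_mul, abs_mul, abs_of_pos hε] at this
        have t1 := mul_le_mul b0 b2 (abs_nonneg _) hBn
        have t2 := mul_le_mul hε1 t1 (by positivity) zero_le_one
        linarith
      rw [hQ]
      linarith

theorem IsReaction.mono {G : ℝ → ℝ → ℝ} {K K' L : ℝ} (h : IsReaction G K L) (h0 : 0 ≤ K')
    (hK : K' ≤ K) : IsReaction G K' L :=
  ⟨h.1, h.2.1, h0, h.2.2.2.1, fun x a b ha haK hb hbK =>
    h.2.2.2.2 x a b ha (haK.trans hK) hb (hbK.trans hK)⟩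

theorem IsLocalMax.deriv_deriv_nonpos {g : ℝ → ℝ} {a : ℝ} (h : IsLocalMax g a)
    (hc : ContinuousAt g a) : deriv (deriv g) a ≤ 0 := by
  by_contra hpos
  have hmin := isLocalMin_of_deriv_deriv_pos (not_le.1 hpos) h.deriv_eq_zero hc
  have he : g =ᶠ[nhds a] fun _ => g a := by
    filter_upwards [h, hmin] with x h1 h2 using le_antisymm h1 h2
  rw [he.deriv.deriv_eq] at hpos
  simp at hpos

/-- A travelling subsolution slightly faster than `c₀`. -/
theorem exists_front {f : ℝ → ℝ → ℝ} {κ φ : ℝ → ℝ} {c₀ l K₁ K L : ℝ} (h : CondF2 2 f κ c₀ l φ)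
    (hG : IsReaction (fun x v => f x v * (κ x - v)) K L) (hφ : ∀ z ∈ Icc (-l) l, φ z < K₁)
    (hK : K₁ ≤ K) :
    ∃ (c : ℝ) (Ψ : ℝ → ℝ), c₀ < c ∧ (∀ z, Ψ z ≤ K₁) ∧ (∀ z < l, 0 < Ψ z) ∧ (∀ z, l ≤ z → Ψ z = 0) ∧
      ∀ T, IsMildSub (fun x v => f x v * (κ x - v)) K T fun x t => Ψ (x + (l - c * t)) := by
  have hineq := condF2_two h
  obtain ⟨hc₀, hl, hreg, hl1, hl2, hpos, hσ, -⟩ := h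
  obtain ⟨d1, d2, c2⟩ := hasDerivWithinAt_of_contDiffOn hl hreg
  obtain ⟨a, ha, hmax⟩ := isCompact_Icc.exists_isMaxOn (nonempty_Icc.2 (by linarith : -l ≤ l))
    hreg.continuousOn
  have h0I : (0 : ℝ) ∈ Ioo (-l) l := ⟨by linarith, hl⟩
  have hMpos : 0 < φ a := (hpos 0 h0I).trans_le (hmax (Ioo_subset_Icc_self h0I))
  have haI : a ∈ Ioo (-l) l :=
    ⟨lt_of_le_of_ne ha.1 fun e => by rw [← e, hl1] at hMpos; exact lt_irrefl _ hMpos,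
      lt_of_le_of_ne ha.2 fun e => by rw [e, hl2] at hMpos; exact lt_irrefl _ hMpos⟩
  have hnhds : ∀ z ∈ Ioo (-l) l, Icc (-l) l ∈ nhds z := fun z hz => Icc_mem_nhds hz.1 hz.2
  have hloc : IsLocalMax φ a := hmax.isLocalMax (hnhds a haI)
  have e1 : derivWithin φ (Icc (-l) l) =ᶠ[nhds a] deriv φ := by
    filter_upwards [Ioo_mem_nhds haI.1 haI.2] with z hz using derivWithin_of_mem_nhds (hnhds z hz)
  have hφ1a : derivWithin φ (Icc (-l) l) a = 0 := e1.eq_of_nhds.trans hloc.deriv_eq_zero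
  have hφ2a : derivWithin (derivWithin φ (Icc (-l) l)) (Icc (-l) l) a ≤ 0 := by
    rw [derivWithin_of_mem_nhds (hnhds a haI), e1.deriv_eq]
    exact hloc.deriv_deriv_nonpos (hreg.continuousOn.continuousAt (hnhds a haI))
  have hGM : ∀ x, 0 ≤ f x (φ a) * (κ x - φ a) := fun x => by
    have := hineq x ha
    rw [hφ1a] at this
    nlinarith
  have hsub : Icc a l ⊆ Icc (-l) l := Icc_subset_Icc_left ha.1
  have hsub' : Ioo a l ⊆ Ioo (-l) l := Ioo_subset_Ioo_left ha.1
  have hK₁ : 0 ≤ K₁ := hMpos.le.trans (hφ a ha).le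
  obtain ⟨c, q, q1, q2, hc, k0, k1, k2, m1, m2, hqa, hq1a, hql, hqpos, hqK, hqineq⟩ :=
    exists_faster_profile (φ := φ) (σ := -derivWithin φ (Icc (-l) l) l) haI.2
      (hreg.continuousOn.mono hsub) (fun z hz => (d2 z (hsub hz)).continuousWithinAt.mono hsub)
      (c2.mono hsub)
      (fun z hz => (d1 z (Ioo_subset_Icc_self (hsub' hz))).hasDerivAt (hnhds z (hsub' hz)))
      (fun z hz => (d2 z (Ioo_subset_Icc_self (hsub' hz))).hasDerivAt (hnhds z (hsub' hz)))
      rfl hφ1a hl2 (neg_neg _).symm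
      (fun z hz => hpos z ⟨by linarith [haI.1, hz.1], hz.2⟩) (fun z hz => hmax (hsub hz))
      (hφ a ha) hc₀ hσ (hG.mono hK₁ hK) (fun x z hz => hineq x (hsub hz))
  refine ⟨c, clampProfile q a l, hc, fun z => ?_, fun z hz => ?_, fun z hz => ?_, fun T => ?_⟩
  · exact (hqK _ ⟨le_max_left _ _, max_le haI.2.le (min_le_right _ _)⟩).2
  · exact hqpos _ ⟨le_max_left _ _, max_lt haI.2 ((min_le_left _ _).trans_lt hz)⟩
  · rw [clampProfile_right haI.2.le hz, hql]
  · exact front_mildSub haI.2.le hG (by rwa [hqa]) k0 k1 k2 m1 m2 hql hq1a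
      (fun z hz => ⟨(hqK z hz).1, (hqK z hz).2.trans hK⟩) hqineq l

theorem CondF1.exists_isReaction {f : ℝ → ℝ → ℝ} {κ : ℝ → ℝ} {θ K : ℝ} (h : CondF1 f κ θ)
    (hK : 0 ≤ K) : ∃ L, IsReaction (fun x v => f x v * (κ x - v)) K L := by
  obtain ⟨hf, hκ, hfp, hκp, hf0, -⟩ := h
  have hreg : ContDiff ℝ 1 (fun q : ℝ × ℝ => f q.1 q.2 * (κ q.1 - q.2)) := by
    refine ((hf : ContDiff ℝ 2 fun q : ℝ × ℝ => f q.1 q.2).mul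
      ((hκ.comp contDiff_fst).sub contDiff_snd)).of_le one_le_two
  obtain ⟨C, hC⟩ := hreg.locallyLipschitz.locallyLipschitzOn.exists_lipschitzOnWith_of_compact
    (s := Icc (0 : ℝ) 1 ×ˢ Icc 0 K) (isCompact_Icc.prod isCompact_Icc)
  refine ⟨C, hreg.continuous, fun x => by simp [hf0], hK, C.2, fun x a b ha haK hb hbK => ?_⟩
  have hper : ∀ v, Function.Periodic (fun x => f x v * (κ x - v)) 1 := fun v x => by
    simp only [hfp, hκp]
  have hfr : ∀ v, f x v * (κ x - v) = f (Int.fract x) v * (κ (Int.fract x) - v) := fun v => by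
    have := (hper v).sub_int_mul_eq (x := x) ⌊x⌋
    rw [mul_one] at this
    exact this.symm
  have hx : Int.fract x ∈ Icc (0 : ℝ) 1 := ⟨Int.fract_nonneg x, (Int.fract_lt_one x).le⟩
  have := hC.dist_le_mul (Int.fract x, a) ⟨hx, ha, haK⟩ (Int.fract x, b) ⟨hx, hb, hbK⟩
  rw [Real.dist_eq, Prod.dist_eq, dist_self, max_eq_right dist_nonneg, Real.dist_eq] at this
  change |f x a * (κ x - a) - f x b * (κ x - b)| ≤ _
  rw [hfr, hfr b]
  exact this

theorem exists_periodic_extrema {p : ℝ → ℝ} (hp : Continuous p) (hper : Function.Periodic p 1) :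
    ∃ y z, ∀ x, p y ≤ p x ∧ p x ≤ p z := by
  obtain ⟨y, -, hy⟩ := isCompact_Icc.exists_isMinOn (nonempty_Icc.2 (zero_le_one (α := ℝ)))
    hp.continuousOn
  obtain ⟨z, -, hz⟩ := isCompact_Icc.exists_isMaxOn (nonempty_Icc.2 (zero_le_one (α := ℝ)))
    hp.continuousOn
  refine ⟨y, z, fun x => ?_⟩
  have hx : Int.fract x ∈ Icc (0 : ℝ) 1 := ⟨Int.fract_nonneg x, (Int.fract_lt_one x).le⟩
  have := hper.sub_int_mul_eq (x := x) ⌊x⌋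
  rw [mul_one] at this
  rw [← this]
  exact ⟨hy hx, hz hx⟩

section
variable {G : ℝ → ℝ → ℝ} {K L T T' : ℝ} {u : ℝ → ℝ → ℝ} {u₀ : ℝ → ℝ} {x t : ℝ}

theorem extendInit_zero : extendInit T u₀ u x 0 = u₀ x := if_pos le_rfl

theorem extendInit_of_mem (ht : t ∈ Ioc 0 T) : extendInit T u₀ u x t = u x t := by
  rw [extendInit, if_neg ht.1.not_ge, min_eq_left ht.2]

theorem IsMildSub.mono (h : IsMildSub G K T u) (hT : T' ≤ T) : IsMildSub G K T' u :=
  ⟨h.1, fun Θ h1 h2 h3 s t h4 h5 h6 => h.2 Θ h1 h2 h3 s t h4 h5 (h6.trans hT)⟩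

theorem IsMildSuper.mono (h : IsMildSuper G K T u) (hT : T' ≤ T) : IsMildSuper G K T' u :=
  ⟨h.1, fun Θ h1 h2 h3 s t h4 h5 h6 => h.2 Θ h1 h2 h3 s t h4 h5 (h6.trans hT)⟩

/-- Solutions emanating from a truncated steady state stay below it. -/
theorem GlobalVeryWeakSol.le_stationary {f : ℝ → ℝ → ℝ} {κ p : ℝ → ℝ} {θ : ℝ}
    (hF : CondF1 f κ θ) (hp : ContDiff ℝ 2 p) (hp0 : ∀ x, 0 ≤ p x) (hK : ∀ x, p x ≤ K)
    (hs : ∀ x, deriv (deriv fun y => p y ^ (2 : ℝ)) x + f x (p x) * (κ x - p x) = 0)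
    (hu0 : ∀ x, 0 ≤ u₀ x) (hup : ∀ x, u₀ x ≤ p x) (hm : Measurable u₀)
    (hsol : GlobalVeryWeakSol 2 f κ u₀ u) (hu : ∀ x, ∀ t > 0, 0 ≤ u x t) {t : ℝ} (ht : 0 < t)
    (x : ℝ) : u x t ≤ p x := by
  obtain ⟨-, ⟨M, hM⟩, -⟩ := hsol t ht
  have hKM : ∀ x, p x ≤ max K M := fun x => (hK x).trans (le_max_left _ _)
  obtain ⟨L, hG⟩ := hF.exists_isReaction ((hp0 0).trans (hKM 0))
  have hsub := (mild_of_veryWeak ht hG (fun x => ⟨hu0 x, (hup x).trans (hKM x)⟩) hm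
    (fun x s hs => ⟨hu x s hs.1, (le_abs_self _).trans ((hM x s hs).trans (le_max_right _ _))⟩)
    (fun s hs => hsol s hs.1)).1
  have := hsub.le (stationary_mildSuper hp (fun x => ⟨hp0 x, hKM x⟩)
    (fun x => by simpa only [Real.rpow_two] using hs x)) hG
    (fun x => by rw [extendInit_zero]; exact hup x) ht le_rfl x
  rwa [extendInit_of_mem ⟨ht, le_rfl⟩] at this

variable {b : ℝ → ℝ}

/-- A front needs at least as long for the next period as for the present one. -/
theorem crossing_time_step (hG : IsReaction G K L) (hper : ∀ x v, G (x + 1) v = G x v)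
    (hsub : ∀ T > 0, IsMildSub G K T (extendInit T u₀ u))
    (hsup : ∀ T > 0, IsMildSuper G K T (extendInit T u₀ u))
    (hle : ∀ t > 0, ∀ x ≤ 0, u (x + 1) t ≤ u₀ x) (h0 : ∀ x > 0, u₀ x = 0)
    (hb : ∀ t > 0, ∀ x, (x < b t → 0 < u x t) ∧ (b t ≤ x → u x t = 0))
    (hmono : StrictMonoOn b (Ioi 0)) {α β γ : ℝ} (hα : 0 < α) (hβ : 0 < β) (hγ : 0 < γ)
    (h1 : b β = b α + 1) (h2 : b γ = b β + 1) : β - α ≤ γ - β := by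
  by_contra! hlt
  have hαβ : α < β := (hmono.lt_iff_lt hα hβ).1 (by linarith)
  have hβγ : β < γ := (hmono.lt_iff_lt hβ hγ).1 (by linarith)
  obtain ⟨s, hs1, hs2⟩ := exists_between hlt
  have hs : 0 < s := by linarith
  have a1 : b (α + s) < b α + 1 := by
    rw [← h1]; exact hmono (mem_Ioi.2 (by linarith)) hβ (by linarith)
  have a2 : b β + 1 < b (β + s) := by
    rw [← h2]; exact hmono hγ (mem_Ioi.2 (by linarith)) (by linarith)
  have hT : 0 < β + s := by linarith
  have hu0 : ∀ x t, 0 < t → 0 ≤ u x t := fun x t ht => by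
    rcases lt_or_ge x (b t) with h | h
    · exact ((hb t ht x).1 h).le
    · exact ((hb t ht x).2 h).ge
  have eV : ∀ x t, 0 < t → t ≤ β + s → extendInit (β + s) u₀ u x t = u x t := fun x t p q =>
      extendInit_of_mem ⟨p, q⟩
  have V0 : ∀ x, extendInit (β + s) u₀ u x 0 = u₀ x := fun x => extendInit_zero
  have Vsub := hsub _ hT
  have Vsup := hsup _ hT
  have Wsub := Vsub.shift (T' := β) hper hs.le le_rfl
  have Wsup := Vsup.shift (T' := β) hper hs.le le_rfl
  have key : ∀ x, u (x + 1) (α + s) ≤ u x α := fun x => by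
    rcases le_or_gt (b (α + s)) (x + 1) with h | h
    · rw [(hb _ (by linarith) _).2 h]
      exact hu0 _ _ hα
    by_contra! hc
    obtain ⟨x₁, hx1, hx2⟩ := exists_between (show b (α + s) - 1 < b α by linarith)
    have := Wsub.no_crossing Wsup (Vsub.mono (by linarith)) (Vsup.mono (by linarith)) hG
      (fun x hx => by
        simp only [zero_add]
        rw [eV _ _ hs (by linarith), V0]
        exact hle s hs x hx)
      (fun x hx => by
        rw [V0, h0 x hx]
        exact (Vsub.1.1 _ _ (by linarith)).1) hα hαβ.le (x₀ := x) (x₁ := x₁) (by linarith)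
      (by rw [eV _ _ hα (by linarith), eV _ _ (by linarith) (by linarith)]; exact hc)
    rw [eV _ _ hα (by linarith), eV _ _ (by linarith) (by linarith),
      (hb _ (by linarith) (x₁ + 1)).2 (by linarith)] at this
    exact this.not_gt ((hb α hα x₁).1 hx2)
  have fin := (Wsub.shift (T' := β - α) (a := 0) (s₀ := α) (by simp) hα.le (by linarith)).le
    ((Vsup.shift (T' := β - α) (a := 0) (s₀ := α) (by simp) hα.le (by linarith))) hG
    (fun x => by
      simp only [zero_add, add_zero]
      rw [eV _ _ hα (by linarith), eV _ _ (by linarith) (by linarith)]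
      exact key x) (t := β - α) (by linarith) le_rfl (b β)
  simp only [add_zero, sub_add_cancel] at fin
  rw [eV _ _ hβ (by linarith), eV _ _ hT le_rfl, (hb β hβ _).2 le_rfl] at fin
  exact fin.not_gt ((hb _ hT _).1 a2)

/-- The front stays ahead of a travelling subsolution. -/
theorem front_lower_bound {l c : ℝ} {Ψ : ℝ → ℝ} (hG : IsReaction G K L)
    (hsup : ∀ T > 0, IsMildSuper G K T (extendInit T u₀ u))
    (hΨ : ∀ T, IsMildSub G K T fun x t => Ψ (x + (l - c * t)))
    (hle : ∀ x, Ψ (x + l) ≤ u₀ x) (hpos : ∀ z < l, 0 < Ψ z)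
    (hb : ∀ t > 0, ∀ x, (x < b t → 0 < u x t) ∧ (b t ≤ x → u x t = 0)) {t : ℝ} (ht : 0 < t) :
    c * t ≤ b t := by
  by_contra! h
  have := (hΨ t).le (hsup t ht) hG
    (fun x => by rw [mul_zero, sub_zero, extendInit_zero]; exact hle x) ht le_rfl (b t)
  rw [extendInit_of_mem ⟨ht, le_rfl⟩, (hb t ht _).2 le_rfl] at this
  exact this.not_gt (hpos _ (by linarith))

/-- Nondecreasing increments of a sequence of linear growth converge. -/
theorem exists_tendsto_increments {a : ℕ → ℝ} {C : ℝ} (h0 : ∀ n, 0 ≤ a n) (hpos : a 0 < a 1)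
    (hmono : Monotone fun n => a (n + 1) - a n) (hC : ∀ n : ℕ, a n ≤ C * (n + 1)) :
    ∃ T, 0 < T ∧ T ≤ C ∧ Tendsto (fun n => a (n + 1) - a n) atTop (nhds T) := by
  have tel : ∀ n k : ℕ, a n + k * (a (n + 1) - a n) ≤ a (n + k) := fun n k => by
    induction k with
    | zero => simp
    | succ k ih =>
      have := hmono (Nat.le_add_right n k)
      dsimp only at this
      push_cast
      rw [← add_assoc]
      linarith
  have hbd : ∀ n, a (n + 1) - a n ≤ C := fun n => by
    by_contra! h
    obtain ⟨k, hk⟩ := exists_nat_gt (C * (n + 1) / (a (n + 1) - a n - C))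
    rw [div_lt_iff₀ (by linarith)] at hk
    have h1 := tel n k
    have h2 := hC (n + k)
    push_cast at h2
    linarith [h0 n]
  have ht := tendsto_atTop_ciSup hmono ⟨C, by rintro _ ⟨n, rfl⟩; exact hbd n⟩
  refine ⟨_, ?_, le_of_tendsto' ht hbd, ht⟩
  refine lt_of_lt_of_le ?_ (hmono.ge_of_tendsto ht 0)
  simpa using hpos

end

/-- In the renormalization setting, the crossing times
`s_n = t_{n+1} - t_n` are nondecreasing in `n` and converge to some `T ∈ (0, 1/c₀)`;
equivalently the average speeds `1/s_n` decrease to `1/T > c₀`. -/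
theorem crossing_times_monotone_converge
    (m : ℝ) (hm : 1 < m) (f : ℝ → ℝ → ℝ) (κ : ℝ → ℝ) (θ c₀ l₀ : ℝ) (φ₀ p : ℝ → ℝ)
    (u : ℝ → ℝ → ℝ) (b : ℝ → ℝ) (ty : ℝ → ℝ)
    (hset : RenormSetting m f κ θ c₀ l₀ φ₀ p u b ty) :
    (∀ n : ℕ, 1 ≤ n →
      ty ((n : ℝ) + 1) - ty (n : ℝ) ≤ ty ((n : ℝ) + 2) - ty ((n : ℝ) + 1)) ∧
    ∃ T : ℝ, 0 < T ∧ T < 1 / c₀ ∧ c₀ < 1 / T ∧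
      Tendsto (fun n : ℕ => ty ((n : ℝ) + 1) - ty (n : ℝ)) atTop (nhds T) := by
  obtain ⟨hF, hF2, hp, hp0, hpper, hps, -, hφ, hsol, -, -, hb, hmono, -, -, -, hty⟩ := hset
  obtain rfl := condF2_exponent hm hF.2.2.2.2.1 hF2
  set u₀ : ℝ → ℝ := fun x => if x ≤ 0 then p x else 0 with hu₀
  obtain ⟨y, z, hyz⟩ := exists_periodic_extrema hp.continuous hpper
  have hP : 0 ≤ p z := (hp0 z).le
  obtain ⟨L, hG⟩ := hF.exists_isReaction hP
  have hper : ∀ x v, f (x + 1) v * (κ (x + 1) - v) = f x v * (κ x - v) := fun x v => by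
    rw [hF.2.2.1, hF.2.2.2.1]
  have hu₀p : ∀ x, 0 ≤ u₀ x ∧ u₀ x ≤ p x := fun x => by
    rw [hu₀]
    dsimp only
    split_ifs
    exacts [⟨(hp0 x).le, le_rfl⟩, ⟨le_rfl, (hp0 x).le⟩]
  have hm₀ : Measurable u₀ := hp.continuous.measurable.ite measurableSet_Iic measurable_const
  have hu : ∀ x, ∀ t > 0, 0 ≤ u x t := fun x t ht => by
    rcases lt_or_ge x (b t) with h | h
    · exact ((hb t ht x).1 h).le
    · exact ((hb t ht x).2 h).ge
  have hup : ∀ t > 0, ∀ x, u x t ≤ p x := fun t ht x =>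
    hsol.le_stationary hF hp (fun x => (hp0 x).le) (fun x => (hyz x).2) hps (fun x => (hu₀p x).1)
      (fun x => (hu₀p x).2) hm₀ hu ht x
  have hmild : ∀ T > (0 : ℝ), _ := fun T hT => mild_of_veryWeak hT hG
    (fun x => ⟨(hu₀p x).1, (hu₀p x).2.trans (hyz x).2⟩) hm₀
    (fun x t ht => ⟨hu x t ht.1, (hup t ht.1 x).trans (hyz x).2⟩) fun t ht => hsol t ht.1
  have hstep : ∀ a : ℝ, 0 < a → ty (a + 1) - ty a ≤ ty (a + 2) - ty (a + 1) := fun a ha => by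
    obtain ⟨t0, b0⟩ := hty a ha
    obtain ⟨t1, b1⟩ := hty (a + 1) (by linarith)
    obtain ⟨t2, b2⟩ := hty (a + 2) (by linarith)
    refine crossing_time_step hG hper (fun T hT => (hmild T hT).1) (fun T hT => (hmild T hT).2)
      (fun t ht x hx => ?_) (fun x hx => if_neg hx.not_ge) hb hmono t0 t1 t2 (by rw [b0, b1])
      (by rw [b1, b2]; ring)
    rw [hu₀]
    dsimp only
    rw [if_pos hx, ← hpper x]
    exact hup t ht _
  obtain ⟨c, Ψ, hc, hΨK, hΨpos, hΨ0, hΨ⟩ := exists_front hF2 hG (K₁ := p y)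
    (fun z hz => by simpa using hφ (y - z) y ⟨by linarith [hz.1], by linarith [hz.2]⟩) (hyz y).2
  have hc₀ : 0 < c₀ := hF2.1
  have hcpos : 0 < c := hc₀.trans hc
  have hfront : ∀ t > 0, c * t ≤ b t := fun t ht =>
    front_lower_bound hG (fun T hT => (hmild T hT).2) hΨ (fun x => by
      rw [hu₀]
      dsimp only
      split_ifs with hx
      · exact (hΨK _).trans (hyz x).1
      · exact (hΨ0 _ (by linarith)).le) hΨpos hb ht
  have hn : ∀ n : ℕ, (0 : ℝ) < n + 1 := fun n => by positivity
  obtain ⟨T, hT0, hTc, hT⟩ := exists_tendsto_increments (a := fun n : ℕ => ty (n + 1))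
    (C := 1 / c) (fun n => (hty _ (hn n)).1.le)
    (by
      refine (hmono.lt_iff_lt (hty _ (hn 0)).1 (hty _ (hn 1)).1).1 ?_
      rw [(hty _ (hn 0)).2, (hty _ (hn 1)).2]
      norm_num)
    (monotone_nat_of_le_succ fun n => by
      have := hstep (n + 1) (hn n)
      push_cast
      rwa [show (n : ℝ) + 1 + 1 + 1 = n + 1 + 2 by ring])
    (fun n => by
      have := hfront _ (hty _ (hn n)).1
      rw [(hty _ (hn n)).2] at this
      rw [div_mul_eq_mul_div, one_mul, le_div_iff₀ hcpos]
      linarith)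
  have hTlt : T < 1 / c₀ := hTc.trans_lt (one_div_lt_one_div_of_lt hc₀ hc)
  refine ⟨fun n h1 => hstep n (by exact_mod_cast h1), T, hT0, hTlt, ?_, ?_⟩
  · rwa [lt_one_div hc₀ hT0]
  · refine (tendsto_add_atTop_iff_nat 1).1 (hT.congr fun n => ?_)
    push_cast
    rfl
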